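/- Suppose that (λ−3)n > 2δ + 2γ. Let 1 < p < ∞, ω ∈ A₁, and f ∈ BMO^p(ω). If G*_λ(f)(x₀) < +∞ for at least one point x₀ ∈ ℝⁿ, then G*_λ(f) is finite almost everywhere on ℝⁿ, and there exists a constant C > 0 independent of f such that ‖G*_λ(f)‖_{BLO^p(ω)} ≤ C · ‖f‖_{BMO^p(ω)}. -/

import Mathlib

open MeasureTheory Metric Set ENNReal

noncomputable section

namespace LPW

variable {n : ℕ}

/-- n-dimensional Euclidean space. -/
abbrev Rn (n : ℕ) := EuclideanSpace ℝ (Fin n)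

/-- Axis-parallel open cube with center `c` and half-side `h`. -/
def cube (c : Rn n) (h : ℝ) : Set (Rn n) := {y : Rn n | ∀ i, |y i - c i| < h}

/-- The ω-measure `ω(E) = ∫_E ω`. -/
def wInt (ω : Rn n → ℝ) (E : Set (Rn n)) : ℝ := ∫ x in E, ω x

/-- The Lebesgue mean value `f_E = (1/m(E)) ∫_E f`. -/
def avg (f : Rn n → ℝ) (E : Set (Rn n)) : ℝ := ((volume E).toReal)⁻¹ * ∫ x in E, f x

/-- Weighted mean oscillation `(1/ω(E)) ∫_E |f - f_E|`. -/
def bmoAvg (ω f : Rn n → ℝ) (E : Set (Rn n)) : ℝ :=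
  (wInt ω E)⁻¹ * ∫ x in E, |f x - avg f E|

/-- Weighted lower oscillation `(1/ω(E)) ∫_E (f - essinf_E f)`. -/
def bloAvg (ω f : Rn n → ℝ) (E : Set (Rn n)) : ℝ :=
  (wInt ω E)⁻¹ * ∫ x in E, (f x - essInf f (volume.restrict E))

/-- `‖f‖_{BMO(ω)}`, supremum over all balls, valued in `[0,∞]`. -/
def bmoNorm (ω f : Rn n → ℝ) : ℝ≥0∞ :=
  ⨆ (c : Rn n) (ρ : ℝ) (_ : 0 < ρ), ENNReal.ofReal (bmoAvg ω f (Metric.ball c ρ))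

/-- `‖f‖_{BLO(ω)}`, supremum over all balls, valued in `[0,∞]`. -/
def bloNorm (ω f : Rn n → ℝ) : ℝ≥0∞ :=
  ⨆ (c : Rn n) (ρ : ℝ) (_ : 0 < ρ), ENNReal.ofReal (bloAvg ω f (Metric.ball c ρ))

/-- `‖f‖_{L^∞(ω)}`, supremum over all balls of `(essinf_B ω)⁻¹ · esssup_B |f|`. -/
def linfNorm (ω f : Rn n → ℝ) : ℝ≥0∞ :=
  ⨆ (c : Rn n) (ρ : ℝ) (_ : 0 < ρ),
    ENNReal.ofReal ((essInf ω (volume.restrict (Metric.ball c ρ)))⁻¹ *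
      essSup (fun x => |f x|) (volume.restrict (Metric.ball c ρ)))

/-- `‖f‖_{BMO(ω)}` taken over cubes. -/
def bmoNormC (ω f : Rn n → ℝ) : ℝ≥0∞ :=
  ⨆ (c : Rn n) (h : ℝ) (_ : 0 < h), ENNReal.ofReal (bmoAvg ω f (cube c h))

/-- `‖f‖_{BLO(ω)}` taken over cubes. -/
def bloNormC (ω f : Rn n → ℝ) : ℝ≥0∞ :=
  ⨆ (c : Rn n) (h : ℝ) (_ : 0 < h), ENNReal.ofReal (bloAvg ω f (cube c h))

/-- `‖f‖_{BMO^p(ω)}` taken over cubes (extended-valued). -/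
def bmoPNorm (p : ℝ) (ω f : Rn n → ℝ) : ℝ≥0∞ :=
  ⨆ (c : Rn n) (h : ℝ) (_ : 0 < h),
    ((ENNReal.ofReal (wInt ω (cube c h)))⁻¹ *
      ∫⁻ x in cube c h,
        ENNReal.ofReal (|f x - avg f (cube c h)| ^ p * (ω x) ^ (1 - p))) ^ (1/p)

/-- `‖f‖_{BLO^p(ω)}` taken over cubes (extended-valued). -/
def bloPNorm (p : ℝ) (ω f : Rn n → ℝ) : ℝ≥0∞ :=
  ⨆ (c : Rn n) (h : ℝ) (_ : 0 < h),
    ((ENNReal.ofReal (wInt ω (cube c h)))⁻¹ *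
      ∫⁻ x in cube c h,
        ENNReal.ofReal ((f x - essInf f (volume.restrict (cube c h))) ^ p * (ω x) ^ (1 - p))) ^ (1/p)

/-- A weight: nonnegative, locally integrable, positive a.e. -/
def IsWeight (ω : Rn n → ℝ) : Prop :=
  (∀ x, 0 ≤ ω x) ∧ LocallyIntegrable ω volume ∧
    ∀ᵐ x ∂(volume : Measure (Rn n)), 0 < ω x

/-- `C` is an `A₁` bound for `ω` (over balls). -/
def A1ballBound (ω : Rn n → ℝ) (C : ℝ) : Prop :=
  0 < C ∧ ∀ (c : Rn n) (ρ : ℝ), 0 < ρ →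
    avg ω (Metric.ball c ρ) ≤ C * essInf ω (volume.restrict (Metric.ball c ρ))

/-- `ω ∈ A₁` (over balls). -/
def IsA1ball (ω : Rn n → ℝ) : Prop := ∃ C, A1ballBound ω C

/-- `[ω]_{A₁}` (over balls), the least `A₁` bound. -/
def A1ballConst (ω : Rn n → ℝ) : ℝ := sInf {C | A1ballBound ω C}

/-- `C` is an `A₁` bound for `ω` (over cubes). -/
def A1cubeBound (ω : Rn n → ℝ) (C : ℝ) : Prop :=
  0 < C ∧ ∀ (c : Rn n) (h : ℝ), 0 < h →
    avg ω (cube c h) ≤ C * essInf ω (volume.restrict (cube c h))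

/-- `ω ∈ A₁` (over cubes). -/
def IsA1cube (ω : Rn n → ℝ) : Prop := ∃ C, A1cubeBound ω C

/-- `[ω]_{A₁}` (over cubes), the least `A₁` bound. -/
def A1cubeConst (ω : Rn n → ℝ) : ℝ := sInf {C | A1cubeBound ω C}

/-- `C` is an `A₂` bound for `ω` (over balls). -/
def A2ballBound (ω : Rn n → ℝ) (C : ℝ) : Prop :=
  0 < C ∧ ∀ (c : Rn n) (ρ : ℝ), 0 < ρ →
    avg ω (Metric.ball c ρ) * avg (fun x => (ω x)⁻¹) (Metric.ball c ρ) ≤ C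

/-- `ω ∈ A₂` (over balls). -/
def IsA2ball (ω : Rn n → ℝ) : Prop := ∃ C, A2ballBound ω C

/-- `[ω]_{A₂}` (over balls), the least `A₂` bound. -/
def A2ballConst (ω : Rn n → ℝ) : ℝ := sInf {C | A2ballBound ω C}

/-- Conditions (P1), (P2), (P3) on the kernel ψ. -/
def PsiKernel (n : ℕ) (C₁ C₂ δ γ : ℝ) (ψ : Rn n → ℝ) : Prop :=
  Integrable ψ volume ∧ (∫ x, ψ x) = 0 ∧
  (∀ x : Rn n, |ψ x| ≤ C₁ * (1 + ‖x‖) ^ (-((n : ℝ) + δ))) ∧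
  (∀ x h : Rn n, 2 * ‖h‖ ≤ ‖x‖ →
    |ψ (x + h) - ψ x| ≤ C₂ * ‖h‖ ^ γ * (1 + ‖x‖) ^ (-((n : ℝ) + δ + γ)))

/-- The convolution `(ψ_t * f)(x)` where `ψ_t(x) = t^{-n} ψ(x/t)`. -/
def cvl (ψ : Rn n → ℝ) (t : ℝ) (f : Rn n → ℝ) (x : Rn n) : ℝ :=
  ∫ y, (t ^ n)⁻¹ * ψ (t⁻¹ • (x - y)) * f y

/-- The generalized Littlewood–Paley g-function `G(f)(x)`, valued in `[0,∞]`. -/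
def Gfun (ψ f : Rn n → ℝ) (x : Rn n) : ℝ≥0∞ :=
  (∫⁻ t in Ioi (0:ℝ), ENNReal.ofReal ((cvl ψ t f x) ^ 2 / t)) ^ (1/2 : ℝ)

/-- The dilated Lusin area integral `S_a(f)(x)` (aperture `a`), valued in `[0,∞]`. -/
def Sdil (ψ : Rn n → ℝ) (a : ℝ) (f : Rn n → ℝ) (x : Rn n) : ℝ≥0∞ :=
  (∫⁻ t in Ioi (0:ℝ), ∫⁻ y in Metric.ball x (a * t),
      ENNReal.ofReal ((cvl ψ t f y) ^ 2 / t ^ (n + 1))) ^ (1/2 : ℝ)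

/-- The generalized Lusin area integral `S(f)(x)`, valued in `[0,∞]`. -/
def Sfun (ψ f : Rn n → ℝ) (x : Rn n) : ℝ≥0∞ := Sdil ψ 1 f x

/-- Stein's function `G*_λ(f)(x)`, valued in `[0,∞]`. -/
def Gstar (ψ : Rn n → ℝ) (lam : ℝ) (f : Rn n → ℝ) (x : Rn n) : ℝ≥0∞ :=
  (∫⁻ t in Ioi (0:ℝ), ∫⁻ y,
      ENNReal.ofReal ((t / (t + dist x y)) ^ (lam * (n : ℝ)) *
        (cvl ψ t f y) ^ 2 / t ^ (n + 1))) ^ (1/2 : ℝ)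



lemma isOpen_cube (c : Rn n) (h : ℝ) : IsOpen (cube c h) := by
  have : cube c h = ⋂ i, {y : Rn n | |y i - c i| < h} := by ext y; simp [cube]
  rw [this]
  refine isOpen_iInter_of_finite fun i => ?_
  exact isOpen_lt (by fun_prop) continuous_const

lemma measurableSet_cube (c : Rn n) (h : ℝ) : MeasurableSet (cube c h) :=
  (isOpen_cube c h).measurableSet

lemma volume_preimage_pi (s : Fin n → Set ℝ) (hs : ∀ i, MeasurableSet (s i)) :
    volume {y : Rn n | ∀ i, y i ∈ s i} = ∏ i, volume (s i) := by
  have h1 := (EuclideanSpace.volume_preserving_symm_measurableEquiv_toLp (Fin n))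
  have h2 : {y : Rn n | ∀ i, y i ∈ s i} =
      (MeasurableEquiv.toLp 2 (Fin n → ℝ)).symm ⁻¹' (Set.pi univ s) := by
    ext y; simp [Set.mem_pi]
  rw [h2, h1.measure_preimage (MeasurableSet.univ_pi hs).nullMeasurableSet, volume_pi_pi]

lemma volume_cube (c : Rn n) {h : ℝ} (hh : 0 ≤ h) :
    volume (cube c h) = ENNReal.ofReal ((2 * h) ^ n) := by
  have h2 : cube c h = {y : Rn n | ∀ i, y i ∈ Ioo (c i - h) (c i + h)} := by
    ext y; simp only [cube, Set.mem_ofPred_eq, mem_Ioo, abs_lt]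
    refine forall_congr' fun i => ?_
    constructor <;> rintro ⟨h1, h2⟩ <;> constructor <;> linarith
  rw [h2, volume_preimage_pi _ (fun i => measurableSet_Ioo)]
  have h3 : ∀ i, volume (Ioo (c i - h) (c i + h)) = ENNReal.ofReal (2 * h) := fun i => by
    rw [Real.volume_Ioo]; congr 1; ring
  simp only [h3]
  rw [Finset.prod_const, Finset.card_univ, Fintype.card_fin, ← ENNReal.ofReal_pow (by linarith)]

lemma volume_cube_toReal (c : Rn n) {h : ℝ} (hh : 0 ≤ h) :
    (volume (cube c h)).toReal = (2 * h) ^ n := by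
  rw [volume_cube c hh, ENNReal.toReal_ofReal (by positivity)]

lemma volume_cube_pos (c : Rn n) {h : ℝ} (hh : 0 < h) : 0 < volume (cube c h) := by
  rw [volume_cube c hh.le]; simp; positivity

lemma volume_cube_ne_top (c : Rn n) {h : ℝ} (hh : 0 < h) : volume (cube c h) ≠ ⊤ := by
  rw [volume_cube c hh.le]; simp

lemma cube_norm_le {c y : Rn n} {h : ℝ} (hh : 0 ≤ h) (hy : y ∈ cube c h) :
    ‖y - c‖ ≤ √n * h := by
  rw [EuclideanSpace.norm_eq]
  have : ∑ i, ‖(y - c) i‖ ^ 2 ≤ n * h ^ 2 := by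
    calc ∑ i, ‖(y - c) i‖ ^ 2 ≤ ∑ i : Fin n, h ^ 2 := by
          refine Finset.sum_le_sum fun i _ => ?_
          have := (hy i).le
          simp only [PiLp.sub_apply, Real.norm_eq_abs]
          gcongr
      _ = n * h ^ 2 := by simp
  calc √(∑ i, ‖(y - c) i‖ ^ 2) ≤ √(n * h ^ 2) := Real.sqrt_le_sqrt this
    _ = √n * h := by rw [Real.sqrt_mul (by positivity), Real.sqrt_sq hh]

lemma mem_cube_of_norm {c y : Rn n} {h : ℝ} (hy : ‖y - c‖ < h) : y ∈ cube c h := by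
  intro i
  have := PiLp.norm_apply_le (y - c) i
  simp only [PiLp.sub_apply, Real.norm_eq_abs] at this
  linarith

lemma cube_mono (c : Rn n) {h h' : ℝ} (hh : h ≤ h') : cube c h ⊆ cube c h' :=
  fun _ hy i => (hy i).trans_le hh

lemma cube_subset_closedBall (c : Rn n) {h : ℝ} (hh : 0 ≤ h) :
    cube c h ⊆ closedBall c (√n * h) := fun y hy => by
  rw [mem_closedBall, dist_eq_norm]; exact cube_norm_le hh hy

lemma integrableOn_cube {f : Rn n → ℝ} (hf : LocallyIntegrable f volume) (c : Rn n) {h : ℝ}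
    (hh : 0 ≤ h) : IntegrableOn f (cube c h) volume :=
  (hf.integrableOn_isCompact (isCompact_closedBall c (√n * h))).mono_set
    (cube_subset_closedBall c hh)

lemma setIntegral_cube_eq_avg (f : Rn n → ℝ) (c : Rn n) {h : ℝ} (hh : 0 < h) :
    ∫ x in cube c h, f x = (2 * h) ^ n * avg f (cube c h) := by
  rw [avg, volume_cube_toReal c hh.le]; field_simp

/-- scaling constant -/
lemma lintegral_scaled (t : ℝ) (ht : 0 < t) (c : Rn n) (g : Rn n → ℝ≥0∞) :
    ∫⁻ y, g (t⁻¹ • (y - c)) = ENNReal.ofReal (t ^ n) * ∫⁻ y, g y := by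
  have h0 : (∫⁻ y, g (t⁻¹ • (y - c))) = ∫⁻ y, g (t⁻¹ • y) :=
    lintegral_sub_right_eq_self (μ := (volume : Measure (Rn n))) (fun y => g (t⁻¹ • y)) c
  rw [h0]
  have ht' : t⁻¹ ≠ 0 := by positivity
  have h2 : Measure.map (fun y : Rn n => t⁻¹ • y) volume = ENNReal.ofReal (t ^ n) • volume := by
    have := Measure.map_addHaar_smul (volume : Measure (Rn n)) ht'
    rw [this]; congr 2
    simp [abs_of_pos ht]
  have hm : MeasurableEmbedding (fun y : Rn n => t⁻¹ • y) :=
    (Homeomorph.smulOfNeZero t⁻¹ ht').measurableEmbedding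
  rw [← hm.lintegral_map (μ := volume) g, h2, lintegral_smul_measure, smul_eq_mul]

/-- the Japanese bracket constant -/
def JB (n : ℕ) (κ : ℝ) : ℝ≥0∞ := ∫⁻ y : Rn n, ENNReal.ofReal ((1 + ‖y‖) ^ (-κ))

lemma JB_lt_top {κ : ℝ} (hκ : (n : ℝ) < κ) : JB n κ < ⊤ := by
  apply finite_integral_one_add_norm
  simpa using hκ

lemma bracket_eq {t : ℝ} (ht : 0 < t) (κ : ℝ) {d : ℝ} (hd : 0 ≤ d) :
    (t / (t + d)) ^ κ = (1 + t⁻¹ * d) ^ (-κ) := by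
  have h1 : t / (t + d) = (1 + t⁻¹ * d)⁻¹ := by field_simp
  rw [h1, Real.inv_rpow (by positivity), Real.rpow_neg (by positivity)]

lemma lintegral_bracket {t : ℝ} (ht : 0 < t) (c : Rn n) (κ : ℝ) :
    ∫⁻ y, ENNReal.ofReal ((t / (t + dist c y)) ^ κ) = ENNReal.ofReal (t ^ n) * JB n κ := by
  rw [JB, ← lintegral_scaled t ht c]
  refine lintegral_congr fun y => ?_
  rw [bracket_eq ht κ dist_nonneg, norm_smul, dist_comm, dist_eq_norm, Real.norm_eq_abs,
    abs_of_pos (inv_pos.2 ht)]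

lemma psi_continuousAt {C₁ C₂ δ γ : ℝ} (hγ : 0 < γ) {ψ : Rn n → ℝ}
    (hψ : PsiKernel n C₁ C₂ δ γ ψ) {x : Rn n} (hx : x ≠ 0) : ContinuousAt ψ x := by
  obtain ⟨-, -, -, h3⟩ := hψ
  rw [ContinuousAt, tendsto_iff_dist_tendsto_zero]
  have hlim : Filter.Tendsto (fun y : Rn n => C₂ * ‖y - x‖ ^ γ * (1 + ‖x‖) ^ (-((n : ℝ) + δ + γ)))
      (nhds x) (nhds 0) := by
    have hc : ContinuousAt (fun y : Rn n => C₂ * ‖y - x‖ ^ γ * (1 + ‖x‖) ^ (-((n : ℝ) + δ + γ))) x := by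
      refine ContinuousAt.mul (ContinuousAt.mul continuousAt_const ?_) continuousAt_const
      exact ContinuousAt.rpow_const (by fun_prop) (Or.inr hγ.le)
    have := hc.tendsto
    simpa [Real.zero_rpow hγ.ne'] using this
  refine squeeze_zero' (Filter.Eventually.of_forall fun _ => dist_nonneg) ?_ hlim
  have hx' : 0 < ‖x‖ / 2 := by positivity
  filter_upwards [Metric.ball_mem_nhds x hx'] with y hy
  have hy' : 2 * ‖y - x‖ ≤ ‖x‖ := by
    rw [mem_ball, dist_eq_norm] at hy; linarith
  have := h3 x (y - x) hy'
  rwa [add_sub_cancel] at this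

lemma psi_measurable {C₁ C₂ δ γ : ℝ} (hγ : 0 < γ) {ψ : Rn n → ℝ}
    (hψ : PsiKernel n C₁ C₂ δ γ ψ) : Measurable ψ :=
  measurable_of_continuousOn_compl_singleton 0 fun _ hx =>
    (psi_continuousAt hγ hψ hx).continuousWithinAt

lemma cvl_congr_ae (ψ : Rn n → ℝ) {f g : Rn n → ℝ} (h : f =ᵐ[volume] g) (t : ℝ) (x : Rn n) :
    cvl ψ t f x = cvl ψ t g x := by
  refine integral_congr_ae ?_
  filter_upwards [h] with y hy
  rw [hy]

lemma cvl_measurable {ψ : Rn n → ℝ} (hψ : Measurable ψ) {f : Rn n → ℝ}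
    (hf : AEStronglyMeasurable f volume) :
    Measurable (fun q : ℝ × Rn n => cvl ψ q.1 f q.2) := by
  have h1 : (fun q : ℝ × Rn n => cvl ψ q.1 f q.2) = fun q => cvl ψ q.1 (hf.mk f) q.2 := by
    funext q; exact cvl_congr_ae ψ hf.ae_eq_mk _ _
  rw [h1]
  have hm : Measurable (hf.mk f) := hf.stronglyMeasurable_mk.measurable
  have h2 : StronglyMeasurable (fun r : (ℝ × Rn n) × Rn n =>
      (r.1.1 ^ n)⁻¹ * ψ (r.1.1⁻¹ • (r.1.2 - r.2)) * hf.mk f r.2) := by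
    apply Measurable.stronglyMeasurable
    refine Measurable.mul (Measurable.mul (by fun_prop) (hψ.comp ?_)) (hm.comp measurable_snd)
    fun_prop
  exact (h2.integral_prod_right).measurable

/-- the weight in Stein's function -/
def wk (lam t : ℝ) (x y : Rn n) : ℝ≥0∞ :=
  ENNReal.ofReal ((t / (t + dist x y)) ^ (lam * (n : ℝ)) / t ^ (n + 1))

/-- Square functional underlying `Gstar`. -/
def SQ (lam : ℝ) (F : ℝ → Rn n → ℝ≥0∞) (x : Rn n) : ℝ≥0∞ :=
  ∫⁻ t in Ioi (0:ℝ), ∫⁻ y, wk lam t x y * (F t y) ^ 2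

lemma Gstar_eq (ψ : Rn n → ℝ) (lam : ℝ) (f : Rn n → ℝ) (x : Rn n) :
    Gstar ψ lam f x = (SQ lam (fun t y => ‖cvl ψ t f y‖ₑ) x) ^ (1/2 : ℝ) := by
  rw [Gstar, SQ]
  congr 1
  refine setLIntegral_congr_fun measurableSet_Ioi fun t (ht : 0 < t) => ?_
  refine lintegral_congr fun y => ?_
  rw [wk, Real.enorm_eq_ofReal_abs, ← ENNReal.ofReal_pow (abs_nonneg _), sq_abs,
    ← ENNReal.ofReal_mul (by positivity)]
  congr 1; ring

lemma wk_measurable (lam : ℝ) :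
    Measurable (fun r : (Rn n × ℝ) × Rn n => wk lam r.1.2 r.1.1 r.2) := by
  unfold wk
  fun_prop

lemma SQ_measurable (lam : ℝ) {F : ℝ → Rn n → ℝ≥0∞}
    (hF : Measurable (fun q : ℝ × Rn n => F q.1 q.2)) : Measurable (SQ lam F) := by
  unfold SQ
  have h1 : Measurable (fun r : (Rn n × ℝ) × Rn n => wk lam r.1.2 r.1.1 r.2 * F r.1.2 r.2 ^ 2) := by
    refine (wk_measurable lam).mul (Measurable.pow_const ?_ 2)
    exact hF.comp (f := fun r : (Rn n × ℝ) × Rn n => (r.1.2, r.2)) (by fun_prop)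
  have h2 := h1.lintegral_prod_right' (ν := (volume : Measure (Rn n)))
  exact h2.lintegral_prod_right' (ν := (volume : Measure ℝ).restrict (Ioi 0))

lemma Gstar_measurable {ψ : Rn n → ℝ} (hψ : Measurable ψ) (lam : ℝ) {f : Rn n → ℝ}
    (hf : AEStronglyMeasurable f volume) : Measurable (Gstar ψ lam f) := by
  have : Gstar ψ lam f = fun x => (SQ lam (fun t y => ‖cvl ψ t f y‖ₑ) x) ^ (1/2 : ℝ) :=
    funext fun x => Gstar_eq ψ lam f x
  rw [this]
  exact (SQ_measurable lam (cvl_measurable hψ hf).enorm).pow_const _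

lemma SQ_mono (lam : ℝ) {F G : ℝ → Rn n → ℝ≥0∞} (x : Rn n)
    (h : ∀ t > 0, ∀ y, F t y ≤ G t y) : SQ lam F x ≤ SQ lam G x := by
  refine setLIntegral_mono' measurableSet_Ioi fun t ht => ?_
  refine lintegral_mono fun y => ?_
  gcongr
  exact h t ht y

lemma lintegral_wk {lam t : ℝ} (ht : 0 < t) (y : Rn n) :
    ∫⁻ x, wk lam t x y = JB n (lam * n) * ENNReal.ofReal (1 / t) := by
  unfold wk
  have : ∀ x : Rn n, ENNReal.ofReal ((t / (t + dist x y)) ^ (lam * (n : ℝ)) / t ^ (n + 1)) =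
      ENNReal.ofReal ((t ^ (n + 1))⁻¹) * ENNReal.ofReal ((t / (t + dist y x)) ^ (lam * (n : ℝ))) := by
    intro x
    rw [← ENNReal.ofReal_mul (by positivity), dist_comm, div_eq_inv_mul (_ ^ _)]
  simp_rw [this]
  rw [lintegral_const_mul' _ _ (by simp), lintegral_bracket ht, ← mul_assoc,
    ← ENNReal.ofReal_mul (by positivity), mul_comm]
  congr 2
  field_simp
  ring

lemma lintegral_SQ (lam : ℝ) {F : ℝ → Rn n → ℝ≥0∞}
    (hF : Measurable (fun q : ℝ × Rn n => F q.1 q.2)) :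
    ∫⁻ x, SQ lam F x =
      JB n (lam * n) * ∫⁻ t in Ioi (0:ℝ), ENNReal.ofReal (1 / t) * ∫⁻ y, F t y ^ 2 := by
  unfold SQ
  have h1 : Measurable (fun r : (Rn n × ℝ) × Rn n => wk lam r.1.2 r.1.1 r.2 * F r.1.2 r.2 ^ 2) := by
    refine (wk_measurable lam).mul (Measurable.pow_const ?_ 2)
    exact hF.comp (f := fun r : (Rn n × ℝ) × Rn n => (r.1.2, r.2)) (by fun_prop)
  have h2 := h1.lintegral_prod_right' (ν := (volume : Measure (Rn n)))
  have h4 : Measurable fun t => ∫⁻ y, F t y ^ 2 :=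
    (hF.pow_const 2).lintegral_prod_right' (ν := (volume : Measure (Rn n)))
  rw [lintegral_lintegral_swap h2.aemeasurable, ← lintegral_const_mul]
  · refine setLIntegral_congr_fun measurableSet_Ioi fun t (ht : 0 < t) => ?_
    rw [lintegral_lintegral_swap]
    · rw [← mul_assoc, ← lintegral_const_mul]
      · refine lintegral_congr fun y => ?_
        rw [lintegral_mul_const, lintegral_wk ht]
        exact (wk_measurable lam).comp (f := fun x : Rn n => ((x, t), y)) (by fun_prop)
      · exact (hF.comp (f := fun y : Rn n => (t, y)) (by fun_prop)).pow_const 2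
    · exact (h1.comp (f := fun r : Rn n × Rn n => ((r.1, t), r.2)) (by fun_prop)).aemeasurable
  · exact (by fun_prop : Measurable fun t : ℝ => ENNReal.ofReal (1 / t)).mul h4

section Fourier
open FourierTransform

lemma fourier_continuous_of_integrable {h : Rn n → ℂ} (h1 : Integrable h volume) :
    Continuous (𝓕 h) :=
  VectorFourier.fourierIntegral_continuous Real.continuous_fourierChar
    (L := innerₗ (Rn n)) continuous_inner h1

lemma integral_fourier_flip {f g : Rn n → ℂ} (hf : Integrable f volume)
    (hg : Integrable g volume) : ∫ ξ, 𝓕 f ξ • g ξ = ∫ x, f x • 𝓕 g x := by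
  have := VectorFourier.integral_fourierIntegral_smul_eq_flip (L := innerₗ (Rn n))
    (μ := volume) (ν := volume) Real.continuous_fourierChar continuous_inner hf hg
  rw [flip_innerₗ] at this
  exact this

lemma plancherel {h : Rn n → ℂ} (h1 : Integrable h volume) (h2 : MemLp h 2 volume) :
    ∫⁻ ξ, ‖𝓕 h ξ‖ₑ ^ 2 = ∫⁻ x, ‖h x‖ₑ ^ 2 := by
  set H : Lp ℂ 2 (volume : Measure (Rn n)) := h2.toLp h with hH
  have key : (𝓕 H : Lp ℂ 2 (volume : Measure (Rn n))) =ᵐ[volume] 𝓕 h := by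
    refine ae_eq_of_integral_contDiff_smul_eq
      ((Lp.memLp _).locallyIntegrable (by norm_num)) (fourier_continuous_of_integrable h1).locallyIntegrable ?_
    intro g g_smooth g_cpt
    have hg₁ : HasCompactSupport (Complex.ofRealCLM ∘ g) := g_cpt.comp_left rfl
    have hg₂ : ContDiff ℝ (⊤ : ℕ∞) (Complex.ofRealCLM ∘ g) :=
      Complex.ofRealCLM.contDiff.comp g_smooth
    set G := hg₁.toSchwartzMap hg₂ with hG
    have e1 : ∫ x, g x • (𝓕 H : Lp ℂ 2 (volume : Measure (Rn n))) x
        = ((𝓕 H : Lp ℂ 2 (volume : Measure (Rn n))) : TemperedDistribution (Rn n) ℂ) G := by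
      rw [Lp.toTemperedDistribution_apply]; rfl
    rw [e1, ← Lp.fourier_toTemperedDistribution_eq, TemperedDistribution.fourier_apply,
      Lp.toTemperedDistribution_apply]
    have e2 : ∫ x, (𝓕 G) x • H x = ∫ x, (𝓕 (G : Rn n → ℂ)) x • h x := by
      refine integral_congr_ae ?_
      filter_upwards [h2.coeFn_toLp] with x hx
      rw [hH, hx, SchwartzMap.fourier_coe]
    rw [e2, integral_fourier_flip G.integrable h1]
    rfl
  have e3 : eLpNorm (𝓕 h) 2 volume = eLpNorm h 2 volume := by
    rw [← eLpNorm_congr_ae key, ← eLpNorm_congr_ae h2.coeFn_toLp, ← Lp.enorm_def, ← Lp.enorm_def,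
      ← ofReal_norm, ← ofReal_norm, Lp.norm_fourier_eq]
  rw [eLpNorm_eq_lintegral_rpow_enorm_toReal (by norm_num) (by norm_num),
    eLpNorm_eq_lintegral_rpow_enorm_toReal (by norm_num) (by norm_num)] at e3
  have e4 := ENNReal.rpow_left_injective (x := 1 / (2:ℝ≥0∞).toReal) (by norm_num) e3
  simpa using e4

end Fourier

/-- two-sided power decay -/
def mm (s u : ℝ) : ℝ := min (u ^ s) (u ^ (-s))

lemma mm_nonneg (s : ℝ) {u : ℝ} (hu : 0 ≤ u) : 0 ≤ mm s u :=
  le_min (Real.rpow_nonneg hu _) (Real.rpow_nonneg hu _)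

lemma mm_of_le {s u : ℝ} (hs : 0 ≤ s) (hu : 0 < u) (h1 : u ≤ 1) : mm s u = u ^ s := by
  refine min_eq_left ?_
  exact Real.rpow_le_rpow_of_exponent_ge hu h1 (by linarith)

lemma mm_of_ge {s u : ℝ} (hs : 0 ≤ s) (h1 : 1 ≤ u) : mm s u = u ^ (-s) := by
  refine min_eq_right ?_
  exact Real.rpow_le_rpow_of_exponent_le h1 (by linarith)

lemma mm_measurable (s : ℝ) : Measurable (mm s) := by
  unfold mm
  exact (measurable_id.pow_const _).min (measurable_id.pow_const _)

lemma lint_mm {a s : ℝ} (ha : 0 < a) (hs : 0 < s) :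
    ∫⁻ t in Ioi (0:ℝ), ENNReal.ofReal (mm s (t / a) / t) ≤ ENNReal.ofReal (2 / s) := by
  have h1 : ∫⁻ t in Ioc (0:ℝ) a, ENNReal.ofReal (mm s (t / a) / t) ≤ ENNReal.ofReal (1 / s) := by
    have e1 : ∀ t ∈ Ioc (0:ℝ) a, ENNReal.ofReal (mm s (t / a) / t) ≤
        ENNReal.ofReal (a ^ (-s) * t ^ (s - 1)) := by
      intro t ht
      apply ENNReal.ofReal_le_ofReal
      have ht0 := ht.1
      calc mm s (t / a) / t ≤ (t / a) ^ s / t := by gcongr; exact min_le_left _ _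
        _ = a ^ (-s) * t ^ (s - 1) := by
          rw [Real.div_rpow ht0.le ha.le, Real.rpow_neg ha.le, Real.rpow_sub_one ht0.ne']; ring
    have hIntg : IntegrableOn (fun t : ℝ => a ^ (-s) * t ^ (s - 1)) (Ioc 0 a) volume := by
      have := (intervalIntegral.intervalIntegrable_rpow' (a := 0) (b := a)
        (r := s - 1) (by linarith)).1
      exact this.const_mul _
    refine (setLIntegral_mono' measurableSet_Ioc e1).trans ?_
    rw [← ofReal_integral_eq_lintegral_ofReal hIntg]
    · apply ENNReal.ofReal_le_ofReal
      rw [← intervalIntegral.integral_of_le ha.le, intervalIntegral.integral_const_mul,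
        integral_rpow (Or.inl (by linarith)), sub_add_cancel, Real.zero_rpow hs.ne',
        Real.rpow_neg ha.le]
      have : 0 < a ^ s := Real.rpow_pos_of_pos ha _
      field_simp; simp
    · refine (ae_restrict_iff' measurableSet_Ioc).2 (Filter.Eventually.of_forall fun t ht => ?_)
      have := ht.1
      positivity
  have h2 : ∫⁻ t in Ioi a, ENNReal.ofReal (mm s (t / a) / t) ≤ ENNReal.ofReal (1 / s) := by
    have e1 : ∀ t ∈ Ioi a, ENNReal.ofReal (mm s (t / a) / t) ≤
        ENNReal.ofReal (a ^ s * t ^ (-s - 1)) := by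
      intro t ht
      apply ENNReal.ofReal_le_ofReal
      have ht0 : 0 < t := ha.trans ht
      calc mm s (t / a) / t ≤ (t / a) ^ (-s) / t := by gcongr; exact min_le_right _ _
        _ = a ^ s * t ^ (-s - 1) := by
          rw [Real.div_rpow ht0.le ha.le, Real.rpow_neg ha.le, Real.rpow_sub_one ht0.ne',
            div_inv_eq_mul]; ring
    have hIntg : IntegrableOn (fun t : ℝ => a ^ s * t ^ (-s - 1)) (Ioi a) volume :=
      (integrableOn_Ioi_rpow_of_lt (by linarith) ha).const_mul _
    refine (setLIntegral_mono' measurableSet_Ioi e1).trans ?_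
    rw [← ofReal_integral_eq_lintegral_ofReal hIntg]
    · apply ENNReal.ofReal_le_ofReal
      rw [integral_const_mul, integral_Ioi_rpow_of_lt (by linarith) ha, sub_add_cancel,
        Real.rpow_neg ha.le]
      have : 0 < a ^ s := Real.rpow_pos_of_pos ha _
      field_simp; simp
    · refine (ae_restrict_iff' measurableSet_Ioi).2 (Filter.Eventually.of_forall fun t ht => ?_)
      have : 0 < t := ha.trans ht
      positivity
  have h3 : Ioi (0:ℝ) = Ioc 0 a ∪ Ioi a := (Ioc_union_Ioi_eq_Ioi ha.le).symm
  rw [h3]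
  refine (lintegral_union_le _ _ _).trans ((add_le_add h1 h2).trans ?_)
  rw [← ENNReal.ofReal_add (by positivity) (by positivity)]
  apply ENNReal.ofReal_le_ofReal
  apply le_of_eq; ring

section Fourier
open FourierTransform

lemma integrable_bracket {κ : ℝ} (hκ : (n : ℝ) < κ) :
    Integrable (fun y : Rn n => (1 + ‖y‖) ^ (-κ)) volume :=
  integrable_one_add_norm (by simpa using hκ)

lemma psi_fourier_small {C₁ C₂ δ γ : ℝ} (hδ : 0 < δ) {ψ : Rn n → ℝ}
    (hψ : PsiKernel n C₁ C₂ δ γ ψ) {ε : ℝ} (hε : 0 < ε) (hε1 : ε ≤ 1) (hεδ : ε < δ) :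
    ∃ C : ℝ, 0 ≤ C ∧ ∀ ξ : Rn n, ‖𝓕 (fun x => (ψ x : ℂ)) ξ‖ ≤ C * ‖ξ‖ ^ ε := by
  obtain ⟨h1, h2, h3, -⟩ := hψ
  set K := ∫ x : Rn n, |C₁| * (1 + ‖x‖) ^ (-((n : ℝ) + δ - ε)) with hK
  refine ⟨(2 * Real.pi) ^ ε * 2 * K, ?_, fun ξ => ?_⟩
  · have : 0 ≤ K := integral_nonneg fun x => by positivity
    positivity
  have hIntg : Integrable (fun x : Rn n => (ψ x : ℂ)) volume := h1.ofReal
  have e0 : 𝓕 (fun x => (ψ x : ℂ)) ξ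
      = ∫ x, (Complex.exp (Complex.I * ((-2 * Real.pi * inner ℝ x ξ : ℝ) : ℂ)) - 1) * (ψ x : ℂ) := by
    rw [Real.fourier_eq']
    have e1 : ∫ x : Rn n, (ψ x : ℂ) = 0 := by
      rw [integral_complex_ofReal, h2]; simp
    simp_rw [sub_mul, one_mul]
    have hi2 : Integrable (fun x : Rn n => Complex.exp (Complex.I * ((-2 * Real.pi * inner ℝ x ξ : ℝ) : ℂ)) * (ψ x : ℂ)) volume := by
      refine hIntg.bdd_mul (c := 1) ?_ ?_
      · exact Continuous.aestronglyMeasurable (by fun_prop)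
      · refine Filter.Eventually.of_forall fun x => ?_
        rw [mul_comm, Complex.norm_exp_ofReal_mul_I]
    rw [integral_sub hi2 hIntg, e1, sub_zero]
    refine integral_congr_ae (Filter.Eventually.of_forall fun x => ?_)
    simp only [smul_eq_mul]
    congr 2
    rw [mul_comm]
  rw [e0]
  have hb : Integrable (fun x : Rn n => |C₁| * (1 + ‖x‖) ^ (-((n : ℝ) + δ - ε))) volume :=
    (integrable_bracket (by linarith)).const_mul _
  calc _ ≤ ∫ x : Rn n, (2 * Real.pi) ^ ε * 2 * ‖ξ‖ ^ ε * (|C₁| * (1 + ‖x‖) ^ (-((n : ℝ) + δ - ε))) := by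
        refine norm_integral_le_of_norm_le (hb.const_mul _) (Filter.Eventually.of_forall fun x => ?_)
        rw [norm_mul]
        have a1 : ‖Complex.exp (Complex.I * ((-2 * Real.pi * inner ℝ x ξ : ℝ) : ℂ)) - 1‖
            ≤ 2 * (2 * Real.pi * ‖x‖ * ‖ξ‖) ^ ε := by
          have b1 := Real.norm_exp_I_mul_ofReal_sub_one_le (x := -2 * Real.pi * inner ℝ x ξ)
          have b2 : ‖Complex.exp (Complex.I * ((-2 * Real.pi * inner ℝ x ξ : ℝ) : ℂ)) - 1‖ ≤ 2 := by
            refine (norm_sub_le _ _).trans ?_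
            rw [mul_comm, Complex.norm_exp_ofReal_mul_I]; norm_num
          have b3 : ‖-2 * Real.pi * inner ℝ x ξ‖ ≤ 2 * Real.pi * ‖x‖ * ‖ξ‖ := by
            rw [norm_mul, norm_mul, mul_assoc (2 * Real.pi)]
            have := norm_inner_le_norm (𝕜 := ℝ) x ξ
            simp only [norm_neg, Real.norm_ofNat, Real.norm_eq_abs, abs_of_pos Real.pi_pos] at *
            gcongr
          set v := 2 * Real.pi * ‖x‖ * ‖ξ‖ with hv
          have hv0 : 0 ≤ v := by positivity
          rcases le_total v 1 with hv1 | hv1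
          · have : v ≤ v ^ ε := by
              rcases hv0.eq_or_lt with h | h
              · rw [← h, Real.zero_rpow hε.ne']
              · calc v = v ^ (1:ℝ) := (Real.rpow_one v).symm
                  _ ≤ v ^ ε := Real.rpow_le_rpow_of_exponent_ge h hv1 hε1
            have := Real.rpow_nonneg hv0 ε
            linarith
          · have : 1 ≤ v ^ ε := Real.one_le_rpow hv1 hε.le
            linarith
        have a2 : ‖(ψ x : ℂ)‖ ≤ |C₁| * (1 + ‖x‖) ^ (-((n : ℝ) + δ)) := by
          rw [Complex.norm_real, Real.norm_eq_abs]
          refine (h3 x).trans ?_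
          gcongr
          exact le_abs_self _
        have a3 : (2 * Real.pi * ‖x‖ * ‖ξ‖) ^ ε ≤ (2 * Real.pi) ^ ε * (1 + ‖x‖) ^ ε * ‖ξ‖ ^ ε := by
          rw [Real.mul_rpow (by positivity) (by positivity), Real.mul_rpow (by positivity) (by positivity)]
          gcongr
          linarith
        calc _ ≤ (2 * ((2 * Real.pi) ^ ε * (1 + ‖x‖) ^ ε * ‖ξ‖ ^ ε)) * (|C₁| * (1 + ‖x‖) ^ (-((n : ℝ) + δ))) := by
              gcongr
              exact a1.trans (by gcongr)
          _ = (2 * Real.pi) ^ ε * 2 * ‖ξ‖ ^ ε * (|C₁| * ((1 + ‖x‖) ^ ε * (1 + ‖x‖) ^ (-((n : ℝ) + δ)))) := by ring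
          _ = _ := by
              rw [← Real.rpow_add (by positivity)]
              congr 4; ring
    _ = _ := by
        rw [integral_const_mul, ← hK]; ring

lemma psi_translate {C₁ C₂ δ γ : ℝ} (hC₁ : 0 < C₁) (hC₂ : 0 < C₂) (hδ : 0 < δ) (hγ : 0 < γ)
    {ψ : Rn n → ℝ} (hψ : PsiKernel n C₁ C₂ δ γ ψ) (hn : 1 ≤ n) {ε : ℝ} (hε : 0 < ε) (hε1 : ε ≤ 1)
    (hεγ : ε ≤ γ) :
    ∃ C : ℝ, 0 ≤ C ∧ ∀ h : Rn n, 2 * ‖h‖ ≤ 1 → ∫ x, ‖ψ x - ψ (x + h)‖ ≤ C * ‖h‖ ^ ε := by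
  obtain ⟨h1, h2, h3, h4⟩ := hψ
  set K := ∫ x : Rn n, C₂ * (1 + ‖x‖) ^ (-((n : ℝ) + δ + γ)) with hK
  have hK0 : 0 ≤ K := integral_nonneg fun x => by positivity
  set B := volume.real (ball (0 : Rn n) 1) with hB
  refine ⟨K + 2 ^ ε * (2 * C₁ * B), by positivity, fun h hh => ?_⟩
  have hb : Integrable (fun x : Rn n => C₂ * (1 + ‖x‖) ^ (-((n : ℝ) + δ + γ))) volume :=
    (integrable_bracket (by linarith)).const_mul _
  have hI : Integrable (indicator (ball (0 : Rn n) (2 * ‖h‖)) fun _ => 2 * C₁) volume :=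
    (integrable_indicator_iff measurableSet_ball).2
      (integrableOn_const measure_ball_lt_top.ne)
  haveI : Nonempty (Fin n) := ⟨⟨0, by omega⟩⟩
  haveI : Nontrivial (Rn n) := by infer_instance
  have hvol : volume.real (ball (0 : Rn n) (2 * ‖h‖)) = (2 * ‖h‖) ^ n * B := by
    rw [Measure.real, Measure.addHaar_ball _ _ (by positivity), ENNReal.toReal_mul,
      ENNReal.toReal_ofReal (by positivity), finrank_euclideanSpace, Fintype.card_fin]; rfl
  calc ∫ x, ‖ψ x - ψ (x + h)‖
      ≤ ∫ x, (‖h‖ ^ ε * (C₂ * (1 + ‖x‖) ^ (-((n : ℝ) + δ + γ)))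
          + indicator (ball (0 : Rn n) (2 * ‖h‖)) (fun _ => 2 * C₁) x) := by
        refine integral_mono_of_nonneg (Filter.Eventually.of_forall fun x => norm_nonneg _)
          ((hb.const_mul _).add hI) (Filter.Eventually.of_forall fun x => ?_)
        simp only
        by_cases hx : 2 * ‖h‖ ≤ ‖x‖
        · have := h4 x h hx
          rw [Real.norm_eq_abs, abs_sub_comm]
          have h5 : ‖h‖ ^ γ ≤ ‖h‖ ^ ε := by
            rcases (norm_nonneg h).eq_or_lt with h0 | h0
            · rw [← h0, Real.zero_rpow hγ.ne', Real.zero_rpow hε.ne']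
            · exact Real.rpow_le_rpow_of_exponent_ge h0 (by linarith) hεγ
          have h6 : 0 ≤ indicator (ball (0 : Rn n) (2 * ‖h‖)) (fun _ => 2 * C₁) x :=
            indicator_nonneg (fun _ _ => by positivity) _
          calc _ ≤ C₂ * ‖h‖ ^ γ * (1 + ‖x‖) ^ (-((n : ℝ) + δ + γ)) := this
            _ ≤ C₂ * ‖h‖ ^ ε * (1 + ‖x‖) ^ (-((n : ℝ) + δ + γ)) := by gcongr
            _ ≤ _ := by linarith
        · have hx' : x ∈ ball (0 : Rn n) (2 * ‖h‖) := by
            rw [mem_ball_zero_iff]; exact not_le.1 hx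
          rw [indicator_of_mem hx']
          have h7 : ∀ z, ‖ψ z‖ ≤ C₁ := fun z => by
            refine (h3 z).trans ?_
            have : (1 + ‖z‖) ^ (-((n : ℝ) + δ)) ≤ 1 :=
              Real.rpow_le_one_of_one_le_of_nonpos (by linarith [norm_nonneg z]) (by linarith [Nat.cast_nonneg (α := ℝ) n])
            nlinarith
          have : ‖ψ x - ψ (x + h)‖ ≤ 2 * C₁ := by
            refine (norm_sub_le _ _).trans ?_
            linarith [h7 x, h7 (x + h)]
          have h8 : 0 ≤ ‖h‖ ^ ε * (C₂ * (1 + ‖x‖) ^ (-((n : ℝ) + δ + γ))) := by positivity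
          linarith
    _ = ‖h‖ ^ ε * K + (2 * ‖h‖) ^ n * B * (2 * C₁) := by
        rw [integral_add (hb.const_mul _) hI, integral_const_mul, integral_indicator measurableSet_ball,
          setIntegral_const, hvol, smul_eq_mul]
    _ ≤ ‖h‖ ^ ε * K + (2 * ‖h‖) ^ ε * B * (2 * C₁) := by
        gcongr
        rcases (norm_nonneg h).eq_or_lt with h0 | h0
        · rw [← h0, mul_zero, Real.zero_rpow hε.ne', zero_pow (by omega)]
        · rw [← Real.rpow_natCast]
          exact Real.rpow_le_rpow_of_exponent_ge (by positivity) hh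
            (hε1.trans (by exact_mod_cast hn))
    _ = _ := by
        rw [Real.mul_rpow (by norm_num) (norm_nonneg _)]; ring

lemma psi_fourier_decay (hn : 1 ≤ n) {C₁ C₂ δ γ : ℝ} (hC₁ : 0 < C₁) (hC₂ : 0 < C₂)
    (hδ : 0 < δ) (hγ : 0 < γ)
    {ψ : Rn n → ℝ} (hψ : PsiKernel n C₁ C₂ δ γ ψ) :
    ∃ C ε : ℝ, 0 ≤ C ∧ 0 < ε ∧ ∀ ξ : Rn n, ξ ≠ 0 → ‖𝓕 (fun x => (ψ x : ℂ)) ξ‖ ≤ C * mm ε ‖ξ‖ := by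
  set ε := min (min (δ / 2) γ) 1 with hε
  have hε0 : 0 < ε := by positivity
  have hε1 : ε ≤ 1 := min_le_right _ _
  have hεγ : ε ≤ γ := (min_le_left _ _).trans (min_le_right _ _)
  have hεδ : ε < δ := ((min_le_left _ _).trans (min_le_left _ _)).trans_lt (by linarith)
  obtain ⟨A, hA, hA'⟩ := psi_fourier_small hδ hψ hε0 hε1 hεδ
  obtain ⟨B, hB, hB'⟩ := psi_translate hC₁ hC₂ hδ hγ hψ hn hε0 hε1 hεγ
  refine ⟨A + B, ε, by positivity, hε0, fun ξ hξ => ?_⟩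
  have hξ0 : 0 < ‖ξ‖ := norm_pos_iff.2 hξ
  rcases le_total ‖ξ‖ 1 with h1 | h1
  · rw [mm_of_le hε0.le hξ0 h1]
    refine (hA' ξ).trans ?_
    gcongr; linarith
  · rw [mm_of_ge hε0.le h1]
    set i : Rn n := (1 / (2 * ‖ξ‖ ^ 2) : ℝ) • ξ with hi
    have hin : ‖i‖ = (2 * ‖ξ‖)⁻¹ := by
      rw [hi, norm_smul, Real.norm_of_nonneg (by positivity)]; field_simp
    have e1 : 𝓕 (fun x => (ψ x : ℂ)) ξ = (1 / (2:ℂ)) • ∫ v, Real.fourierChar (-inner ℝ v ξ) •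
        ((ψ v : ℂ) - (ψ (v + i) : ℂ)) :=
      fourierIntegral_eq_half_sub_half_period_translate (f := fun x => (ψ x : ℂ)) hξ hψ.1.ofReal
    rw [e1, norm_smul]
    have e2 : ‖∫ v, Real.fourierChar (-inner ℝ v ξ) • ((ψ v : ℂ) - (ψ (v + i) : ℂ))‖
        ≤ ∫ x, ‖ψ x - ψ (x + i)‖ := by
      refine (norm_integral_le_integral_norm _).trans_eq ?_
      congr 1; funext v
      rw [Circle.norm_smul, ← Complex.ofReal_sub, Complex.norm_real]
    have e3 := hB' i (by
      rw [hin]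
      rw [mul_inv, ← mul_assoc, mul_inv_cancel₀ (by norm_num), one_mul]
      exact inv_le_one_of_one_le₀ h1)
    have e4 : ‖i‖ ^ ε ≤ ‖ξ‖ ^ (-ε) := by
      rw [hin, Real.inv_rpow (by positivity), Real.rpow_neg (by positivity)]
      gcongr; linarith
    calc ‖(1 / (2:ℂ))‖ * _ ≤ 1 * (B * ‖ξ‖ ^ (-ε)) := by
          gcongr
          · norm_num
          · exact e2.trans (e3.trans (by gcongr))
      _ ≤ (A + B) * ‖ξ‖ ^ (-ε) := by
          rw [one_mul]; gcongr; linarith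

end Fourier

lemma psi_bdd {C₁ C₂ δ γ : ℝ} (hC₁ : 0 < C₁) (hδ : 0 < δ)
    {ψ : Rn n → ℝ} (hψ : PsiKernel n C₁ C₂ δ γ ψ) (z : Rn n) : |ψ z| ≤ C₁ := by
  refine (hψ.2.2.1 z).trans ?_
  have : (1 + ‖z‖) ^ (-((n : ℝ) + δ)) ≤ 1 :=
    Real.rpow_le_one_of_one_le_of_nonpos (by linarith [norm_nonneg z])
      (by linarith [Nat.cast_nonneg (α := ℝ) n])
  nlinarith

lemma cvl_kernel_abs_le {C₁ C₂ δ γ : ℝ} (hC₁ : 0 < C₁) (hδ : 0 < δ)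
    {ψ : Rn n → ℝ} (hψ : PsiKernel n C₁ C₂ δ γ ψ) {t : ℝ} (ht : 0 < t) (z : Rn n) :
    |(t ^ n)⁻¹ * ψ z| ≤ (t ^ n)⁻¹ * C₁ := by
  rw [abs_mul, abs_of_pos (by positivity)]
  gcongr
  exact psi_bdd hC₁ hδ hψ z

lemma cvl_abs_le {C₁ C₂ δ γ : ℝ} (hC₁ : 0 < C₁) (hδ : 0 < δ)
    {ψ : Rn n → ℝ} (hψ : PsiKernel n C₁ C₂ δ γ ψ) {t : ℝ} (ht : 0 < t) {g : Rn n → ℝ}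
    (hg : Integrable g volume) (y : Rn n) :
    |cvl ψ t g y| ≤ (t ^ n)⁻¹ * C₁ * ∫ x, |g x| := by
  rw [← integral_const_mul]
  unfold cvl
  rw [← Real.norm_eq_abs]
  refine norm_integral_le_of_norm_le (g := fun x => (t ^ n)⁻¹ * C₁ * |g x|) (hg.abs.const_mul _) (Filter.Eventually.of_forall fun x => ?_)
  rw [Real.norm_eq_abs, abs_mul]
  gcongr
  exact cvl_kernel_abs_le hC₁ hδ hψ ht _

lemma mm_sq {s u : ℝ} (hu : 0 < u) : mm s u ^ 2 = mm (2 * s) u := by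
  unfold mm
  have e : ∀ a : ℝ, u ^ (2 * a) = (u ^ a) ^ 2 := fun a => by
    rw [mul_comm, Real.rpow_mul hu.le]; norm_num
  rw [e, show -(2 * s) = 2 * (-s) by ring, e]
  rcases le_total (u ^ s) (u ^ (-s)) with h | h
  · rw [min_eq_left h, min_eq_left (by gcongr)]
  · rw [min_eq_right h, min_eq_right (by gcongr)]

section Fourier2
open FourierTransform Convolution

lemma fourier_dilate {Ψ : Rn n → ℂ} {t : ℝ} (ht : 0 < t) (ξ : Rn n) :
    𝓕 (fun x => ((t ^ n)⁻¹ : ℝ) • Ψ (t⁻¹ • x)) ξ = 𝓕 Ψ (t • ξ) := by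
  rw [Real.fourier_eq', Real.fourier_eq']
  have h := Measure.integral_comp_inv_smul_of_nonneg (volume : Measure (Rn n))
    (fun v => Complex.exp (((-2 * Real.pi * inner ℝ v (t • ξ) : ℝ) : ℂ) * Complex.I) • Ψ v) ht.le
  rw [finrank_euclideanSpace, Fintype.card_fin] at h
  rw [← inv_smul_smul₀ (pow_pos ht n).ne' (∫ v : Rn n, Complex.exp (((-2 * Real.pi * inner ℝ v (t • ξ) : ℝ) : ℂ) * Complex.I) • Ψ v), ← h, ← integral_smul]
  congr 1; funext v
  rw [smul_comm, inner_smul_left, inner_smul_right]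
  simp [ht.ne']

lemma cvl_L2 {C₁ C₂ δ γ : ℝ} (hC₁ : 0 < C₁) (hδ : 0 < δ)
    {ψ : Rn n → ℝ} (hψ : PsiKernel n C₁ C₂ δ γ ψ) {t : ℝ} (ht : 0 < t) {g : Rn n → ℝ}
    (hg : Integrable g volume) :
    ∫⁻ y, ‖cvl ψ t g y‖ₑ ^ 2 =
      ∫⁻ ξ, ‖𝓕 (fun x => (g x : ℂ)) ξ‖ₑ ^ 2 * ‖𝓕 (fun x => (ψ x : ℂ)) (t • ξ)‖ₑ ^ 2 := by
  set G : Rn n → ℂ := fun x => (g x : ℂ) with hG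
  set P : Rn n → ℂ := fun x => ((t ^ n)⁻¹ : ℝ) • ((ψ (t⁻¹ • x) : ℝ) : ℂ) with hP
  have hGi : Integrable G volume := hg.ofReal
  have hPi : Integrable P volume := by
    have := (hψ.1.comp_smul (inv_ne_zero ht.ne')).ofReal (𝕜 := ℂ)
    exact Integrable.smul ((t ^ n)⁻¹ : ℝ) this
  have e1 : ∀ y, ((cvl ψ t g y : ℝ) : ℂ) = (G ⋆[ContinuousLinearMap.mul ℂ ℂ] P) y := by
    intro y
    unfold cvl convolution
    rw [← integral_complex_ofReal]
    congr 1; funext s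
    simp [hG, hP]; ring
  have hci : Integrable (G ⋆[ContinuousLinearMap.mul ℂ ℂ] P) volume :=
    hGi.integrable_convolution _ hPi
  have hc2 : MemLp (G ⋆[ContinuousLinearMap.mul ℂ ℂ] P) 2 volume := by
    rw [memLp_two_iff_integrable_sq_norm hci.1]
    refine Integrable.mono' (hci.norm.const_mul ((t ^ n)⁻¹ * C₁ * ∫ x, |g x|)) (hci.1.norm.pow 2)
      (Filter.Eventually.of_forall fun y => ?_)
    have : ‖(G ⋆[ContinuousLinearMap.mul ℂ ℂ] P) y‖ ≤ (t ^ n)⁻¹ * C₁ * ∫ x, |g x| := by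
      rw [← e1, Complex.norm_real]
      exact cvl_abs_le hC₁ hδ hψ ht hg y
    rw [Real.norm_of_nonneg (by positivity), sq]
    gcongr
  have h := plancherel hci hc2
  have e2 : ∀ y, ‖cvl ψ t g y‖ₑ ^ 2 = ‖(G ⋆[ContinuousLinearMap.mul ℂ ℂ] P) y‖ₑ ^ 2 := by
    intro y; rw [← e1]; simp [enorm]
  simp_rw [e2]
  rw [← h]
  congr 1; funext ξ
  rw [Real.fourier_mul_convolution_eq hGi hPi, enorm_mul, mul_pow]
  congr 3
  exact fourier_dilate (Ψ := fun x => (ψ x : ℂ)) ht ξ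

lemma L2_bound (hn : 1 ≤ n) {C₁ C₂ δ γ : ℝ} (hC₁ : 0 < C₁) (hC₂ : 0 < C₂) (hδ : 0 < δ) (hγ : 0 < γ)
    {ψ : Rn n → ℝ} (hψ : PsiKernel n C₁ C₂ δ γ ψ) :
    ∃ C : ℝ, 0 < C ∧ ∀ g : Rn n → ℝ, Integrable g volume →
      ∫⁻ t in Ioi (0:ℝ), ENNReal.ofReal (1 / t) * ∫⁻ y, ‖cvl ψ t g y‖ₑ ^ 2 ≤
        ENNReal.ofReal C * ∫⁻ x, ‖g x‖ₑ ^ 2 := by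
  obtain ⟨C, ε, hC, hε, hdec⟩ := psi_fourier_decay hn hC₁ hC₂ hδ hγ hψ
  refine ⟨C ^ 2 * (2 / (2 * ε)) + 1, by positivity, fun g hg => ?_⟩
  by_cases htop : ∫⁻ x, ‖g x‖ₑ ^ 2 = ⊤
  · rw [htop, ENNReal.mul_top]
    · exact le_top
    · simp only [ne_eq, ENNReal.ofReal_eq_zero, not_le]; positivity
  have hg2 : MemLp (fun x => (g x : ℂ)) 2 volume := by
    rw [memLp_two_iff_integrable_sq_norm hg.ofReal.1]
    refine ⟨(hg.ofReal.1.norm.pow 2), ?_⟩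
    rw [HasFiniteIntegral]
    refine lt_of_le_of_lt (le_of_eq ?_) (lt_top_iff_ne_top.2 htop)
    congr 1; funext x; simp [enorm_pow]
  set Φ := 𝓕 (fun x => (g x : ℂ)) with hΦ
  set Ψ := 𝓕 (fun x => (ψ x : ℂ)) with hΨ
  have hΦc : Continuous Φ := fourier_continuous_of_integrable hg.ofReal
  have hΨc : Continuous Ψ := fourier_continuous_of_integrable hψ.1.ofReal
  have hp : ∫⁻ ξ, ‖Φ ξ‖ₑ ^ 2 = ∫⁻ x, ‖((g x : ℝ) : ℂ)‖ₑ ^ 2 := plancherel hg.ofReal hg2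
  have e0 : ∀ x, ‖((g x : ℝ) : ℂ)‖ₑ ^ 2 = ‖g x‖ₑ ^ 2 := fun x => by simp [enorm]
  calc ∫⁻ t in Ioi (0:ℝ), ENNReal.ofReal (1 / t) * ∫⁻ y, ‖cvl ψ t g y‖ₑ ^ 2
      = ∫⁻ t in Ioi (0:ℝ), ∫⁻ ξ, ‖Φ ξ‖ₑ ^ 2 * (ENNReal.ofReal (1 / t) * ‖Ψ (t • ξ)‖ₑ ^ 2) := by
        refine setLIntegral_congr_fun measurableSet_Ioi fun t ht => ?_
        rw [cvl_L2 hC₁ hδ hψ ht hg, ← lintegral_const_mul]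
        · congr 1; funext ξ; ring
        · exact (hΦc.measurable.enorm.pow_const 2).mul ((hΨc.comp (continuous_const_smul t)).measurable.enorm.pow_const 2)
    _ = ∫⁻ ξ, ∫⁻ t in Ioi (0:ℝ), ‖Φ ξ‖ₑ ^ 2 * (ENNReal.ofReal (1 / t) * ‖Ψ (t • ξ)‖ₑ ^ 2) := by
        refine lintegral_lintegral_swap (Measurable.aemeasurable ?_)
        have : Measurable fun q : ℝ × Rn n => Ψ (q.1 • q.2) := (hΨc.comp continuous_smul).measurable
        refine (hΦc.measurable.comp measurable_snd).enorm.pow_const 2 |>.mul ?_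
        refine Measurable.mul ?_ (this.enorm.pow_const 2)
        exact (measurable_const.div measurable_fst).ennreal_ofReal
    _ ≤ ∫⁻ ξ, ‖Φ ξ‖ₑ ^ 2 * ENNReal.ofReal (C ^ 2 * (2 / (2 * ε)) + 1) := by
        have hne : ∀ᵐ ξ : Rn n ∂volume, ξ ≠ 0 := by
          have : Nonempty (Fin n) := ⟨⟨0, by omega⟩⟩
          have : Nontrivial (Rn n) := by infer_instance
          exact Measure.ae_ne volume 0
        refine lintegral_mono_ae (hne.mono fun ξ hξ => ?_)
        have hξ0 : 0 < ‖ξ‖ := norm_pos_iff.2 hξ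
        rw [lintegral_const_mul']
        · gcongr
          calc ∫⁻ t in Ioi (0:ℝ), ENNReal.ofReal (1 / t) * ‖Ψ (t • ξ)‖ₑ ^ 2
              ≤ ∫⁻ t in Ioi (0:ℝ), ENNReal.ofReal (C ^ 2) * ENNReal.ofReal (mm (2 * ε) (t / ‖ξ‖⁻¹) / t) := by
                refine setLIntegral_mono' measurableSet_Ioi fun t ht => ?_
                have ht' : 0 < t := ht
                have hd := hdec (t • ξ) (smul_ne_zero ht'.ne' hξ)
                rw [norm_smul, Real.norm_of_nonneg ht'.le] at hd
                rw [← ofReal_norm, ← ENNReal.ofReal_pow (norm_nonneg _),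
                  ← ENNReal.ofReal_mul (by positivity), ← ENNReal.ofReal_mul (by positivity)]
                refine ENNReal.ofReal_le_ofReal ?_
                rw [div_inv_eq_mul, ← mm_sq (by positivity)]
                calc 1 / t * ‖Ψ (t • ξ)‖ ^ 2 ≤ 1 / t * (C * mm ε (t * ‖ξ‖)) ^ 2 := by gcongr
                  _ = _ := by ring
            _ ≤ ENNReal.ofReal (C ^ 2) * ENNReal.ofReal (2 / (2 * ε)) := by
                rw [lintegral_const_mul' _ _ ENNReal.ofReal_ne_top]
                gcongr
                exact lint_mm (by positivity) (by positivity)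
            _ ≤ _ := by
                rw [← ENNReal.ofReal_mul (by positivity)]
                exact ENNReal.ofReal_le_ofReal (by linarith)
        · exact ENNReal.pow_ne_top enorm_ne_top
    _ = _ := by
        rw [lintegral_mul_const' _ _ ENNReal.ofReal_ne_top, mul_comm]
        rw [← lintegral_congr e0, ← hp]

end Fourier2

lemma Gstar_sq (ψ : Rn n → ℝ) (lam : ℝ) (f : Rn n → ℝ) (x : Rn n) :
    Gstar ψ lam f x ^ 2 = SQ lam (fun t y => ‖cvl ψ t f y‖ₑ) x := by
  rw [Gstar_eq, ← ENNReal.rpow_natCast, ← ENNReal.rpow_mul]; norm_num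

lemma Gstar_L2 (hn : 1 ≤ n) {C₁ C₂ δ γ : ℝ} (hC₁ : 0 < C₁) (hC₂ : 0 < C₂) (hδ : 0 < δ) (hγ : 0 < γ)
    {ψ : Rn n → ℝ} (hψ : PsiKernel n C₁ C₂ δ γ ψ) {lam : ℝ} (hlam : 2 < lam) :
    ∃ C : ℝ, 0 < C ∧ ∀ g : Rn n → ℝ, Integrable g volume →
      ∫⁻ x, Gstar ψ lam g x ^ 2 ≤ ENNReal.ofReal C * ∫⁻ x, ‖g x‖ₑ ^ 2 := by
  obtain ⟨C, hC, h⟩ := L2_bound hn hC₁ hC₂ hδ hγ hψ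
  have hn' : (1:ℝ) ≤ n := by exact_mod_cast hn
  have hJ : JB n (lam * n) < ⊤ := JB_lt_top (by nlinarith)
  refine ⟨((JB n (lam * n)).toReal + 1) * C, by positivity, fun g hg => ?_⟩
  simp_rw [Gstar_sq]
  rw [lintegral_SQ lam (cvl_measurable (psi_measurable hγ hψ) hg.1).enorm]
  have e : JB n (lam * n) ≤ ENNReal.ofReal ((JB n (lam * n)).toReal + 1) := by
    conv_lhs => rw [← ENNReal.ofReal_toReal hJ.ne]
    exact ENNReal.ofReal_le_ofReal (by linarith)
  rw [ENNReal.ofReal_mul (by positivity), mul_assoc]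
  exact mul_le_mul' e (h g hg)

lemma norm_le_of_coord {c y : Rn n} {h : ℝ} (hh : 0 ≤ h) (hy : ∀ i, |y i - c i| ≤ h) :
    ‖y - c‖ ≤ √n * h := by
  rw [EuclideanSpace.norm_eq]
  have : ∑ i, ‖(y - c) i‖ ^ 2 ≤ n * h ^ 2 := by
    calc ∑ i, ‖(y - c) i‖ ^ 2 ≤ ∑ i : Fin n, h ^ 2 := by
          refine Finset.sum_le_sum fun i _ => ?_
          have := hy i
          simp only [PiLp.sub_apply, Real.norm_eq_abs]
          gcongr
      _ = n * h ^ 2 := by simp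
  calc √(∑ i, ‖(y - c) i‖ ^ 2) ≤ √(n * h ^ 2) := Real.sqrt_le_sqrt this
    _ = √n * h := by rw [Real.sqrt_mul (by positivity), Real.sqrt_sq hh]

/-- Half-open dyadic subcubes of `cube c h`. -/
def dy (c : Rn n) (h : ℝ) (q : ℕ × (Fin n → ℤ)) : Set (Rn n) :=
  {x | ∀ i, ⌊2 ^ q.1 * ((x i - (c i - h)) / (2 * h))⌋ = q.2 i}

/-- Centers of dyadic subcubes. -/
def dyc (c : Rn n) (h : ℝ) (q : ℕ × (Fin n → ℤ)) : Rn n :=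
  WithLp.toLp 2 fun i => c i - h + 2 * h * (q.2 i + 1 / 2) / 2 ^ q.1

/-- The dyadic index of a point. -/
def dyF (c : Rn n) (h : ℝ) (k : ℕ) (x : Rn n) : ℕ × (Fin n → ℤ) :=
  (k, fun i => ⌊2 ^ k * ((x i - (c i - h)) / (2 * h))⌋)

lemma mem_dy_iff {c : Rn n} {h : ℝ} {q : ℕ × (Fin n → ℤ)} {x : Rn n} :
    x ∈ dy c h q ↔ q = dyF c h q.1 x := by
  unfold dy dyF
  rcases q with ⟨k, j⟩
  simp only [Set.mem_ofPred_eq, Prod.mk.injEq, true_and, funext_iff]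
  exact forall_congr' fun i => eq_comm

lemma mem_dyF (c : Rn n) (h : ℝ) (k : ℕ) (x : Rn n) : x ∈ dy c h (dyF c h k x) :=
  mem_dy_iff.2 rfl

lemma floor_half (k : ℕ) (u : ℝ) : ⌊2 ^ k * u⌋ = ⌊2 ^ (k + 1) * u⌋ / 2 := by
  have := Int.floor_div_natCast (2 ^ (k + 1) * u) 2
  push_cast at this
  rw [← this]; congr 1; rw [pow_succ]; ring

lemma dy_nest {c : Rn n} {h : ℝ} {m k : ℕ} (hmk : m ≤ k) (x : Rn n) :
    dy c h (dyF c h k x) ⊆ dy c h (dyF c h m x) := by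
  induction k, hmk using Nat.le_induction with
  | base => exact subset_rfl
  | succ k hk ih =>
    refine Subset.trans (fun y hy => ?_) ih
    intro i
    have := hy i
    simp only [dyF] at this ⊢
    rw [floor_half, this, ← floor_half]

lemma dy_eq {c : Rn n} {h : ℝ} (hh : 0 < h) (q : ℕ × (Fin n → ℤ)) :
    dy c h q = {y | ∀ i, y i ∈ Ico (dyc c h q i - h / 2 ^ q.1) (dyc c h q i + h / 2 ^ q.1)} := by
  ext x
  refine forall_congr' fun i => ?_
  rw [Int.floor_eq_iff, mem_Ico]
  simp only [dyc]
  have h2 : (0:ℝ) < 2 ^ q.1 := by positivity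
  rw [← mul_div_assoc, le_div_iff₀ (by positivity), div_lt_iff₀ (by positivity)]
  constructor
  · rintro ⟨h3, h4⟩
    constructor
    · rw [add_sub_assoc, ← sub_div, ← le_sub_iff_add_le', div_le_iff₀ h2]; nlinarith
    · rw [add_assoc, ← add_div, ← sub_lt_iff_lt_add', lt_div_iff₀ h2]; nlinarith
  · rintro ⟨h3, h4⟩
    rw [add_sub_assoc, ← sub_div, ← le_sub_iff_add_le', div_le_iff₀ h2] at h3
    rw [add_assoc, ← add_div, ← sub_lt_iff_lt_add', lt_div_iff₀ h2] at h4
    constructor <;> nlinarith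

lemma dy_measurable {c : Rn n} {h : ℝ} (hh : 0 < h) (q : ℕ × (Fin n → ℤ)) :
    MeasurableSet (dy c h q) := by
  rw [dy_eq hh]
  have : {y : Rn n | ∀ i, y i ∈ Ico (dyc c h q i - h / 2 ^ q.1) (dyc c h q i + h / 2 ^ q.1)}
    = ⋂ i, (fun y : Rn n => y i) ⁻¹' Ico (dyc c h q i - h / 2 ^ q.1) (dyc c h q i + h / 2 ^ q.1) := by
    ext y; simp
  rw [this]
  exact MeasurableSet.iInter fun i => (by fun_prop : Measurable fun y : Rn n => y i) measurableSet_Ico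

lemma dy_volume {c : Rn n} {h : ℝ} (hh : 0 < h) (q : ℕ × (Fin n → ℤ)) :
    volume (dy c h q) = ENNReal.ofReal ((2 * (h / 2 ^ q.1)) ^ n) := by
  rw [dy_eq hh, volume_preimage_pi _ (fun i => measurableSet_Ico)]
  have h3 : ∀ i, volume (Ico (dyc c h q i - h / 2 ^ q.1) (dyc c h q i + h / 2 ^ q.1)) =
      ENNReal.ofReal (2 * (h / 2 ^ q.1)) := fun i => by
    rw [Real.volume_Ico]; congr 1; ring
  simp only [h3]
  rw [Finset.prod_const, Finset.card_univ, Fintype.card_fin, ← ENNReal.ofReal_pow (by positivity)]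

lemma cube_subset_dy {c : Rn n} {h : ℝ} (hh : 0 < h) (q : ℕ × (Fin n → ℤ)) :
    cube (dyc c h q) (h / 2 ^ q.1) ⊆ dy c h q := by
  rw [dy_eq hh]
  intro y hy i
  have := abs_lt.1 (hy i)
  constructor <;> linarith

lemma cube_ae_dy {c : Rn n} {h : ℝ} (hh : 0 < h) (q : ℕ × (Fin n → ℤ)) :
    cube (dyc c h q) (h / 2 ^ q.1) =ᵐ[volume] dy c h q := by
  refine ae_eq_of_subset_of_measure_ge (cube_subset_dy hh q) ?_ (measurableSet_cube _ _).nullMeasurableSet ?_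
  · rw [dy_volume hh, volume_cube _ (by positivity)]
  · rw [dy_volume hh]; exact ENNReal.ofReal_ne_top

lemma dy_zero {c : Rn n} {h : ℝ} : dyc c h (0, 0) = c := by
  ext i; simp [dyc]; ring

lemma cube_subset_of_dy {c : Rn n} {h : ℝ} (hh : 0 < h) {q : ℕ × (Fin n → ℤ)}
    (hq : dy c h q ⊆ dy c h (0, 0)) : cube (dyc c h q) (h / 2 ^ q.1) ⊆ cube c h := by
  intro y hy i
  have h1 := hq (cube_subset_dy hh q hy) i
  simp only [pow_zero, one_mul, Pi.zero_apply, Int.floor_eq_zero_iff, mem_Ico] at h1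
  rw [le_div_iff₀ (by positivity), div_lt_one (by positivity), zero_mul] at h1
  rw [abs_lt]
  refine ⟨?_, by linarith⟩
  rcases h1.1.eq_or_lt with h2 | h2
  · exfalso
    have h3 := abs_lt.1 (hy i)
    simp only [dyc] at h3
    have h4 : y i = c i - h := by linarith
    rw [h4] at h3
    have h5 : (0:ℝ) < 2 ^ q.1 := by positivity
    have h6 : -(h / 2 ^ q.1) < -(2 * h * (q.2 i + 1 / 2) / 2 ^ q.1) := by linarith
    have h7 : -(2 * h * (q.2 i + 1 / 2) / 2 ^ q.1) < h / 2 ^ q.1 := by linarith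
    rw [neg_lt_neg_iff, div_lt_div_iff_of_pos_right h5] at h6
    rw [← neg_div, div_lt_div_iff_of_pos_right h5] at h7
    have h8 : (q.2 i : ℝ) < 0 := by nlinarith
    have h9 : (-1 : ℝ) < q.2 i := by nlinarith
    have h10 : q.2 i < 0 := by exact_mod_cast h8
    have h11 : -1 < q.2 i := by exact_mod_cast h9
    omega
  · linarith

lemma cz (hn : 1 ≤ n) (c : Rn n) {h : ℝ} (hh : 0 < h) {g : Rn n → ℝ} (hg0 : ∀ x, 0 ≤ g x)
    (hg : Integrable g volume) {α : ℝ} (hα : avg g (cube c h) ≤ α) :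
    ∃ (I : Set (ℕ × (Fin n → ℤ))) (cc : ℕ × (Fin n → ℤ) → Rn n) (r : ℕ × (Fin n → ℤ) → ℝ),
      (∀ i, 0 < r i) ∧ (I.PairwiseDisjoint fun i => cube (cc i) (r i)) ∧
      (∀ i ∈ I, cube (cc i) (r i) ⊆ cube c h) ∧
      (∀ i ∈ I, α * (2 * r i) ^ n < ∫ x in cube (cc i) (r i), g x) ∧
      (∀ i ∈ I, ∫ x in cube (cc i) (r i), g x ≤ 2 ^ n * α * (2 * r i) ^ n) ∧
      ∀ᵐ x ∂(volume : Measure (Rn n)), x ∈ cube c h → (∃ i ∈ I, x ∈ cube (cc i) (r i)) ∨ g x ≤ α := by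
  set r : ℕ × (Fin n → ℤ) → ℝ := fun q => h / 2 ^ q.1 with hr
  have hr0 : ∀ i, 0 < r i := fun i => by simp only [hr]; positivity
  set bad : ℕ × (Fin n → ℤ) → Prop := fun q => α * (2 * r q) ^ n < ∫ x in dy c h q, g x with hbad
  set I : Set (ℕ × (Fin n → ℤ)) := {q | bad q ∧ dy c h q ⊆ dy c h (0, 0) ∧
    ∀ q' : ℕ × (Fin n → ℤ), q'.1 < q.1 → dy c h q ⊆ dy c h q' → ¬ bad q'} with hI
  have hset : ∀ q, ∫ x in cube (dyc c h q) (r q), g x = ∫ x in dy c h q, g x := fun q =>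
    setIntegral_congr_set (cube_ae_dy hh q)
  have hroot : ¬ bad (0, 0) := by
    simp only [hbad, not_lt]
    rw [← hset, dy_zero]
    simp only [hr, pow_zero, div_one]
    rw [setIntegral_cube_eq_avg _ _ hh, mul_comm]
    gcongr
  have hne : ∀ q, (dy c h q).Nonempty := by
    intro q
    refine ⟨dyc c h q, cube_subset_dy hh q ?_⟩
    intro i
    rw [sub_self, abs_zero]; exact hr0 q
  refine ⟨I, dyc c h, r, hr0, ?_, ?_, ?_, ?_, ?_⟩
  · intro q hq q' hq' hqq
    refine Set.disjoint_left.2 fun x hx hx' => hqq ?_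
    have h1 := mem_dy_iff.1 (cube_subset_dy hh q hx)
    have h2 := mem_dy_iff.1 (cube_subset_dy hh q' hx')
    rcases lt_trichotomy q.1 q'.1 with h3 | h3 | h3
    · refine absurd hq.1 (hq'.2.2 q h3 ?_)
      rw [h1, h2]; exact dy_nest h3.le x
    · rw [h1, h2, h3]
    · refine absurd hq'.1 (hq.2.2 q' h3 ?_)
      rw [h1, h2]; exact dy_nest h3.le x
  · intro q hq
    exact cube_subset_of_dy hh hq.2.1
  · intro q hq
    rw [hset]; exact hq.1
  · intro q hq
    rw [hset]
    obtain ⟨x, hx⟩ := hne q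
    have h1 := mem_dy_iff.1 hx
    rcases Nat.eq_zero_or_pos q.1 with h0 | h0
    · exfalso
      have h2 := mem_dy_iff.1 (hq.2.1 hx)
      rw [h0] at h1
      simp only at h2
      rw [← h2] at h1
      exact hroot (h1 ▸ hq.1)
    · obtain ⟨k, hk⟩ : ∃ k, q.1 = k + 1 := ⟨q.1 - 1, by omega⟩
      have h3 : dy c h q ⊆ dy c h (dyF c h k x) := by
        rw [h1, hk]; exact dy_nest (by omega) x
      have h4 := hq.2.2 (dyF c h k x) (by rw [hk]; exact Nat.lt_succ_self k) h3
      simp only [hbad, not_lt] at h4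
      calc ∫ x in dy c h q, g x ≤ ∫ x in dy c h (dyF c h k x), g x :=
            setIntegral_mono_set hg.integrableOn (Filter.Eventually.of_forall hg0)
              (Filter.Eventually.of_forall h3)
        _ ≤ _ := h4
        _ = _ := by
            have : r (dyF c h k x) = 2 * r q := by
              simp only [hr, dyF, hk, pow_succ]; field_simp
            rw [this, mul_pow 2 (2 * r q)]; ring
  · have hleb := IsUnifLocDoublingMeasure.ae_tendsto_average_norm_sub (volume : Measure (Rn n))
      hg.locallyIntegrable 1
    have hcub : ∀ᵐ x ∂(volume : Measure (Rn n)), ∀ q, x ∈ dy c h q → x ∈ cube (dyc c h q) (r q) := by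
      rw [ae_all_iff]; intro q
      filter_upwards [(cube_ae_dy hh q).mem_iff] with x hx using hx.2
    have hroot' : cube c h ⊆ dy c h (0, 0) := by
      have := cube_subset_dy hh ((0, 0) : ℕ × (Fin n → ℤ)) (c := c)
      rw [dy_zero] at this
      simpa using this
    filter_upwards [hleb, hcub] with x hx hxc hxQ
    by_contra hcon
    push Not at hcon
    obtain ⟨hcon1, hcon2⟩ := hcon
    have hx0 := mem_dy_iff.1 (hroot' hxQ)
    have hnb : ∀ k, ¬ bad (dyF c h k x) := by
      intro k
      induction k using Nat.strong_induction_on with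
      | _ k ih =>
        intro hb
        refine hcon1 (dyF c h k x) ⟨hb, ?_, ?_⟩ (hxc _ (mem_dyF c h k x))
        · rw [hx0]; exact dy_nest (Nat.zero_le _) x
        · intro q' hq' hsub
          have h1 := mem_dy_iff.1 (hsub (mem_dyF c h k x))
          rw [h1]; exact ih _ hq'
    have : Nonempty (Fin n) := ⟨⟨0, by omega⟩⟩
    have : Nontrivial (Rn n) := by infer_instance
    have hsn : 0 < √(n:ℝ) := Real.sqrt_pos.2 (by exact_mod_cast hn)
    have hδ : Filter.Tendsto (fun k : ℕ => √(n:ℝ) * (h / 2 ^ k)) Filter.atTop (nhdsWithin 0 (Ioi 0)) := by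
      refine tendsto_nhdsWithin_iff.2 ⟨?_, Filter.Eventually.of_forall fun k => ?_⟩
      · have h1 : Filter.Tendsto (fun k : ℕ => √(n:ℝ) * h * (1 / 2 : ℝ) ^ k) Filter.atTop (nhds (√(n:ℝ) * h * 0)) :=
          (_root_.tendsto_pow_atTop_nhds_zero_of_lt_one (by norm_num) (by norm_num)).const_mul _
        rw [mul_zero] at h1
        refine h1.congr fun k => ?_
        rw [one_div, inv_pow]; ring
      · simp only [mem_Ioi]; positivity
    have hxb : ∀ k, dy c h (dyF c h k x) ⊆ closedBall (dyc c h (dyF c h k x)) (√(n:ℝ) * (h / 2 ^ k)) := by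
      intro k
      rw [dy_eq hh]
      intro y hy
      rw [mem_closedBall, dist_eq_norm]
      refine norm_le_of_coord (by positivity) fun i => ?_
      have h1 := hy i
      rw [mem_Ico] at h1
      have h2 : (dyF c h k x).1 = k := rfl
      rw [h2] at h1
      rw [abs_le]; constructor <;> linarith
    have hlim := hx (fun k => dyc c h (dyF c h k x)) _ hδ
      (Filter.Eventually.of_forall fun k => by rw [one_mul]; exact hxb k (mem_dyF c h k x))
    set κ := √(n:ℝ) ^ n * (volume (ball (0 : Rn n) 1)).toReal / 2 ^ n with hκ
    have hκl := hlim.const_mul κ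
    rw [mul_zero] at hκl
    have hge : g x - α ≤ 0 := by
      refine ge_of_tendsto hκl (Filter.Eventually.of_forall fun k => ?_)
      set q := dyF c h k x with hq
      set B := closedBall (dyc c h q) (√(n:ℝ) * (h / 2 ^ k)) with hB
      have hrq : r q = h / 2 ^ k := rfl
      have hrp : 0 < h / 2 ^ k := by positivity
      have hvB : (volume B).toReal = κ * (2 * (h / 2 ^ k)) ^ n := by
        rw [hB, Measure.addHaar_closedBall _ _ (by positivity), ENNReal.toReal_mul,
          ENNReal.toReal_ofReal (by positivity), finrank_euclideanSpace, Fintype.card_fin, hκ,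
          mul_pow, mul_pow 2]
        field_simp
      have hvD : volume.real (dy c h q) = (2 * (h / 2 ^ k)) ^ n := by
        rw [Measure.real, dy_volume hh, ENNReal.toReal_ofReal (by positivity)]; rfl
      have h1 := not_lt.1 (hnb k)
      have hDfin : volume (dy c h q) ≠ ⊤ := by rw [dy_volume hh]; exact ENNReal.ofReal_ne_top
      have hBfin : volume B ≠ ⊤ := measure_closedBall_lt_top.ne
      have hi : IntegrableOn (fun y => ‖g y - g x‖) B volume :=
        (hg.integrableOn.sub (integrableOn_const hBfin)).norm
      have h2 : (g x - α) * (2 * (h / 2 ^ k)) ^ n ≤ ∫ y in B, ‖g y - g x‖ := by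
        calc (g x - α) * (2 * (h / 2 ^ k)) ^ n
            ≤ g x * (2 * (h / 2 ^ k)) ^ n - ∫ y in dy c h q, g y := by
              rw [hrq] at h1; linarith
          _ = ∫ y in dy c h q, (g x - g y) := by
              have hci : Integrable (fun _ : Rn n => g x) (volume.restrict (dy c h q)) := integrableOn_const hDfin
              rw [integral_sub hci hg.integrableOn, setIntegral_const, hvD,
                smul_eq_mul, mul_comm]
          _ ≤ ∫ y in dy c h q, ‖g y - g x‖ := by
              refine setIntegral_mono_on ((integrableOn_const hDfin).sub hg.integrableOn)
                (hi.mono_set (hxb k)) (dy_measurable hh q) fun y _ => ?_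
              rw [Real.norm_eq_abs, abs_sub_comm]; exact le_abs_self _
          _ ≤ _ := setIntegral_mono_set hi (Filter.Eventually.of_forall fun y => norm_nonneg _)
              (Filter.Eventually.of_forall (hxb k))
      rw [setAverage_eq, smul_eq_mul, Measure.real, hvB]
      have hκ0 : 0 < κ := by
        have : 0 < (volume (ball (0 : Rn n) 1)).toReal :=
          ENNReal.toReal_pos (measure_ball_pos _ _ one_pos).ne' measure_ball_lt_top.ne
        positivity
      rw [mul_inv, mul_assoc, mul_inv_cancel_left₀ hκ0.ne', inv_mul_eq_div,
        le_div_iff₀ (by positivity)]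
      exact h2
    linarith

lemma rpow_mul_nat {t : ℝ} (ht : 0 < t) (k m : ℕ) : t ^ ((m:ℝ) * (k:ℝ)) = (t ^ k) ^ m := by
  rw [mul_comm, Real.rpow_mul ht.le, Real.rpow_natCast, Real.rpow_natCast]

lemma bracket_mm {a b s u : ℝ} (hs : 0 < s) (hsa : s ≤ a) (hsb : s ≤ b - a) (hu : 0 < u) :
    u ^ (-a) * (u / (1 + u)) ^ b ≤ mm s u := by
  rcases le_total u 1 with h | h
  · rw [mm_of_le hs.le hu h]
    calc u ^ (-a) * (u / (1 + u)) ^ b ≤ u ^ (-a) * u ^ b := by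
          gcongr
          · linarith
          · exact div_le_self hu.le (by linarith)
      _ = u ^ (b - a) := by rw [← Real.rpow_add hu]; ring_nf
      _ ≤ u ^ s := Real.rpow_le_rpow_of_exponent_ge hu h hsb
  · rw [mm_of_ge hs.le h]
    calc u ^ (-a) * (u / (1 + u)) ^ b ≤ u ^ (-a) * 1 := by
          gcongr
          exact Real.rpow_le_one (by positivity) ((div_le_one (by positivity)).2 (by linarith)) (by linarith)
      _ ≤ u ^ (-s) := by
          rw [mul_one]; exact Real.rpow_le_rpow_of_exponent_le h (by linarith)

lemma bracket_mm' {a b s t R : ℝ} (hs : 0 < s) (hsa : s ≤ a) (hsb : s ≤ b - a) (ht : 0 < t)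
    (hR : 0 < R) : t ^ (-a) * (t / (t + R)) ^ b ≤ R ^ (-a) * mm s (t / R) := by
  have h := bracket_mm hs hsa hsb (div_pos ht hR)
  have e : t / R / (1 + t / R) = t / (t + R) := by field_simp; ring
  rw [e, Real.div_rpow ht.le hR.le] at h
  have hR' : 0 < R ^ (-a) := by positivity
  calc t ^ (-a) * (t / (t + R)) ^ b = R ^ (-a) * (t ^ (-a) / R ^ (-a) * (t / (t + R)) ^ b) := by
        field_simp
    _ ≤ _ := by gcongr

lemma lint_bracket {a b s R : ℝ} (hs : 0 < s) (hsa : s ≤ a) (hsb : s ≤ b - a)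
    (hR : 0 < R) : ∫⁻ t in Ioi (0:ℝ), ENNReal.ofReal (t ^ (-a) * (t / (t + R)) ^ b / t) ≤
      ENNReal.ofReal (R ^ (-a) * (2 / s)) := by
  calc _ ≤ ∫⁻ t in Ioi (0:ℝ), ENNReal.ofReal (R ^ (-a)) * ENNReal.ofReal (mm s (t / R) / t) := by
        refine setLIntegral_mono' measurableSet_Ioi fun t ht => ?_
        have ht' : 0 < t := ht
        rw [← ENNReal.ofReal_mul (by positivity)]
        refine ENNReal.ofReal_le_ofReal ?_
        rw [← mul_div_assoc]
        refine div_le_div_of_nonneg_right ?_ ht'.le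
        exact bracket_mm' hs hsa hsb ht' hR
    _ ≤ _ := by
        rw [lintegral_const_mul' _ _ ENNReal.ofReal_ne_top, ENNReal.ofReal_mul (by positivity)]
        gcongr
        exact lint_mm hR hs

lemma atom_near {C₁ C₂ δ γ : ℝ} (hC₂ : 0 < C₂)
    {ψ : Rn n → ℝ} (hψ : PsiKernel n C₁ C₂ δ γ ψ) (hψm : Measurable ψ) (hC₁ : 0 < C₁) (hδ : 0 < δ) (hγ : 0 < γ)
    {c : Rn n} {r : ℝ} (hr : 0 < r)
    {b : Rn n → ℝ} (hb : Integrable b volume) (hsupp : ∀ z, z ∉ cube c r → b z = 0)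
    (hmean : ∫ z, b z = 0) {t : ℝ} (ht : 0 < t) {y : Rn n} (hy : 2 * (√n * r) ≤ ‖y - c‖) :
    |cvl ψ t b y| ≤ (t ^ n)⁻¹ * C₂ * (√n * r / t) ^ γ * (t / (t + ‖y - c‖)) ^ ((n:ℝ) + δ + γ)
      * ∫ z, |b z| := by
  have e1 : cvl ψ t b y = ∫ z, (t ^ n)⁻¹ * (ψ (t⁻¹ • (y - z)) - ψ (t⁻¹ • (y - c))) * b z := by
    have hi1 : Integrable (fun z => (t ^ n)⁻¹ * ψ (t⁻¹ • (y - z)) * b z) volume := by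
      refine hb.bdd_mul (c := (t ^ n)⁻¹ * C₁) ?_ (Filter.Eventually.of_forall fun z => ?_)
      · exact ((hψm.comp (by fun_prop : Measurable fun z : Rn n => t⁻¹ • (y - z))).const_mul _).aestronglyMeasurable
      · exact cvl_kernel_abs_le hC₁ hδ hψ ht _
    have hi2 : Integrable (fun z => (t ^ n)⁻¹ * ψ (t⁻¹ • (y - c)) * b z) volume := hb.const_mul _
    have : ∫ z, (t ^ n)⁻¹ * ψ (t⁻¹ • (y - c)) * b z = 0 := by
      rw [integral_const_mul, hmean, mul_zero]
    rw [cvl, ← sub_zero (∫ z, (t ^ n)⁻¹ * ψ (t⁻¹ • (y - z)) * b z), ← this, ← integral_sub hi1 hi2]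
    congr 1; funext z; ring
  rw [e1, ← integral_const_mul, ← Real.norm_eq_abs]
  refine norm_integral_le_of_norm_le (hb.abs.const_mul _) (Filter.Eventually.of_forall fun z => ?_)
  by_cases hz : z ∈ cube c r
  · have hz' := cube_norm_le hr.le hz
    have h4 := hψ.2.2.2 (t⁻¹ • (y - c)) (t⁻¹ • (c - z)) (by
      rw [norm_smul, norm_smul, norm_sub_rev c z]
      have : 0 ≤ ‖t⁻¹‖ := norm_nonneg _
      nlinarith)
    rw [← smul_add, sub_add_sub_cancel, norm_smul, norm_smul, Real.norm_of_nonneg (by positivity),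
      norm_sub_rev c z] at h4
    rw [Real.norm_eq_abs, abs_mul, abs_mul, abs_of_pos (by positivity : 0 < (t ^ n)⁻¹),
      bracket_eq ht _ (norm_nonneg _)]
    refine mul_le_mul_of_nonneg_right ?_ (abs_nonneg _)
    rw [mul_assoc, mul_assoc]
    refine mul_le_mul_of_nonneg_left ?_ (by positivity)
    refine h4.trans ?_
    rw [mul_assoc]
    refine mul_le_mul_of_nonneg_left ?_ hC₂.le
    refine mul_le_mul_of_nonneg_right ?_ (by positivity)
    rw [inv_mul_eq_div]
    gcongr
  · rw [hsupp z hz]; simp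

set_option maxHeartbeats 1000000 in
lemma atom_est (hn : 1 ≤ n) {C₁ C₂ δ γ : ℝ} (hC₁ : 0 < C₁) (hC₂ : 0 < C₂) (hδ : 0 < δ) (hγ : 0 < γ)
    {ψ : Rn n → ℝ} (hψ : PsiKernel n C₁ C₂ δ γ ψ) {lam : ℝ}
    (hlamn : (lam - 3) * (n : ℝ) > 2 * δ + 2 * γ) :
    ∃ C : ℝ, 0 < C ∧ ∀ (c : Rn n) (r : ℝ) (b : Rn n → ℝ), 0 < r → Integrable b volume →
      (∀ z, z ∉ cube c r → b z = 0) → ∫ z, b z = 0 → ∀ x : Rn n, 4 * (√n * r) ≤ ‖x - c‖ →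
      Gstar ψ lam b x ^ 2 ≤ ENNReal.ofReal (C * (∫ z, |b z|) ^ 2 *
        ((√n * r) ^ (2 * γ) * ‖x - c‖ ^ (-(2 * n + 2 * γ)) +
          (√n * r) ^ n * ‖x - c‖ ^ (-(3 * (n:ℝ))))) := by
  have hn' : (1:ℝ) ≤ n := by exact_mod_cast hn
  set β : ℝ := 2 * n + 2 * δ + 2 * γ with hβ
  set κ : ℝ := lam * n - β with hκ
  have hκn : (n:ℝ) < κ := by rw [hκ, hβ]; nlinarith
  set s0 : ℝ := min (2 * δ) (2 * n + 2 * γ) with hs0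
  have hs0p : 0 < s0 := lt_min (by linarith) (by linarith)
  set s1 : ℝ := min (lam * n - 3 * n) (3 * n) with hs1
  have hs1p : 0 < s1 := lt_min (by nlinarith) (by linarith)
  set J := (JB n κ).toReal with hJ
  have hJe : JB n κ = ENNReal.ofReal J := (ENNReal.ofReal_toReal (JB_lt_top hκn).ne).symm
  have hJ0 : 0 ≤ J := ENNReal.toReal_nonneg
  set D1 : ℝ := C₂ ^ 2 * J * (2 / s0) with hD1
  set D2 : ℝ := C₁ ^ 2 * 4 ^ n * 2 ^ (3 * (n:ℝ)) * (2 / s1) with hD2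
  have hD1p : 0 ≤ D1 := by positivity
  have hD2p : 0 < D2 := by positivity
  refine ⟨D1 + D2, by linarith, fun c r b hr hb hsupp hmean x hx => ?_⟩
  have hψm := psi_measurable hγ hψ
  set N := ∫ z, |b z| with hN
  have hN0 : 0 ≤ N := integral_nonneg fun z => abs_nonneg _
  set s := √n * r with hs
  have hsp : 0 < s := mul_pos (Real.sqrt_pos.2 (by linarith)) hr
  set R := ‖x - c‖ with hR
  have hRp : 0 < R := by linarith
  rw [Gstar_sq]
  unfold SQ
  calc ∫⁻ t in Ioi (0:ℝ), ∫⁻ y, wk lam t x y * ‖cvl ψ t b y‖ₑ ^ 2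
      ≤ ∫⁻ t in Ioi (0:ℝ), (ENNReal.ofReal (C₂ ^ 2 * N ^ 2 * s ^ (2 * γ) * J) *
            ENNReal.ofReal (t ^ (-(2 * n + 2 * γ)) * (t / (t + R)) ^ β / t) +
          ENNReal.ofReal (C₁ ^ 2 * N ^ 2 * (4 * s) ^ n) *
            ENNReal.ofReal (t ^ (-(3 * (n:ℝ))) * (t / (t + R / 2)) ^ (lam * n) / t)) := by
        refine setLIntegral_mono' measurableSet_Ioi fun t ht => ?_
        have ht' : 0 < t := ht
        set K1 : ℝ := C₂ ^ 2 * N ^ 2 * s ^ (2 * γ) * (t ^ (-(2 * n + 2 * γ)) * (t / (t + R)) ^ β / t) * (t ^ n)⁻¹ with hK1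
        set K2 : ℝ := C₁ ^ 2 * N ^ 2 * (t ^ (-(3 * (n:ℝ))) * (t / (t + R / 2)) ^ (lam * n) / t) with hK2
        have hK1p : 0 ≤ K1 := by positivity
        have hK2p : 0 ≤ K2 := by positivity
        calc ∫⁻ y, wk lam t x y * ‖cvl ψ t b y‖ₑ ^ 2
            ≤ ∫⁻ y, (ENNReal.ofReal K1 * ENNReal.ofReal ((t / (t + dist x y)) ^ κ) +
                (cube c (2 * s)).indicator (fun _ => ENNReal.ofReal K2) y) := by
              refine lintegral_mono fun y => ?_
              rw [← ofReal_norm, wk, ← ENNReal.ofReal_pow (norm_nonneg _),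
                ← ENNReal.ofReal_mul (by positivity)]
              by_cases hy : 2 * s ≤ ‖y - c‖
              · refine le_add_right ?_
                rw [← ENNReal.ofReal_mul hK1p]
                refine ENNReal.ofReal_le_ofReal ?_
                have h1 := atom_near hC₂ hψ hψm hC₁ hδ hγ hr hb hsupp hmean ht' hy
                set v := t / (t + dist x y) with hv
                set w := t / (t + ‖y - c‖) with hw
                have hv0 : 0 < v := by positivity
                have hw0 : 0 < w := by positivity
                have hvw : v * w ≤ t / (t + R) := by
                  rw [hv, hw, div_mul_div_comm, div_le_div_iff₀ (by positivity) (by positivity)]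
                  have h3 : R ≤ dist x y + ‖y - c‖ := by
                    rw [dist_eq_norm]; exact norm_sub_le_norm_sub_add_norm_sub x y c
                  have h4 : 0 ≤ dist x y * ‖y - c‖ := by positivity
                  nlinarith [mul_pos ht' ht']
                have e1 : v ^ (lam * n) = v ^ β * v ^ κ := by
                  rw [← Real.rpow_add hv0, hκ]; ring_nf
                have e2 : (w ^ ((n:ℝ) + δ + γ)) ^ 2 = w ^ β := by
                  rw [← Real.rpow_natCast, ← Real.rpow_mul hw0.le, hβ]; congr 1; push_cast; ring
                have e3 : ((s / t) ^ γ) ^ 2 = s ^ (2 * γ) * t ^ (-(2 * γ)) := by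
                  rw [← Real.rpow_natCast, ← Real.rpow_mul (by positivity), Real.rpow_neg ht'.le,
                    Real.div_rpow hsp.le ht'.le, div_eq_mul_inv]
                  push_cast; rw [mul_comm γ 2]
                have e4 : t ^ (-(2 * n + 2 * γ)) = ((t ^ n)⁻¹) ^ 2 * t ^ (-(2 * γ)) := by
                  have e0 : t ^ (2 * (n:ℝ)) = (t ^ n) ^ 2 := rpow_mul_nat ht' n 2
                  rw [neg_add, Real.rpow_add ht', Real.rpow_neg ht'.le (2 * (n:ℝ)), e0, inv_pow]
                calc v ^ (lam * n) / t ^ (n + 1) * ‖cvl ψ t b y‖ ^ 2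
                    ≤ v ^ (lam * n) / t ^ (n + 1) * ((t ^ n)⁻¹ * C₂ * (s / t) ^ γ * w ^ ((n:ℝ) + δ + γ) * N) ^ 2 := by
                      refine mul_le_mul_of_nonneg_left ?_ (by positivity)
                      exact pow_le_pow_left₀ (norm_nonneg _) h1 2
                  _ = C₂ ^ 2 * N ^ 2 * s ^ (2 * γ) * (t ^ (-(2 * n + 2 * γ)) * (v * w) ^ β / t) * (t ^ n)⁻¹ * v ^ κ := by
                      rw [e1, mul_pow, mul_pow, mul_pow, mul_pow, e2, e3, e4, Real.mul_rpow hv0.le hw0.le,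
                        pow_succ t n]
                      field_simp
                  _ ≤ _ := by
                      refine mul_le_mul_of_nonneg_right ?_ (by positivity)
                      rw [hK1]
                      refine mul_le_mul_of_nonneg_right ?_ (by positivity)
                      refine mul_le_mul_of_nonneg_left ?_ (by positivity)
                      refine div_le_div_of_nonneg_right ?_ ht'.le
                      refine mul_le_mul_of_nonneg_left ?_ (by positivity)
                      exact Real.rpow_le_rpow (by positivity) hvw (by positivity)
              · have hy' : y ∈ cube c (2 * s) := mem_cube_of_norm (not_le.1 hy)
                rw [indicator_of_mem hy']
                refine le_add_left (ENNReal.ofReal_le_ofReal ?_)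
                have h1 := cvl_abs_le hC₁ hδ hψ ht' hb y
                have h2 : R / 2 ≤ dist x y := by
                  rw [dist_eq_norm]
                  have := norm_sub_le_norm_sub_add_norm_sub x y c
                  linarith [not_le.1 hy]
                have e4 : t ^ (-(3 * (n:ℝ))) = ((t ^ n)⁻¹) ^ 3 := by
                  have e0 : t ^ (3 * (n:ℝ)) = (t ^ n) ^ 3 := rpow_mul_nat ht' n 3
                  rw [Real.rpow_neg ht'.le, e0, inv_pow]
                have h3 : (t / (t + dist x y)) ^ (lam * n) ≤ (t / (t + R / 2)) ^ (lam * n) := by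
                  refine Real.rpow_le_rpow (by positivity) ?_ (by nlinarith)
                  gcongr
                calc (t / (t + dist x y)) ^ (lam * n) / t ^ (n + 1) * ‖cvl ψ t b y‖ ^ 2
                    ≤ (t / (t + R / 2)) ^ (lam * n) / t ^ (n + 1) * ((t ^ n)⁻¹ * C₁ * N) ^ 2 := by
                      refine mul_le_mul ?_ (pow_le_pow_left₀ (norm_nonneg _) h1 2) (by positivity) (by positivity)
                      exact div_le_div_of_nonneg_right h3 (by positivity)
                  _ = K2 := by
                      rw [hK2, e4, pow_succ t n]; field_simp
          _ ≤ _ := by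
              rw [lintegral_add_right _ (measurable_const.indicator (measurableSet_cube _ _)),
                lintegral_const_mul' _ _ ENNReal.ofReal_ne_top, lintegral_bracket ht', hJe,
                lintegral_indicator (measurableSet_cube _ _), setLIntegral_const,
                volume_cube _ (by positivity), ← ENNReal.ofReal_mul (by positivity),
                ← ENNReal.ofReal_mul (by positivity), ← ENNReal.ofReal_mul (by positivity),
                ← ENNReal.ofReal_mul (by positivity), ← ENNReal.ofReal_mul (by positivity)]
              refine add_le_add (ENNReal.ofReal_le_ofReal (le_of_eq ?_)) (ENNReal.ofReal_le_ofReal (le_of_eq ?_))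
              · rw [hK1]; field_simp
              · rw [hK2]; ring
    _ ≤ ENNReal.ofReal (C₂ ^ 2 * N ^ 2 * s ^ (2 * γ) * J) * ENNReal.ofReal (R ^ (-(2 * n + 2 * γ)) * (2 / s0)) +
        ENNReal.ofReal (C₁ ^ 2 * N ^ 2 * (4 * s) ^ n) * ENNReal.ofReal ((R / 2) ^ (-(3 * (n:ℝ))) * (2 / s1)) := by
        rw [lintegral_add_left (by fun_prop), lintegral_const_mul' _ _ ENNReal.ofReal_ne_top,
          lintegral_const_mul' _ _ ENNReal.ofReal_ne_top]
        gcongr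
        · exact lint_bracket hs0p (min_le_right _ _) ((min_le_left _ _).trans (by linarith)) hRp
        · exact lint_bracket hs1p (min_le_right _ _) (min_le_left _ _) (by linarith)
    _ ≤ _ := by
        rw [← ENNReal.ofReal_mul (by positivity), ← ENNReal.ofReal_mul (by positivity),
          ← ENNReal.ofReal_add (by positivity) (by positivity)]
        refine ENNReal.ofReal_le_ofReal ?_
        rw [Real.div_rpow hRp.le (by norm_num), Real.rpow_neg (by norm_num : (0:ℝ) ≤ 2), div_inv_eq_mul]
        set X := s ^ (2 * γ) * R ^ (-(2 * n + 2 * γ)) with hX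
        set Y := s ^ n * R ^ (-(3 * (n:ℝ))) with hY
        have hX0 : 0 ≤ X := by positivity
        have hY0 : 0 ≤ Y := by positivity
        calc _ = D1 * N ^ 2 * X + D2 * N ^ 2 * Y := by
              rw [hD1, hD2, hX, hY, mul_pow]; ring
          _ ≤ (D1 + D2) * N ^ 2 * (X + Y) := by
              have : 0 ≤ D1 * N ^ 2 * Y := by positivity
              have : 0 ≤ D2 * N ^ 2 * X := by positivity
              nlinarith

lemma atom_est' (hn : 1 ≤ n) {C₁ C₂ δ γ : ℝ} (hC₁ : 0 < C₁) (hC₂ : 0 < C₂) (hδ : 0 < δ) (hγ : 0 < γ)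
    {ψ : Rn n → ℝ} (hψ : PsiKernel n C₁ C₂ δ γ ψ) {lam : ℝ}
    (hlamn : (lam - 3) * (n : ℝ) > 2 * δ + 2 * γ) :
    ∃ C : ℝ, 0 < C ∧ ∀ (c : Rn n) (r : ℝ) (b : Rn n → ℝ), 0 < r → Integrable b volume →
      (∀ z, z ∉ cube c r → b z = 0) → ∫ z, b z = 0 →
      ∫⁻ x in (cube c (4 * (√n * r)))ᶜ, Gstar ψ lam b x ≤ ENNReal.ofReal (C * ∫ z, |b z|) := by
  obtain ⟨C, hC, h⟩ := atom_est hn hC₁ hC₂ hδ hγ hψ hlamn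
  have hn' : (1:ℝ) ≤ n := by exact_mod_cast hn
  set ε := min γ ((n:ℝ) / 2) with hε
  have hεp : 0 < ε := lt_min hγ (by linarith)
  set J := (JB n (n + ε)).toReal with hJ
  have hJe : JB n (n + ε) = ENNReal.ofReal J := (ENNReal.ofReal_toReal (JB_lt_top (by linarith)).ne).symm
  have hJ0 : 0 ≤ J := ENNReal.toReal_nonneg
  refine ⟨√(2 * C) * 2 ^ (n + ε) * J + 1, by positivity, fun c r b hr hb hsupp hmean => ?_⟩
  set N := ∫ z, |b z| with hN
  have hN0 : 0 ≤ N := integral_nonneg fun z => abs_nonneg _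
  set s := √n * r with hs
  have hsp : 0 < s := mul_pos (Real.sqrt_pos.2 (by linarith)) hr
  have key : ∀ x ∈ (cube c (4 * s))ᶜ, Gstar ψ lam b x ≤
      ENNReal.ofReal (√(2 * C) * 2 ^ (n + ε) * N * (s ^ n)⁻¹) * ENNReal.ofReal ((s / (s + dist c x)) ^ (n + ε)) := by
    intro x hx
    have hxR : 4 * s ≤ ‖x - c‖ := by
      by_contra hcon
      exact hx (mem_cube_of_norm (not_le.1 hcon))
    have h1 := h c r b hr hb hsupp hmean x hxR
    rw [dist_comm, dist_eq_norm]
    set R := ‖x - c‖ with hR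
    have hRp : 0 < R := by linarith
    have hu : s / R ≤ 1 := (div_le_one hRp).2 (by linarith)
    have hu0 : 0 < s / R := by positivity
    have e1 : s ^ (2 * γ) * R ^ (-(2 * n + 2 * γ)) = ((s ^ n)⁻¹) ^ 2 * (s / R) ^ (2 * n + 2 * γ) := by
      have e0 : s ^ (2 * (n:ℝ)) = (s ^ n) ^ 2 := rpow_mul_nat hsp n 2
      rw [Real.div_rpow hsp.le hRp.le, Real.rpow_neg hRp.le, Real.rpow_add hsp, e0]
      field_simp
    have e2 : s ^ n * R ^ (-(3 * (n:ℝ))) = ((s ^ n)⁻¹) ^ 2 * (s / R) ^ (3 * (n:ℝ)) := by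
      have e0 : s ^ (3 * (n:ℝ)) = (s ^ n) ^ 3 := rpow_mul_nat hsp n 3
      rw [Real.div_rpow hsp.le hRp.le, Real.rpow_neg hRp.le, e0]
      field_simp
    have e3 : (s / R) ^ (2 * n + 2 * γ) ≤ (s / R) ^ (2 * (n + ε)) :=
      Real.rpow_le_rpow_of_exponent_ge hu0 hu (by have := min_le_left γ ((n:ℝ) / 2); linarith)
    have e4 : (s / R) ^ (3 * (n:ℝ)) ≤ (s / R) ^ (2 * (n + ε)) :=
      Real.rpow_le_rpow_of_exponent_ge hu0 hu (by have := min_le_right γ ((n:ℝ) / 2); linarith)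
    have e5 : (s / R) ^ (2 * (n + ε)) = ((s / R) ^ (n + ε)) ^ 2 := by
      rw [mul_comm, Real.rpow_mul hu0.le]; norm_num
    have e6 : s / R ≤ 2 * (s / (s + R)) := by
      rw [← mul_div_assoc, div_le_div_iff₀ hRp (by positivity)]; nlinarith
    have e7 : (s / R) ^ (n + ε) ≤ 2 ^ (n + ε) * (s / (s + R)) ^ (n + ε) := by
      rw [← Real.mul_rpow (by norm_num) (by positivity)]
      exact Real.rpow_le_rpow hu0.le e6 (by positivity)
    rw [← ENNReal.ofReal_mul (by positivity), ← ENNReal.pow_le_pow_left_iff (two_ne_zero),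
      ← ENNReal.ofReal_pow (by positivity)]
    refine h1.trans (ENNReal.ofReal_le_ofReal ?_)
    rw [e1, e2, ← mul_add]
    calc C * N ^ 2 * (((s ^ n)⁻¹) ^ 2 * ((s / R) ^ (2 * n + 2 * γ) + (s / R) ^ (3 * (n:ℝ))))
        ≤ C * N ^ 2 * (((s ^ n)⁻¹) ^ 2 * ((s / R) ^ (2 * (n + ε)) + (s / R) ^ (2 * (n + ε)))) := by
          gcongr
      _ = (2 * C) * (N * (s ^ n)⁻¹ * (s / R) ^ (n + ε)) ^ 2 := by rw [e5]; ring
      _ = (√(2 * C) * (N * (s ^ n)⁻¹ * (s / R) ^ (n + ε))) ^ 2 := by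
          rw [mul_pow (√(2 * C)), Real.sq_sqrt (by positivity)]
      _ ≤ (√(2 * C) * (N * (s ^ n)⁻¹ * (2 ^ (n + ε) * (s / (s + R)) ^ (n + ε)))) ^ 2 := by
          gcongr
      _ = _ := by ring
  calc ∫⁻ x in (cube c (4 * s))ᶜ, Gstar ψ lam b x
      ≤ ∫⁻ x in (cube c (4 * s))ᶜ, ENNReal.ofReal (√(2 * C) * 2 ^ (n + ε) * N * (s ^ n)⁻¹) *
          ENNReal.ofReal ((s / (s + dist c x)) ^ (n + ε)) :=
        setLIntegral_mono' (measurableSet_cube _ _).compl key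
    _ ≤ ∫⁻ x, ENNReal.ofReal (√(2 * C) * 2 ^ (n + ε) * N * (s ^ n)⁻¹) *
          ENNReal.ofReal ((s / (s + dist c x)) ^ (n + ε)) := setLIntegral_le_lintegral _ _
    _ = ENNReal.ofReal (√(2 * C) * 2 ^ (n + ε) * J * N) := by
        rw [lintegral_const_mul' _ _ ENNReal.ofReal_ne_top, lintegral_bracket hsp, hJe,
          ← ENNReal.ofReal_mul (by positivity), ← ENNReal.ofReal_mul (by positivity)]
        congr 1; field_simp
    _ ≤ _ := ENNReal.ofReal_le_ofReal (by gcongr; linarith)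

lemma mink_fin {α ι : Type*} [MeasurableSpace α] (μ : Measure α) (F : ι → α → ℝ≥0∞)
    (hF : ∀ i, Measurable (F i)) (s : Finset ι) :
    (∫⁻ a, (∑ i ∈ s, F i a) ^ (2:ℝ) ∂μ) ^ (1 / (2:ℝ)) ≤ ∑ i ∈ s, (∫⁻ a, F i a ^ (2:ℝ) ∂μ) ^ (1 / (2:ℝ)) := by
  classical
  induction s using Finset.induction_on with
  | empty => simp
  | insert i s hi ih =>
    simp only [Finset.sum_insert hi]
    refine (ENNReal.lintegral_Lp_add_le (f := F i) (g := fun a => ∑ i ∈ s, F i a)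
      (hF i).aemeasurable (Finset.measurable_fun_sum s fun i _ => hF i).aemeasurable (by norm_num)).trans ?_
    gcongr

lemma mink_tsum {α ι : Type*} [Countable ι] [MeasurableSpace α] (μ : Measure α) (F : ι → α → ℝ≥0∞)
    (hF : ∀ i, Measurable (F i)) :
    (∫⁻ a, (∑' i, F i a) ^ (2:ℝ) ∂μ) ^ (1 / (2:ℝ)) ≤ ∑' i, (∫⁻ a, F i a ^ (2:ℝ) ∂μ) ^ (1 / (2:ℝ)) := by
  classical
  rw [one_div, ENNReal.rpow_inv_le_iff (by norm_num)]
  have : ∀ a, (∑' i, F i a) ^ (2:ℝ) = ⨆ s : Finset ι, (∑ i ∈ s, F i a) ^ (2:ℝ) := by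
    intro a
    rw [ENNReal.tsum_eq_iSup_sum]
    exact (ENNReal.orderIsoRpow 2 (by norm_num)).map_iSup _
  simp_rw [this]
  rw [lintegral_iSup_directed]
  · refine iSup_le fun s => ?_
    rw [← ENNReal.rpow_inv_le_iff (by norm_num), ← one_div]
    refine (mink_fin μ F hF s).trans ?_
    simp only [one_div]
    exact ENNReal.sum_le_tsum s
  · intro s
    exact ((Finset.measurable_fun_sum s fun i _ => hF i).pow_const _).aemeasurable
  · intro s t
    refine ⟨s ∪ t, fun a => ?_, fun a => ?_⟩
    · dsimp only
      gcongr
      exact Finset.subset_union_left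
    · dsimp only
      gcongr
      exact Finset.subset_union_right

/-- the measure underlying `SQ`. -/
def muSQ (lam : ℝ) (x : Rn n) : Measure (ℝ × Rn n) :=
  (((volume : Measure ℝ).restrict (Ioi 0)).prod (volume : Measure (Rn n))).withDensity
    (fun q => wk lam q.1 x q.2)

lemma wk_measurable' (lam : ℝ) (x : Rn n) : Measurable (fun q : ℝ × Rn n => wk lam q.1 x q.2) :=
  (wk_measurable lam).comp (f := fun q : ℝ × Rn n => ((x, q.1), q.2)) (by fun_prop)

lemma SQ_eq (lam : ℝ) (x : Rn n) {F : ℝ → Rn n → ℝ≥0∞}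
    (hF : Measurable (fun q : ℝ × Rn n => F q.1 q.2)) :
    SQ lam F x = ∫⁻ q, (F q.1 q.2) ^ (2:ℝ) ∂(muSQ lam x) := by
  rw [muSQ, lintegral_withDensity_eq_lintegral_mul _ (wk_measurable' lam x) (hF.pow_const _),
    lintegral_prod _ ((wk_measurable' lam x).mul (hF.pow_const _)).aemeasurable]
  simp [SQ]

lemma Gstar_eq' {ψ : Rn n → ℝ} (hψ : Measurable ψ) (lam : ℝ) {f : Rn n → ℝ}
    (hf : AEStronglyMeasurable f volume) (x : Rn n) :
    Gstar ψ lam f x = (∫⁻ q, ‖cvl ψ q.1 f q.2‖ₑ ^ (2:ℝ) ∂(muSQ lam x)) ^ (1 / (2:ℝ)) := by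
  rw [Gstar_eq, SQ_eq lam x (cvl_measurable hψ hf).enorm]

lemma Gstar_le_sum {ψ : Rn n → ℝ} (hψ : Measurable ψ) (lam : ℝ) {ι : Type*} [Countable ι]
    {f g : Rn n → ℝ} {b : ι → Rn n → ℝ}
    (hg : AEStronglyMeasurable g volume)
    (hb : ∀ i, AEStronglyMeasurable (b i) volume)
    (h : ∀ t > 0, ∀ y, ‖cvl ψ t f y‖ₑ ≤ ‖cvl ψ t g y‖ₑ + ∑' i, ‖cvl ψ t (b i) y‖ₑ) (x : Rn n) :
    Gstar ψ lam f x ≤ Gstar ψ lam g x + ∑' i, Gstar ψ lam (b i) x := by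
  have mg := (cvl_measurable hψ hg).enorm
  have mb := fun i => (cvl_measurable hψ (hb i)).enorm
  have ms : Measurable (fun q : ℝ × Rn n => ∑' i, ‖cvl ψ q.1 (b i) q.2‖ₑ) := Measurable.tsum mb
  have h1 : Gstar ψ lam f x ≤ (SQ lam (fun t y => ‖cvl ψ t g y‖ₑ + ∑' i, ‖cvl ψ t (b i) y‖ₑ) x) ^ (1/2 : ℝ) := by
    rw [Gstar_eq]
    exact ENNReal.rpow_le_rpow (SQ_mono lam x h) (by norm_num)
  refine h1.trans ?_
  rw [SQ_eq lam x (mg.add ms)]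
  refine (ENNReal.lintegral_Lp_add_le mg.aemeasurable ms.aemeasurable (by norm_num)).trans ?_
  rw [← Gstar_eq' hψ lam hg]
  gcongr
  refine (mink_tsum _ _ mb).trans_eq ?_
  exact tsum_congr fun i => (Gstar_eq' hψ lam (hb i) x).symm

lemma cz_decomp (hn : 1 ≤ n) (c : Rn n) {h : ℝ} (hh : 0 < h) {f : Rn n → ℝ} (hf : Integrable f volume)
    (hsupp : ∀ x ∉ cube c h, f x = 0) {α : ℝ} (hα0 : 0 < α)
    (hα : avg (fun x => |f x|) (cube c h) ≤ α) :
    ∃ (ι : Type) (_ : Countable ι) (good : Rn n → ℝ) (b : ι → Rn n → ℝ) (cc : ι → Rn n) (r : ι → ℝ),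
      (∀ i, 0 < r i) ∧ Integrable good volume ∧
      ∫⁻ x, ‖good x‖ₑ ^ 2 ≤ ENNReal.ofReal (2 ^ n * α) * ∫⁻ x, ‖f x‖ₑ ∧
      (∀ i, Integrable (b i) volume) ∧ (∀ i, ∀ z ∉ cube (cc i) (r i), b i z = 0) ∧
      (∀ i, ∫ z, b i z = 0) ∧
      (∑' i, ENNReal.ofReal (∫ z, |b i z|) ≤ 2 * ∫⁻ x, ‖f x‖ₑ) ∧
      (∑' i, ENNReal.ofReal (α * (2 * r i) ^ n) ≤ ∫⁻ x, ‖f x‖ₑ) ∧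
      ∀ (k : Rn n → ℝ) (M : ℝ), Measurable k → (∀ x, |k x| ≤ M) →
        ‖∫ x, k x * f x‖ₑ ≤ ‖∫ x, k x * good x‖ₑ + ∑' i, ‖∫ x, k x * b i x‖ₑ := by
  obtain ⟨I, cc, r, hr, hdis, hsub, hlow, hup, hae⟩ := cz hn c hh (fun x => abs_nonneg (f x)) hf.abs hα
  set Q : I → Set (Rn n) := fun i => cube (cc i) (r i) with hQ
  have hQm : ∀ i, MeasurableSet (Q i) := fun i => measurableSet_cube _ _
  have hQd : Pairwise (Function.onFun Disjoint Q) := by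
    intro i j hij
    exact hdis i.2 j.2 (fun h => hij (Subtype.ext h))
  have hQv : ∀ i, volume (Q i) = ENNReal.ofReal ((2 * r i) ^ n) := fun i => volume_cube _ (hr _).le
  set U := ⋃ i, Q i with hU
  have hUm : MeasurableSet U := MeasurableSet.iUnion hQm
  set a : I → ℝ := fun i => avg f (Q i) with ha
  have hpos : ∀ i : I, 0 < (2 * r i) ^ n := fun i => by have := hr i; positivity
  have havg : ∀ i, |a i| * (2 * r i) ^ n ≤ ∫ x in Q i, |f x| := by
    intro i
    have h1 : ∫ x in Q i, f x = (2 * r i) ^ n * a i := setIntegral_cube_eq_avg f _ (hr i)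
    rw [mul_comm, ← abs_of_pos (hpos i), ← abs_mul, ← h1]
    exact abs_integral_le_integral_abs
  have ha_le : ∀ i, |a i| ≤ 2 ^ n * α := fun i => by
    have := (havg i).trans (hup i i.2)
    exact le_of_mul_le_mul_right this (hpos i)
  have hfQ : ∀ i, ENNReal.ofReal (∫ x in Q i, |f x|) = ∫⁻ x in Q i, ‖f x‖ₑ := fun i =>
    ofReal_integral_norm_eq_lintegral_enorm hf.integrableOn
  have hconst : ∀ i, ∫⁻ x in Q i, ‖a i‖ₑ ≤ ∫⁻ x in Q i, ‖f x‖ₑ := by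
    intro i
    rw [setLIntegral_const, hQv, Real.enorm_eq_ofReal_abs, ← ENNReal.ofReal_mul (abs_nonneg _), ← hfQ]
    exact ENNReal.ofReal_le_ofReal (havg i)
  set b : I → Rn n → ℝ := fun i => (Q i).indicator (fun x => f x - a i) with hb
  have hvf : ∀ i, IsFiniteMeasure (volume.restrict (Q i)) := fun i =>
    ⟨by rw [Measure.restrict_apply_univ, hQv]; exact ENNReal.ofReal_lt_top⟩
  have hbint' : ∀ i, IntegrableOn (fun x => f x - a i) (Q i) volume := fun i =>
    have := hvf i
    hf.integrableOn.sub (integrable_const _)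
  have hbint : ∀ i, Integrable (b i) volume := fun i =>
    (hbint' i).integrable_indicator (hQm i)
  have hbn : ∀ i, ENNReal.ofReal (∫ z, |b i z|) ≤ 2 * ∫⁻ x in Q i, ‖f x‖ₑ := by
    intro i
    have : ENNReal.ofReal (∫ z, |b i z|) = ∫⁻ z, ‖b i z‖ₑ := ofReal_integral_norm_eq_lintegral_enorm (hbint i)
    rw [this]
    have h2 : ∀ z, ‖b i z‖ₑ = (Q i).indicator (fun x => ‖f x - a i‖ₑ) z := fun z =>
      enorm_indicator_eq_indicator_enorm (f := fun x => f x - a i) (s := Q i) (a := z)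
    simp_rw [h2]
    rw [lintegral_indicator (hQm i), two_mul]
    calc ∫⁻ x in Q i, ‖f x - a i‖ₑ ≤ ∫⁻ x in Q i, (‖f x‖ₑ + ‖a i‖ₑ) :=
          lintegral_mono fun x => enorm_sub_le
      _ = (∫⁻ x in Q i, ‖f x‖ₑ) + ∫⁻ x in Q i, ‖a i‖ₑ := lintegral_add_right _ measurable_const
      _ ≤ _ := add_le_add le_rfl (hconst i)
  have hsum : ∑' i, ∫⁻ x in Q i, ‖f x‖ₑ = ∫⁻ x in U, ‖f x‖ₑ := (lintegral_iUnion hQm hQd _).symm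
  have hsumle : ∑' i, ∫⁻ x in Q i, ‖f x‖ₑ ≤ ∫⁻ x, ‖f x‖ₑ := by
    rw [hsum]; exact setLIntegral_le_lintegral _ _
  have hffin : ∫⁻ x, ‖f x‖ₑ ≠ ⊤ := hf.2.ne
  have hbs : ∑' i, ENNReal.ofReal (∫ z, |b i z|) ≤ 2 * ∫⁻ x, ‖f x‖ₑ := by
    refine (ENNReal.tsum_le_tsum hbn).trans ?_
    rw [ENNReal.tsum_mul_left]
    gcongr
  set st : Rn n → ℝ := fun x => ∑' i, (Q i).indicator (fun _ => a i) x with hst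
  have hstm : Measurable st := Measurable.tsum fun i => measurable_const.indicator (hQm i)
  set good : Rn n → ℝ := fun x => Uᶜ.indicator f x + st x with hgood
  have huniq : ∀ i x, x ∈ Q i → ∀ j, j ≠ i → x ∉ Q j := fun i x hx j hj hxj =>
    Set.disjoint_left.1 (hQd hj) hxj hx
  have hgU : ∀ i x, x ∈ Q i → good x = a i := by
    intro i x hx
    have h1 : x ∉ Uᶜ := fun h => h (mem_iUnion.2 ⟨i, hx⟩)
    simp only [hgood, hst]
    rw [Set.indicator_of_notMem h1, zero_add, tsum_eq_single i, Set.indicator_of_mem hx]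
    intro j hj
    exact Set.indicator_of_notMem (huniq i x hx j hj) _
  have hgUc : ∀ x, x ∉ U → good x = f x := by
    intro x hx
    simp only [hgood, hst]
    rw [Set.indicator_of_mem (by exact hx)]
    have : ∀ i, (Q i).indicator (fun _ => a i) x = 0 := fun i =>
      Set.indicator_of_notMem (fun h => hx (mem_iUnion.2 ⟨i, h⟩)) _
    simp [this]
  have hdec : ∀ x, f x = good x + ∑' i, b i x := by
    intro x
    by_cases hx : x ∈ U
    · obtain ⟨i, hi⟩ := mem_iUnion.1 hx
      rw [hgU i x hi, tsum_eq_single i]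
      · simp only [hb]; rw [Set.indicator_of_mem hi]; ring
      · intro j hj
        exact Set.indicator_of_notMem (huniq i x hi j hj) _
    · rw [hgUc x hx]
      have : ∀ i, b i x = 0 := fun i =>
        Set.indicator_of_notMem (fun h => hx (mem_iUnion.2 ⟨i, h⟩)) _
      simp [this]
  have hg1 : ∫⁻ x, ‖good x‖ₑ ≤ ∫⁻ x, ‖f x‖ₑ := by
    rw [← lintegral_add_compl _ hUm, ← lintegral_add_compl (fun x => ‖f x‖ₑ) hUm]
    refine add_le_add ?_ (le_of_eq ?_)
    · rw [lintegral_iUnion hQm hQd, lintegral_iUnion hQm hQd]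
      refine ENNReal.tsum_le_tsum fun i => ?_
      refine le_trans (le_of_eq ?_) (hconst i)
      exact setLIntegral_congr_fun (hQm i) fun x hx => by simp only [hgU i x hx]
    · exact setLIntegral_congr_fun hUm.compl fun x hx => by simp only [hgUc x hx]
  have hgi : Integrable good volume := by
    refine ⟨?_, hg1.trans_lt hf.2⟩
    exact (hf.1.indicator hUm.compl).add hstm.aestronglyMeasurable
  have hg2 : ∀ᵐ x, ‖good x‖ₑ ≤ ENNReal.ofReal (2 ^ n * α) := by
    filter_upwards [hae] with x hx
    rw [Real.enorm_eq_ofReal_abs]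
    refine ENNReal.ofReal_le_ofReal ?_
    by_cases hxU : x ∈ U
    · obtain ⟨i, hi⟩ := mem_iUnion.1 hxU
      rw [hgU i x hi]; exact ha_le i
    · rw [hgUc x hxU]
      have h2 : α ≤ 2 ^ n * α := le_mul_of_one_le_left hα0.le (one_le_pow₀ (by norm_num))
      by_cases hxc : x ∈ cube c h
      · rcases hx hxc with ⟨i, hi, hxi⟩ | h1
        · exact absurd (mem_iUnion.2 ⟨⟨i, hi⟩, hxi⟩) hxU
        · exact h1.trans h2
      · rw [hsupp x hxc]; simp; positivity
  refine ⟨I, inferInstance, good, b, fun i => cc i, fun i => r i, fun i => hr i, hgi, ?_, hbint,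
    fun i z hz => Set.indicator_of_notMem hz _, ?_, hbs, ?_, ?_⟩
  · calc ∫⁻ x, ‖good x‖ₑ ^ 2 ≤ ∫⁻ x, ENNReal.ofReal (2 ^ n * α) * ‖good x‖ₑ := by
          refine lintegral_mono_ae ?_
          filter_upwards [hg2] with x hx
          rw [sq]; gcongr
      _ = ENNReal.ofReal (2 ^ n * α) * ∫⁻ x, ‖good x‖ₑ := lintegral_const_mul' _ _ ENNReal.ofReal_ne_top
      _ ≤ _ := by gcongr
  · intro i
    have := hvf i
    simp only [hb]
    rw [integral_indicator (hQm i), integral_sub hf.integrableOn (integrable_const _),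
      setIntegral_cube_eq_avg f _ (hr i), setIntegral_const, measureReal_def,
      volume_cube_toReal _ (hr i).le, smul_eq_mul, sub_self]
  · refine (ENNReal.tsum_le_tsum fun i => ?_).trans hsumle
    rw [← hfQ]
    exact ENNReal.ofReal_le_ofReal (hlow i i.2).le
  · intro k M hk hM
    have hkb : ∀ i, Integrable (fun x => k x * b i x) volume := fun i =>
      (hbint i).bdd_mul hk.aestronglyMeasurable (Filter.Eventually.of_forall hM)
    have hM0 : 0 ≤ M := (abs_nonneg _).trans (hM 0)
    have hbsum : Summable (fun i => ∫ z, |b i z|) := by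
      have h1 : ∑' i, ENNReal.ofReal (∫ z, |b i z|) ≠ ⊤ :=
        (hbs.trans_lt (ENNReal.mul_lt_top (by simp) hf.2)).ne
      have h2 := ENNReal.summable_toReal h1
      refine h2.congr fun i => ?_
      rw [ENNReal.toReal_ofReal (integral_nonneg fun z => abs_nonneg _)]
    have hsm : Summable (fun i => ∫ x, ‖k x * b i x‖) := by
      refine Summable.of_nonneg_of_le (fun i => integral_nonneg fun z => norm_nonneg _) (fun i => ?_)
        (hbsum.mul_left M)
      rw [← integral_const_mul]
      refine integral_mono (hkb i).norm ((hbint i).abs.const_mul M) fun x => ?_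
      simp only [norm_mul, Real.norm_eq_abs]
      exact mul_le_mul_of_nonneg_right (hM x) (abs_nonneg _)
    have hS := hasSum_integral_of_summable_integral_norm hkb hsm
    have hkg : Integrable (fun x => k x * good x) volume :=
      hgi.bdd_mul hk.aestronglyMeasurable (Filter.Eventually.of_forall hM)
    have hkf : Integrable (fun x => k x * f x) volume :=
      hf.bdd_mul hk.aestronglyMeasurable (Filter.Eventually.of_forall hM)
    have heq : ∀ x, ∑' i, k x * b i x = k x * f x - k x * good x := by
      intro x
      rw [tsum_mul_left, hdec x]; ring
    have h3 : ∫ x, k x * f x = (∫ x, k x * good x) + ∑' i, ∫ x, k x * b i x := by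
      rw [hS.tsum_eq]
      simp_rw [heq]
      rw [integral_sub hkf hkg]; ring
    rw [h3]
    refine (enorm_add_le _ _).trans ?_
    gcongr
    exact enorm_tsum_le_tsum_enorm

lemma weak_type (hn : 1 ≤ n) {C₁ C₂ δ γ : ℝ} (hC₁ : 0 < C₁) (hC₂ : 0 < C₂) (hδ : 0 < δ) (hγ : 0 < γ)
    {ψ : Rn n → ℝ} (hψ : PsiKernel n C₁ C₂ δ γ ψ) {lam : ℝ} (hlam : 2 < lam)
    (hlamn : (lam - 3) * (n : ℝ) > 2 * δ + 2 * γ) {η : ℝ} (hη : 0 < η) :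
    ∃ K : ℝ, 0 < K ∧ ∀ (c : Rn n) (h : ℝ) (f : Rn n → ℝ) (A : ℝ), 0 < h → 0 < A →
      Integrable f volume → (∀ x ∉ cube c h, f x = 0) → ∫ x, |f x| ≤ A * (2 * h) ^ n →
      volume {x | ENNReal.ofReal (K * A) < Gstar ψ lam f x} ≤ ENNReal.ofReal (η * (2 * h) ^ n) := by
  obtain ⟨B, hB, hL2⟩ := Gstar_L2 hn hC₁ hC₂ hδ hγ hψ hlam
  obtain ⟨Ca, hCa, hat⟩ := atom_est' hn hC₁ hC₂ hδ hγ hψ hlamn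
  have hψm : Measurable ψ := psi_measurable hγ hψ
  set d : ℝ := (4 * √n) ^ n with hd
  have hd0 : 0 ≤ d := by positivity
  set L : ℝ := 1 + 3 * d / η with hL
  have hL1 : 1 ≤ L := by have : 0 ≤ 3 * d / η := by positivity
                         linarith
  have hL0 : 0 < L := by linarith
  set K : ℝ := 1 + 12 * (B * 2 ^ n * L) / η + 12 * Ca / η with hK
  have hKa : 12 * (B * 2 ^ n * L) / η ≤ K := by
    have : 0 ≤ 12 * Ca / η := by positivity
    linarith
  have hKb : 12 * Ca / η ≤ K := by
    have : 0 ≤ 12 * (B * 2 ^ n * L) / η := by positivity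
    linarith
  have hK1 : 1 ≤ K := by
    have : 0 ≤ 12 * (B * 2 ^ n * L) / η := by positivity
    have : 0 ≤ 12 * Ca / η := by positivity
    linarith
  have hK0 : 0 < K := by linarith
  refine ⟨K, hK0, fun c h f A hh hA hf hsupp hfA => ?_⟩
  set D : ℝ := (2 * h) ^ n with hD
  have hD0 : 0 < D := by positivity
  have hF : ∫⁻ x, ‖f x‖ₑ ≤ ENNReal.ofReal (A * D) := by
    rw [← ofReal_integral_norm_eq_lintegral_enorm hf]
    exact ENNReal.ofReal_le_ofReal hfA
  have havg : avg (fun x => |f x|) (cube c h) ≤ L * A := by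
    have h1 : D * avg (fun x => |f x|) (cube c h) ≤ A * D := by
      rw [← setIntegral_cube_eq_avg _ c hh]
      exact (setIntegral_le_integral hf.abs (Filter.Eventually.of_forall fun x => abs_nonneg _)).trans hfA
    have h2 : avg (fun x => |f x|) (cube c h) ≤ A := le_of_mul_le_mul_left (by linarith) hD0
    nlinarith
  obtain ⟨ι, hι, good, b, cc, r, hr, hgi, hg2, hbi, hbsupp, hbm, hbs, hrs, hk⟩ :=
    cz_decomp hn c hh hf hsupp (mul_pos hL0 hA) havg
  set E : Set (Rn n) := ⋃ i, cube (cc i) (4 * (√n * r i)) with hE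
  have hEm : MeasurableSet E := MeasurableSet.iUnion fun i => measurableSet_cube _ _
  have hG : ∀ x, Gstar ψ lam f x ≤ Gstar ψ lam good x + ∑' i, Gstar ψ lam (b i) x := by
    refine Gstar_le_sum hψm lam hgi.1 (fun i => (hbi i).1) fun t ht y => ?_
    refine hk (fun z => (t ^ n)⁻¹ * ψ (t⁻¹ • (y - z))) ((t ^ n)⁻¹ * C₁)
      (measurable_const.mul (hψm.comp (by fun_prop))) fun z => ?_
    exact cvl_kernel_abs_le hC₁ hδ hψ ht _
  have hKA : 0 < K * A / 2 := by positivity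
  set S1 : Set (Rn n) := {x | ENNReal.ofReal ((K * A / 2) ^ 2) ≤ Gstar ψ lam good x ^ 2} with hS1
  set S2 : Set (Rn n) := {x | ENNReal.ofReal (K * A / 2) ≤ ∑' i, Gstar ψ lam (b i) x} with hS2
  have hsub : {x | ENNReal.ofReal (K * A) < Gstar ψ lam f x} ⊆ E ∪ (S1 ∪ (S2 ∩ Eᶜ)) := by
    intro x hx
    by_contra hcon
    simp only [mem_union, not_or, mem_inter_iff, not_and, mem_compl_iff, not_not] at hcon
    obtain ⟨h1, h2, h3⟩ := hcon
    have h4 : x ∉ S2 := fun h => h1 (h3 h)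
    simp only [hS1, hS2, Set.mem_ofPred_eq, not_le] at h2 h4
    rw [ENNReal.ofReal_pow hKA.le, ENNReal.pow_lt_pow_left_iff two_ne_zero] at h2
    have h5 := (hG x).trans_lt (ENNReal.add_lt_add h2 h4)
    rw [← ENNReal.ofReal_add hKA.le hKA.le, add_halves] at h5
    exact absurd hx (not_lt.2 h5.le)
  have hvE : volume E ≤ ENNReal.ofReal (η / 3 * D) := by
    calc volume E ≤ ∑' i, volume (cube (cc i) (4 * (√n * r i))) := measure_iUnion_le _
      _ = ∑' i, ENNReal.ofReal (d / (L * A)) * ENNReal.ofReal (L * A * (2 * r i) ^ n) := by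
          refine tsum_congr fun i => ?_
          rw [volume_cube _ (by have := hr i; positivity), ← ENNReal.ofReal_mul (by positivity)]
          congr 1
          rw [hd]
          field_simp
          rw [← mul_pow]
          ring
      _ ≤ ENNReal.ofReal (d / (L * A)) * ENNReal.ofReal (A * D) := by
          rw [ENNReal.tsum_mul_left]
          gcongr
          exact hrs.trans hF
      _ ≤ _ := by
          rw [← ENNReal.ofReal_mul (by positivity)]
          refine ENNReal.ofReal_le_ofReal ?_
          have e : d / (L * A) * (A * D) = d / L * D := by field_simp
          rw [e]
          refine mul_le_mul_of_nonneg_right ?_ hD0.le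
          rw [div_le_iff₀ hL0]
          have : η / 3 * L = η / 3 + d := by rw [hL]; field_simp
          rw [this]; linarith
  have hv1 : volume S1 ≤ ENNReal.ofReal (η / 3 * D) := by
    have hm : Measurable fun x => Gstar ψ lam good x ^ 2 := (Gstar_measurable hψm lam hgi.1).pow_const 2
    have hne : ENNReal.ofReal ((K * A / 2) ^ 2) ≠ 0 := by
      simp only [ne_eq, ENNReal.ofReal_eq_zero, not_le]; positivity
    refine (meas_ge_le_lintegral_div hm.aemeasurable hne ENNReal.ofReal_ne_top).trans ?_
    rw [ENNReal.div_le_iff hne ENNReal.ofReal_ne_top]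
    refine (hL2 good hgi).trans ?_
    calc ENNReal.ofReal B * ∫⁻ x, ‖good x‖ₑ ^ 2
        ≤ ENNReal.ofReal B * (ENNReal.ofReal (2 ^ n * (L * A)) * ENNReal.ofReal (A * D)) := by
          gcongr
          refine hg2.trans ?_
          gcongr
      _ ≤ _ := by
          rw [← ENNReal.ofReal_mul (by positivity), ← ENNReal.ofReal_mul (by positivity),
            ← ENNReal.ofReal_mul (by positivity)]
          refine ENNReal.ofReal_le_ofReal ?_
          rw [div_le_iff₀ hη] at hKa
          have : K ≤ K ^ 2 := by nlinarith
          calc B * (2 ^ n * (L * A) * (A * D)) = (12 * (B * 2 ^ n * L)) * (A ^ 2 * D / 12) := by ring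
            _ ≤ (K ^ 2 * η) * (A ^ 2 * D / 12) := 
                mul_le_mul_of_nonneg_right (hKa.trans (by gcongr)) (by positivity)
            _ = _ := by ring
  have hv2 : volume (S2 ∩ Eᶜ) ≤ ENNReal.ofReal (η / 3 * D) := by
    have hm : Measurable fun x => ∑' i, Gstar ψ lam (b i) x :=
      Measurable.tsum fun i => Gstar_measurable hψm lam (hbi i).1
    have hne : ENNReal.ofReal (K * A / 2) ≠ 0 := by
      simp only [ne_eq, ENNReal.ofReal_eq_zero, not_le]; positivity
    rw [← Measure.restrict_apply' hEm.compl]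
    refine (meas_ge_le_lintegral_div hm.aemeasurable hne ENNReal.ofReal_ne_top).trans ?_
    rw [ENNReal.div_le_iff hne ENNReal.ofReal_ne_top,
      lintegral_tsum fun i => (Gstar_measurable hψm lam (hbi i).1).aemeasurable]
    calc ∑' i, ∫⁻ x in Eᶜ, Gstar ψ lam (b i) x
        ≤ ∑' i, ENNReal.ofReal Ca * ENNReal.ofReal (∫ z, |b i z|) := by
          refine ENNReal.tsum_le_tsum fun i => ?_
          rw [← ENNReal.ofReal_mul hCa.le]
          refine le_trans (lintegral_mono_set ?_) (hat (cc i) (r i) (b i) (hr i) (hbi i) (hbsupp i) (hbm i))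
          exact compl_subset_compl.2 (subset_iUnion (fun i => cube (cc i) (4 * (√n * r i))) i)
      _ ≤ ENNReal.ofReal Ca * (ENNReal.ofReal 2 * ENNReal.ofReal (A * D)) := by
          rw [ENNReal.tsum_mul_left]
          gcongr
          refine hbs.trans ?_
          rw [ENNReal.ofReal_ofNat]
          gcongr
      _ ≤ _ := by
          rw [← ENNReal.ofReal_mul (by positivity), ← ENNReal.ofReal_mul (by positivity),
            ← ENNReal.ofReal_mul (by positivity)]
          refine ENNReal.ofReal_le_ofReal ?_
          rw [div_le_iff₀ hη] at hKb
          calc Ca * (2 * (A * D)) = (12 * Ca) * (A * D / 6) := by ring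
            _ ≤ (K * η) * (A * D / 6) := by gcongr
            _ = _ := by ring
  calc volume {x | ENNReal.ofReal (K * A) < Gstar ψ lam f x} ≤ volume (E ∪ (S1 ∪ (S2 ∩ Eᶜ))) :=
        measure_mono hsub
    _ ≤ volume E + (volume S1 + volume (S2 ∩ Eᶜ)) :=
        (measure_union_le _ _).trans (add_le_add le_rfl (measure_union_le _ _))
    _ ≤ ENNReal.ofReal (η / 3 * D) + (ENNReal.ofReal (η / 3 * D) + ENNReal.ofReal (η / 3 * D)) := by
        gcongr
    _ = _ := by
        rw [← ENNReal.ofReal_add (by positivity) (by positivity),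
          ← ENNReal.ofReal_add (by positivity) (by positivity)]
        congr 1; ring

/-- `A₁` in the pointwise form used below. -/
def A1pt (ω : Rn n → ℝ) (Cw : ℝ) : Prop :=
  ∀ (c : Rn n) (h : ℝ), 0 < h → ∀ᵐ x ∂(volume : Measure (Rn n)), x ∈ cube c h → avg ω (cube c h) ≤ Cw * ω x

/-- weighted BMO bound in `L¹` form. -/
def BMO1 (ω f : Rn n → ℝ) (N : ℝ) : Prop :=
  ∀ (c : Rn n) (h : ℝ), 0 < h → ∫ x in cube c h, |f x - avg f (cube c h)| ≤ N * ∫ x in cube c h, ω x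

lemma avg_mono {ω : Rn n → ℝ} {Cw : ℝ} (hω : LocallyIntegrable ω volume) (hA : A1pt ω Cw)
    {c c' : Rn n} {h h' : ℝ} (hh : 0 < h) (hh' : 0 < h') (hsub : cube c h ⊆ cube c' h') :
    avg ω (cube c' h') ≤ Cw * avg ω (cube c h) := by
  have hp : (0:ℝ) < (2 * h) ^ n := by positivity
  refine le_of_mul_le_mul_left ?_ hp
  have h1 : ∫ _ in cube c h, avg ω (cube c' h') = (2 * h) ^ n * avg ω (cube c' h') := by
    rw [setIntegral_const, measureReal_def, volume_cube_toReal _ hh.le, smul_eq_mul]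
  have h2 : (2 * h) ^ n * (Cw * avg ω (cube c h)) = ∫ x in cube c h, Cw * ω x := by
    rw [integral_const_mul, setIntegral_cube_eq_avg ω c hh]; ring
  rw [← h1, h2]
  refine setIntegral_mono_on_ae ?_ ((integrableOn_cube hω c hh.le).const_mul _) (measurableSet_cube _ _) ?_
  · exact integrableOn_const (volume_cube_ne_top _ hh)
  · filter_upwards [hA c' h' hh'] with x hx hxc
    exact hx (hsub hxc)

lemma avg_nonneg {ω : Rn n → ℝ} (h0 : ∀ x, 0 ≤ ω x) (E : Set (Rn n)) : 0 ≤ avg ω E :=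
  mul_nonneg (inv_nonneg.2 ENNReal.toReal_nonneg) (integral_nonneg h0)

lemma osc_cube {ω f : Rn n → ℝ} {N Cw : ℝ} (hω : LocallyIntegrable ω volume) (hA : A1pt ω Cw)
    (hf : LocallyIntegrable f volume) (hN : 0 ≤ N) (hB : BMO1 ω f N) (c : Rn n) {h : ℝ} (hh : 0 < h) (k : ℕ) :
    ∫ x in cube c (2 ^ k * h), |f x - avg f (cube c h)| ≤
      (k + 1) * 2 ^ n * (N * Cw * avg ω (cube c h)) * (2 * (2 ^ k * h)) ^ n := by
  set Q : ℕ → Set (Rn n) := fun k => cube c (2 ^ k * h) with hQ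
  have hr : ∀ k : ℕ, 0 < 2 ^ k * h := fun k => by positivity
  have hQsub : ∀ j k, j ≤ k → Q j ⊆ Q k := by
    intro j k hjk x hx i
    refine (hx i).trans_le ?_
    gcongr
    norm_num
  set a : ℕ → ℝ := fun k => avg f (Q k) with ha
  set w := avg ω (cube c h) with hw
  set M := N * Cw * w with hM
  have hQ0 : Q 0 = cube c h := by simp [hQ]
  have hwk : ∀ k, avg ω (Q k) ≤ Cw * w := fun k => by
    refine avg_mono hω hA hh (hr k) ?_
    rw [← hQ0]; exact hQsub 0 k (Nat.zero_le k)
  have hvk : ∀ k, (0:ℝ) < (2 * (2 ^ k * h)) ^ n := fun k => by positivity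
  have hosc : ∀ k, ∫ x in Q k, |f x - a k| ≤ M * (2 * (2 ^ k * h)) ^ n := fun k => by
    refine (hB c _ (hr k)).trans ?_
    rw [setIntegral_cube_eq_avg ω c (hr k), hM, mul_assoc N]
    calc N * ((2 * (2 ^ k * h)) ^ n * avg ω (cube c (2 ^ k * h)))
        ≤ N * ((2 * (2 ^ k * h)) ^ n * (Cw * w)) := by
          have := hwk k
          gcongr
      _ = _ := by ring
  have hM0 : 0 ≤ M := by
    have h1 := hosc 0
    have h2 : (0:ℝ) ≤ ∫ x in Q 0, |f x - a 0| := integral_nonneg fun x => abs_nonneg _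
    exact nonneg_of_mul_nonneg_left (h2.trans h1) (hvk 0)
  have hIntg : ∀ k (e : ℝ), IntegrableOn (fun x => f x - e) (Q k) volume := fun k e =>
    (integrableOn_cube hf c (hr k).le).sub (integrableOn_const (volume_cube_ne_top _ (hr k)))
  have hstep : ∀ k, |a k - a (k + 1)| ≤ 2 ^ n * M := by
    intro k
    have h1 : (2 * (2 ^ k * h)) ^ n * (a k - a (k + 1)) = ∫ x in Q k, (f x - a (k + 1)) := by
      rw [integral_sub (integrableOn_cube hf c (hr k).le) (integrableOn_const (volume_cube_ne_top _ (hr k))),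
        setIntegral_cube_eq_avg f c (hr k), setIntegral_const, measureReal_def,
        volume_cube_toReal _ (hr k).le, smul_eq_mul]
      ring
    refine le_of_mul_le_mul_left ?_ (hvk k)
    calc (2 * (2 ^ k * h)) ^ n * |a k - a (k + 1)| = |∫ x in Q k, (f x - a (k + 1))| := by
          rw [← h1, abs_mul, abs_of_pos (hvk k)]
      _ ≤ ∫ x in Q k, |f x - a (k + 1)| := abs_integral_le_integral_abs
      _ ≤ ∫ x in Q (k + 1), |f x - a (k + 1)| :=
          setIntegral_mono_set (hIntg _ _).abs (Filter.Eventually.of_forall fun x => abs_nonneg _)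
            (hQsub k (k + 1) (Nat.le_succ k)).eventuallyLE
      _ ≤ M * (2 * (2 ^ (k + 1) * h)) ^ n := hosc (k + 1)
      _ = _ := by rw [pow_succ]; simp only [mul_pow]; ring
  have htel : ∀ k : ℕ, |a k - a 0| ≤ k * (2 ^ n * M) := by
    intro k
    induction k with
    | zero => simp
    | succ k ih =>
      have := hstep k
      rw [abs_sub_comm] at this
      calc |a (k + 1) - a 0| = |(a (k + 1) - a k) + (a k - a 0)| := by congr 1; ring
        _ ≤ |a (k + 1) - a k| + |a k - a 0| := abs_add_le _ _
        _ ≤ 2 ^ n * M + k * (2 ^ n * M) := add_le_add this ih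
        _ = _ := by push_cast; ring
  have ha0 : avg f (cube c h) = a 0 := by simp only [ha]; rw [hQ0]
  rw [ha0]
  calc ∫ x in Q k, |f x - a 0| ≤ ∫ x in Q k, (|f x - a k| + |a k - a 0|) := by
        refine integral_mono (hIntg _ _).abs ((hIntg _ _).abs.add (integrableOn_const (volume_cube_ne_top _ (hr k)))) fun x => ?_
        calc |f x - a 0| = |(f x - a k) + (a k - a 0)| := by congr 1; ring
          _ ≤ _ := abs_add_le _ _
    _ = (∫ x in Q k, |f x - a k|) + (2 * (2 ^ k * h)) ^ n * |a k - a 0| := by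
        rw [integral_add (hIntg _ _).abs (integrableOn_const (volume_cube_ne_top _ (hr k))), setIntegral_const,
          measureReal_def, volume_cube_toReal _ (hr k).le, smul_eq_mul]
    _ ≤ M * (2 * (2 ^ k * h)) ^ n + (2 * (2 ^ k * h)) ^ n * (k * (2 ^ n * M)) := by
        have := htel k
        have := hosc k
        have := hvk k
        gcongr
    _ ≤ _ := by
        have h1 : (1:ℝ) ≤ 2 ^ n := one_le_pow₀ (by norm_num)
        have h2 : M ≤ 2 ^ n * M := le_mul_of_one_le_left hM0 h1
        have h3 := mul_le_mul_of_nonneg_right h2 (hvk k).le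
        linarith

lemma weight_sum {κ : ℝ} (hκ : 0 < κ) (c : Rn n) {h : ℝ} (hh : 0 < h) (z : Rn n) :
    ENNReal.ofReal ((1 + h⁻¹ * ‖z - c‖) ^ (-κ)) ≤
      ∑' k : ℕ, (cube c (2 ^ k * h)).indicator (fun _ => ENNReal.ofReal (2 ^ κ * ((2:ℝ) ^ k) ^ (-κ))) z := by
  classical
  have hex : ∃ k : ℕ, ‖z - c‖ < 2 ^ k * h := by
    obtain ⟨k, hk⟩ := pow_unbounded_of_one_lt (‖z - c‖ / h) (by norm_num : (1:ℝ) < 2)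
    exact ⟨k, (div_lt_iff₀ hh).1 hk⟩
  set k := Nat.find hex with hk
  have hk1 : ‖z - c‖ < 2 ^ k * h := Nat.find_spec hex
  refine le_trans ?_ (ENNReal.le_tsum k)
  rw [Set.indicator_of_mem (mem_cube_of_norm hk1)]
  refine ENNReal.ofReal_le_ofReal ?_
  have hlow : (2:ℝ) ^ k / 2 ≤ 1 + h⁻¹ * ‖z - c‖ := by
    rcases Nat.eq_zero_or_pos k with h0 | h0
    · rw [h0]
      have : 0 ≤ h⁻¹ * ‖z - c‖ := by positivity
      norm_num; linarith
    · obtain ⟨j, hj⟩ := Nat.exists_eq_succ_of_ne_zero h0.ne'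
      have h2 : ¬ ‖z - c‖ < 2 ^ j * h := Nat.find_min hex (by rw [← hk, hj]; exact Nat.lt_succ_self j)
      rw [hj, pow_succ]
      rw [not_lt] at h2
      have : (2:ℝ) ^ j ≤ h⁻¹ * ‖z - c‖ := by
        rw [inv_mul_eq_div, le_div_iff₀ hh]; exact h2
      linarith
  calc (1 + h⁻¹ * ‖z - c‖) ^ (-κ) ≤ ((2:ℝ) ^ k / 2) ^ (-κ) :=
        Real.rpow_le_rpow_of_nonpos (by positivity) hlow (by linarith)
    _ = _ := by
        rw [Real.div_rpow (by positivity) (by norm_num), Real.rpow_neg (by norm_num : (0:ℝ) ≤ 2)]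
        field_simp

lemma tail_est {κ : ℝ} (hκ : (n:ℝ) < κ) {ω : Rn n → ℝ} {Cw : ℝ} (hCw : 0 < Cw) (hω0 : ∀ x, 0 ≤ ω x)
    (hω : LocallyIntegrable ω volume) (hA : A1pt ω Cw) :
    ∃ C : ℝ, 0 < C ∧ ∀ (f : Rn n → ℝ) (N : ℝ), LocallyIntegrable f volume → 0 ≤ N → BMO1 ω f N →
      ∀ (c : Rn n) (h : ℝ), 0 < h →
        ∫⁻ z, ENNReal.ofReal ((1 + h⁻¹ * ‖z - c‖) ^ (-κ)) * ‖f z - avg f (cube c h)‖ₑ ≤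
          ENNReal.ofReal (C * (N * avg ω (cube c h)) * h ^ n) := by
  have hκ0 : 0 < κ := lt_of_le_of_lt (Nat.cast_nonneg n) hκ
  set q : ℝ := 2 ^ (n - κ) with hq
  have hq0 : 0 < q := by positivity
  have hq1 : q < 1 := Real.rpow_lt_one_of_one_lt_of_neg (by norm_num) (by linarith)
  have hs : Summable (fun k : ℕ => ((k:ℝ) + 1) * q ^ k) := by
    have h1 : Summable (fun k : ℕ => ((k:ℝ) ^ 1) * q ^ k) :=
      summable_pow_mul_geometric_of_norm_lt_one 1 (by rw [Real.norm_of_nonneg hq0.le]; exact hq1)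
    have h2 : Summable (fun k : ℕ => q ^ k) := summable_geometric_of_lt_one hq0.le hq1
    refine (h1.add h2).congr fun k => ?_
    ring
  set S := ∑' k : ℕ, ((k:ℝ) + 1) * q ^ k with hS
  have hS0 : 0 ≤ S := tsum_nonneg fun k => by positivity
  refine ⟨2 ^ κ * 2 ^ n * 2 ^ n * Cw * S + 1, by positivity, fun f N hf hN hB c h hh => ?_⟩
  set w := avg ω (cube c h) with hw
  have hw0 : 0 ≤ w := avg_nonneg hω0 _
  set a := avg f (cube c h) with ha
  calc ∫⁻ z, ENNReal.ofReal ((1 + h⁻¹ * ‖z - c‖) ^ (-κ)) * ‖f z - a‖ₑ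
      ≤ ∫⁻ z, ∑' k : ℕ, (cube c (2 ^ k * h)).indicator
          (fun z => ENNReal.ofReal (2 ^ κ * ((2:ℝ) ^ k) ^ (-κ)) * ‖f z - a‖ₑ) z := by
        refine lintegral_mono fun z => ?_
        refine (mul_le_mul_left (weight_sum hκ0 c hh z) _).trans_eq ?_
        rw [← ENNReal.tsum_mul_right]
        refine tsum_congr fun k => ?_
        by_cases hz : z ∈ cube c (2 ^ k * h)
        · simp only [Set.indicator_of_mem hz]
        · simp only [Set.indicator_of_notMem hz, zero_mul]
    _ = ∑' k : ℕ, ENNReal.ofReal (2 ^ κ * ((2:ℝ) ^ k) ^ (-κ)) * ENNReal.ofReal (∫ z in cube c (2 ^ k * h), |f z - a|) := by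
        have hm : AEMeasurable (fun z => ‖f z - a‖ₑ) volume :=
          (hf.aestronglyMeasurable.aemeasurable.sub_const a).enorm
        rw [lintegral_tsum fun k => (hm.const_mul _).indicator (measurableSet_cube _ _)]
        refine tsum_congr fun k => ?_
        rw [lintegral_indicator (measurableSet_cube _ _), lintegral_const_mul' _ _ ENNReal.ofReal_ne_top]
        congr 1
        refine (ofReal_integral_norm_eq_lintegral_enorm (f := fun z => f z - a) ?_).symm
        exact (integrableOn_cube hf c (by positivity)).sub (integrableOn_const (volume_cube_ne_top _ (by positivity)))
    _ ≤ ∑' k : ℕ, ENNReal.ofReal ((2 ^ κ * 2 ^ n * 2 ^ n * Cw * (N * w) * h ^ n) * ((k + 1) * q ^ k)) := by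
        refine ENNReal.tsum_le_tsum fun k => ?_
        rw [← ENNReal.ofReal_mul (by positivity)]
        refine ENNReal.ofReal_le_ofReal ?_
        refine (mul_le_mul_of_nonneg_left (osc_cube hω hA hf hN hB c hh k) (by positivity)).trans_eq ?_
        have e : q ^ k = ((2:ℝ) ^ k) ^ (-κ) * (2 ^ k) ^ n := by
          rw [hq, ← Real.rpow_natCast ((2:ℝ) ^ k) n, ← Real.rpow_add (by positivity), ← Real.rpow_natCast,
            ← Real.rpow_natCast 2 k, ← Real.rpow_mul (by norm_num), ← Real.rpow_mul (by norm_num)]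
          congr 1; ring
        rw [e]
        simp only [mul_pow]
        ring
    _ = ENNReal.ofReal ((2 ^ κ * 2 ^ n * 2 ^ n * Cw * (N * w) * h ^ n) * S) := by
        rw [hS, ← tsum_mul_left, ENNReal.ofReal_tsum_of_nonneg (fun k => by positivity) (hs.mul_left _)]
    _ ≤ _ := by
        refine ENNReal.ofReal_le_ofReal ?_
        have : 0 ≤ (N * w) * h ^ n := by positivity
        nlinarith

lemma kernel_integrable {C₁ C₂ δ γ : ℝ} {ψ : Rn n → ℝ} (hψ : PsiKernel n C₁ C₂ δ γ ψ) {t : ℝ} (ht : 0 < t)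
    (y : Rn n) : Integrable (fun z => (t ^ n)⁻¹ * ψ (t⁻¹ • (y - z))) volume := by
  have h1 : Integrable (fun x => ψ (t⁻¹ • x)) volume := hψ.1.comp_smul (inv_ne_zero ht.ne')
  exact (h1.comp_sub_left y).const_mul _

lemma kernel_integral {C₁ C₂ δ γ : ℝ} {ψ : Rn n → ℝ} (hψ : PsiKernel n C₁ C₂ δ γ ψ) (t : ℝ)
    (y : Rn n) : ∫ z, (t ^ n)⁻¹ * ψ (t⁻¹ • (y - z)) = 0 := by
  rw [integral_const_mul, integral_sub_left_eq_self (fun x => ψ (t⁻¹ • x)) volume y,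
    Measure.integral_comp_smul, hψ.2.1]
  simp

lemma kernel_bound {C₁ C₂ δ γ : ℝ} {ψ : Rn n → ℝ} (hψ : PsiKernel n C₁ C₂ δ γ ψ) {t : ℝ} (ht : 0 < t)
    (y z : Rn n) : |(t ^ n)⁻¹ * ψ (t⁻¹ • (y - z))| ≤
      (t ^ n)⁻¹ * C₁ * (1 + t⁻¹ * ‖z - y‖) ^ (-((n:ℝ) + δ)) := by
  have h := hψ.2.2.1 (t⁻¹ • (y - z))
  rw [norm_smul, norm_inv, Real.norm_of_nonneg ht.le, norm_sub_rev] at h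
  rw [abs_mul, abs_of_pos (by positivity : 0 < (t ^ n)⁻¹), mul_assoc]
  exact mul_le_mul_of_nonneg_left h (by positivity)

lemma far_cvl {C₁ C₂ δ γ : ℝ} (hC₁ : 0 < C₁) (hδ : 0 < δ) (hγ : 0 < γ)
    {ψ : Rn n → ℝ} (hψ : PsiKernel n C₁ C₂ δ γ ψ) {ω : Rn n → ℝ} {Cw : ℝ} (hCw : 0 < Cw) (hω0 : ∀ x, 0 ≤ ω x)
    (hω : LocallyIntegrable ω volume) (hA : A1pt ω Cw) :
    ∃ C : ℝ, 0 < C ∧ ∀ (f : Rn n → ℝ) (N : ℝ), LocallyIntegrable f volume → 0 ≤ N → BMO1 ω f N →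
      ∀ (c y : Rn n) (t : ℝ), 0 < t →
        (∀ a, Integrable (fun z => (t ^ n)⁻¹ * ψ (t⁻¹ • (y - z)) * (f z - a)) volume) ∧
        (∀ a, cvl ψ t f y = ∫ z, (t ^ n)⁻¹ * ψ (t⁻¹ • (y - z)) * (f z - a)) ∧
        |cvl ψ t f y| ≤ C * ((t + ‖y - c‖) / t) ^ n * (N * avg ω (cube c (t + ‖y - c‖))) := by
  obtain ⟨C, hC, h⟩ := tail_est (κ := n + δ) (by linarith) hCw hω0 hω hA
  have hψm := psi_measurable hγ hψ
  refine ⟨C₁ * 2 ^ ((n:ℝ) + δ) * C, by positivity, fun f N hf hN hB c y t ht => ?_⟩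
  set ρ := t + ‖y - c‖ with hρ
  have hρ0 : 0 < ρ := by positivity
  set k : Rn n → ℝ := fun z => (t ^ n)⁻¹ * ψ (t⁻¹ • (y - z)) with hk
  have hkm : Measurable k := measurable_const.mul (hψm.comp (by fun_prop))
  have hki : Integrable k volume := kernel_integrable hψ ht y
  have hk0 : ∫ z, k z = 0 := kernel_integral hψ t y
  set a₀ := avg f (cube c ρ) with ha₀
  set w := avg ω (cube c ρ) with hw
  have hw0 : 0 ≤ w := avg_nonneg hω0 _
  have hb : ∫⁻ z, ‖k z * (f z - a₀)‖ₑ ≤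
      ENNReal.ofReal (C₁ * 2 ^ ((n:ℝ) + δ) * C * (ρ / t) ^ n * (N * w)) := by
    calc ∫⁻ z, ‖k z * (f z - a₀)‖ₑ
        ≤ ∫⁻ z, ENNReal.ofReal ((t ^ n)⁻¹ * C₁ * 2 ^ ((n:ℝ) + δ)) *
            (ENNReal.ofReal ((1 + ρ⁻¹ * ‖z - c‖) ^ (-((n:ℝ) + δ))) * ‖f z - a₀‖ₑ) := by
          refine lintegral_mono fun z => ?_
          rw [enorm_mul, ← mul_assoc, ← ENNReal.ofReal_mul (by positivity)]
          gcongr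
          rw [Real.enorm_eq_ofReal_abs]
          refine ENNReal.ofReal_le_ofReal ((kernel_bound hψ ht y z).trans ?_)
          rw [mul_assoc _ ((2:ℝ) ^ _)]
          refine mul_le_mul_of_nonneg_left ?_ (by positivity)
          have h1 : (1 + ρ⁻¹ * ‖z - c‖) / 2 ≤ 1 + t⁻¹ * ‖z - y‖ := by
            have h2 : ‖z - c‖ ≤ ‖z - y‖ + ‖y - c‖ := norm_sub_le_norm_sub_add_norm_sub _ _ _
            have h3 : ρ⁻¹ * ‖z - c‖ ≤ ρ⁻¹ * ‖z - y‖ + ρ⁻¹ * ρ := by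
              rw [← mul_add]
              refine mul_le_mul_of_nonneg_left ?_ (by positivity)
              linarith
            rw [inv_mul_cancel₀ hρ0.ne'] at h3
            have h4 : ρ⁻¹ ≤ t⁻¹ := inv_anti₀ ht (by rw [hρ]; linarith [norm_nonneg (y - c)])
            have h5 : ρ⁻¹ * ‖z - y‖ ≤ t⁻¹ * ‖z - y‖ := mul_le_mul_of_nonneg_right h4 (norm_nonneg _)
            have h6 : 0 ≤ t⁻¹ * ‖z - y‖ := by positivity
            linarith
          calc (1 + t⁻¹ * ‖z - y‖) ^ (-((n:ℝ) + δ)) ≤ ((1 + ρ⁻¹ * ‖z - c‖) / 2) ^ (-((n:ℝ) + δ)) :=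
                Real.rpow_le_rpow_of_nonpos (by positivity) h1 (by linarith [(Nat.cast_nonneg n : (0:ℝ) ≤ n)])
            _ = _ := by
                rw [Real.div_rpow (by positivity) (by norm_num), Real.rpow_neg (by norm_num : (0:ℝ) ≤ 2)]
                field_simp
      _ ≤ ENNReal.ofReal ((t ^ n)⁻¹ * C₁ * 2 ^ ((n:ℝ) + δ)) * ENNReal.ofReal (C * (N * w) * ρ ^ n) := by
          rw [lintegral_const_mul' _ _ ENNReal.ofReal_ne_top]
          gcongr
          exact h f N hf hN hB c ρ hρ0
      _ = _ := by
          rw [← ENNReal.ofReal_mul (by positivity)]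
          congr 1
          rw [div_pow]
          field_simp
  have hi0 : Integrable (fun z => k z * (f z - a₀)) volume := by
    refine ⟨hkm.aestronglyMeasurable.mul (hf.aestronglyMeasurable.sub aestronglyMeasurable_const), ?_⟩
    exact hb.trans_lt ENNReal.ofReal_lt_top
  have hi : ∀ a, Integrable (fun z => k z * (f z - a)) volume := fun a => by
    have h1 : (fun z => k z * (f z - a)) = fun z => k z * (f z - a₀) + k z * (a₀ - a) := by
      funext z; ring
    rw [h1]
    exact hi0.add (hki.mul_const _)
  have hc : ∀ a, cvl ψ t f y = ∫ z, k z * (f z - a) := fun a => by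
    have h1 : ∀ z, k z * f z = k z * (f z - a) + k z * a := fun z => by ring
    unfold cvl
    change ∫ z, k z * f z = _
    simp_rw [h1]
    rw [integral_add (hi a) (hki.mul_const _), integral_mul_const, hk0]
    ring
  refine ⟨hi, hc, ?_⟩
  rw [hc a₀]
  refine (abs_integral_le_integral_abs).trans ?_
  refine (ENNReal.ofReal_le_ofReal_iff (by positivity)).1 ?_
  refine le_trans (le_of_eq ?_) hb
  exact ofReal_integral_norm_eq_lintegral_enorm hi0

lemma near_cvl {C₁ C₂ δ γ : ℝ} (hC₁ : 0 < C₁) (hδ : 0 < δ)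
    {ψ : Rn n → ℝ} (hψ : PsiKernel n C₁ C₂ δ γ ψ) {ω : Rn n → ℝ} {Cw : ℝ} (hCw : 0 < Cw) (hω0 : ∀ x, 0 ≤ ω x)
    (hω : LocallyIntegrable ω volume) (hA : A1pt ω Cw) :
    ∃ C : ℝ, 0 < C ∧ ∀ (f : Rn n → ℝ) (N : ℝ), LocallyIntegrable f volume → 0 ≤ N → BMO1 ω f N →
      ∀ (c y : Rn n) (t H : ℝ), 0 < t → 0 < H → t + ‖y - c‖ < H / 2 →
        |cvl ψ t ((cube c H)ᶜ.indicator fun z => f z - avg f (cube c H)) y| ≤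
          C * (t / H) ^ δ * (N * avg ω (cube c H)) := by
  obtain ⟨C, hC, h⟩ := tail_est (κ := n + δ) (by linarith) hCw hω0 hω hA
  refine ⟨C₁ * 4 ^ ((n:ℝ) + δ) * C, by positivity, fun f N hf hN hB c y t H ht hH hy => ?_⟩
  set a₀ := avg f (cube c H) with ha₀
  set w := avg ω (cube c H) with hw
  have hw0 : 0 ≤ w := avg_nonneg hω0 _
  have hn0 : (0:ℝ) ≤ n := Nat.cast_nonneg n
  refine (ENNReal.ofReal_le_ofReal_iff (by positivity)).1 ?_
  rw [← Real.enorm_eq_ofReal_abs]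
  unfold cvl
  refine (enorm_integral_le_lintegral_enorm _).trans ?_
  calc ∫⁻ z, ‖(t ^ n)⁻¹ * ψ (t⁻¹ • (y - z)) * (cube c H)ᶜ.indicator (fun z => f z - a₀) z‖ₑ
      ≤ ∫⁻ z, ENNReal.ofReal (C₁ * 4 ^ ((n:ℝ) + δ) * (t ^ δ * H ^ (-((n:ℝ) + δ)))) *
            (ENNReal.ofReal ((1 + H⁻¹ * ‖z - c‖) ^ (-((n:ℝ) + δ))) * ‖f z - a₀‖ₑ) := by
        refine lintegral_mono fun z => ?_
        by_cases hz : z ∈ cube c H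
        · rw [Set.indicator_of_notMem (by simpa using hz)]
          simp
        rw [Set.indicator_of_mem (by simpa using hz), enorm_mul, ← mul_assoc, ← ENNReal.ofReal_mul (by positivity)]
        gcongr
        rw [Real.enorm_eq_ofReal_abs]
        refine ENNReal.ofReal_le_ofReal ((kernel_bound hψ ht y z).trans ?_)
        have hzc : H ≤ ‖z - c‖ := by
          by_contra hcon
          exact hz (mem_cube_of_norm (not_le.1 hcon))
        have h2 : ‖z - c‖ ≤ ‖z - y‖ + ‖y - c‖ := norm_sub_le_norm_sub_add_norm_sub _ _ _
        have h3 : t⁻¹ * (H * (1 + H⁻¹ * ‖z - c‖) / 4) ≤ 1 + t⁻¹ * ‖z - y‖ := by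
          have e : H * (1 + H⁻¹ * ‖z - c‖) = H + ‖z - c‖ := by field_simp
          rw [e]
          have : t⁻¹ * ((H + ‖z - c‖) / 4) ≤ t⁻¹ * ‖z - y‖ := by
            refine mul_le_mul_of_nonneg_left ?_ (by positivity)
            linarith
          linarith
        calc (t ^ n)⁻¹ * C₁ * (1 + t⁻¹ * ‖z - y‖) ^ (-((n:ℝ) + δ))
            ≤ (t ^ n)⁻¹ * C₁ * (t⁻¹ * (H * (1 + H⁻¹ * ‖z - c‖) / 4)) ^ (-((n:ℝ) + δ)) := by
              refine mul_le_mul_of_nonneg_left ?_ (by positivity)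
              exact Real.rpow_le_rpow_of_nonpos (by positivity) h3 (by linarith)
          _ = _ := by
              rw [Real.mul_rpow (by positivity) (by positivity), Real.div_rpow (by positivity) (by positivity),
                Real.mul_rpow (by positivity) (by positivity), Real.inv_rpow ht.le, Real.rpow_neg ht.le, inv_inv,
                Real.rpow_add ht, Real.rpow_natCast, Real.rpow_neg (by norm_num : (0:ℝ) ≤ 4)]
              field_simp
    _ ≤ ENNReal.ofReal (C₁ * 4 ^ ((n:ℝ) + δ) * (t ^ δ * H ^ (-((n:ℝ) + δ)))) * ENNReal.ofReal (C * (N * w) * H ^ n) := by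
        rw [lintegral_const_mul' _ _ ENNReal.ofReal_ne_top]
        gcongr
        exact h f N hf hN hB c H hH
    _ = _ := by
        rw [← ENNReal.ofReal_mul (by positivity)]
        congr 1
        rw [Real.div_rpow ht.le hH.le, Real.rpow_neg hH.le, Real.rpow_add hH, Real.rpow_natCast]
        field_simp

lemma W_diff {b t s s' τ ρ : ℝ} (hb : 1 ≤ b) (ht : 0 < t) (hs : t ≤ s) (hτ : 0 < τ) (hs' : t ≤ s') (h1 : s' ≤ s + τ)
    (h2 : ρ ≤ s + τ) (h3 : ρ ≤ 2 * s) (hρ : t ≤ ρ) :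
    (t / s) ^ b ≤ (t / s') ^ b + b * 2 ^ b * ((t / ρ) ^ b * (τ / ρ)) := by
  have hs0 : 0 < s := by linarith
  have hs0' : 0 < s' := by linarith
  have hρ0 : 0 < ρ := by linarith
  have hst : 0 < s + τ := by linarith
  have a1 : (t / (s + τ)) ^ b ≤ (t / s') ^ b := by
    refine Real.rpow_le_rpow (by positivity) ?_ (by linarith)
    exact div_le_div_of_nonneg_left ht.le hs0' h1
  have a2 : 1 + b * (-(τ / (s + τ))) ≤ (1 + -(τ / (s + τ))) ^ b := by
    refine one_add_mul_self_le_rpow_one_add ?_ hb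
    have : τ / (s + τ) ≤ 1 := (div_le_one hst).2 (by linarith)
    linarith
  have a3 : (1 + -(τ / (s + τ))) = s / (s + τ) := by field_simp; ring
  have a4 : (t / (s + τ)) ^ b = (t / s) ^ b * (s / (s + τ)) ^ b := by
    rw [← Real.mul_rpow (by positivity) (by positivity)]
    congr 1; field_simp
  rw [a3] at a2
  have hts : 0 ≤ (t / s) ^ b := by positivity
  have a5 : (t / s) ^ b * (1 + b * (-(τ / (s + τ)))) ≤ (t / (s + τ)) ^ b := by
    rw [a4]; exact mul_le_mul_of_nonneg_left a2 hts
  have a6 : (t / s) ^ b ≤ 2 ^ b * (t / ρ) ^ b := by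
    rw [← Real.mul_rpow (by norm_num) (by positivity)]
    refine Real.rpow_le_rpow (by positivity) ?_ (by linarith)
    rw [← mul_div_assoc, div_le_div_iff₀ hs0 hρ0]
    nlinarith
  have a7 : τ / (s + τ) ≤ τ / ρ := div_le_div_of_nonneg_left hτ.le hρ0 h2
  have a8 : (t / s) ^ b * (τ / (s + τ)) ≤ 2 ^ b * (t / ρ) ^ b * (τ / ρ) := by
    gcongr
  have : (t / s) ^ b * (b * (τ / (s + τ))) ≤ b * 2 ^ b * ((t / ρ) ^ b * (τ / ρ)) := by
    calc (t / s) ^ b * (b * (τ / (s + τ))) = b * ((t / s) ^ b * (τ / (s + τ))) := by ring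
      _ ≤ b * (2 ^ b * (t / ρ) ^ b * (τ / ρ)) := by gcongr
      _ = _ := by ring
  nlinarith

lemma far_mm {e s t τ ρ : ℝ} (hs : 0 < s) (hs1 : s ≤ 1) (ht : 0 < t) (hτ : 0 < τ) (hρ : t ≤ ρ) (hρτ : τ ≤ ρ) :
    (t / ρ) ^ e * (τ / ρ) ≤ (t / ρ) ^ (e - s) * mm s (t / τ) := by
  have hρ0 : 0 < ρ := by linarith
  have h0 : (t / ρ) ^ e = (t / ρ) ^ (e - s) * (t / ρ) ^ s := by
    rw [← Real.rpow_add (by positivity)]; congr 1; ring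
  rw [h0, mul_assoc]
  refine mul_le_mul_of_nonneg_left ?_ (by positivity)
  have hτρ : τ / ρ ≤ 1 := (div_le_one hρ0).2 hρτ
  have htρ : t / ρ ≤ 1 := (div_le_one hρ0).2 hρ
  refine le_min ?_ ?_
  · calc (t / ρ) ^ s * (τ / ρ) ≤ (t / τ) ^ s * 1 := by gcongr
      _ = _ := mul_one _
  · have h1 : (t / τ) ^ (-s) = (τ / t) ^ s := by
      rw [Real.rpow_neg (by positivity), ← Real.inv_rpow (by positivity), inv_div]
    rw [h1]
    calc (t / ρ) ^ s * (τ / ρ) ≤ 1 * (τ / ρ) ^ s := by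
          gcongr
          · exact Real.rpow_le_one (by positivity) htρ hs.le
          · calc τ / ρ = (τ / ρ) ^ (1:ℝ) := (Real.rpow_one _).symm
              _ ≤ _ := Real.rpow_le_rpow_of_exponent_ge (by positivity) hτρ hs1
      _ ≤ (τ / t) ^ s := by
          rw [one_mul]
          gcongr

lemma pt_compare (hn : 1 ≤ n) {C₁ C₂ δ γ : ℝ} (hC₁ : 0 < C₁) (hδ : 0 < δ) (hγ : 0 < γ)
    {ψ : Rn n → ℝ} (hψ : PsiKernel n C₁ C₂ δ γ ψ) {lam : ℝ} (hlam : 2 < lam)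
    {s : ℝ} (hs : 0 < s) (hs1 : s ≤ 1) {ω : Rn n → ℝ} {Cw : ℝ} (hCw : 0 < Cw) (hω0 : ∀ x, 0 ≤ ω x)
    (hω : LocallyIntegrable ω volume) (hA : A1pt ω Cw) :
    ∃ K : ℝ, 0 < K ∧ ∀ (f : Rn n → ℝ) (N : ℝ), LocallyIntegrable f volume → 0 ≤ N → BMO1 ω f N →
      ∀ (c x x' : Rn n) (h : ℝ), 0 < h → x ∈ cube c h → x' ∈ cube c h → ∀ (t : ℝ) (y : Rn n), 0 < t →
      (t / (t + dist x y)) ^ (lam * n) * (cvl ψ t f y) ^ 2 ≤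
        (t / (t + dist x' y)) ^ (lam * n) * (cvl ψ t f y) ^ 2 +
        2 * ((t / (t + dist x y)) ^ (lam * n) *
          (cvl ψ t ((cube c (4 * (√n * h))).indicator fun z => f z - avg f (cube c (4 * (√n * h)))) y) ^ 2) +
        K * (N * avg ω (cube c h)) ^ 2 * ((t / (t + dist x y)) ^ (lam * n) * mm (2 * δ) (t / (4 * (√n * h)))) +
        K * (N * avg ω (cube c h)) ^ 2 * ((t / (t + dist c y)) ^ ((lam - 2) * n - s) * mm s (t / (2 * (√n * h)))) := by
  obtain ⟨Cf, hCf, hfar⟩ := far_cvl hC₁ hδ hγ hψ hCw hω0 hω hA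
  obtain ⟨Cn, hCn, hnear⟩ := near_cvl hC₁ hδ hψ hCw hω0 hω hA
  have hn' : (1:ℝ) ≤ n := by exact_mod_cast hn
  set b := lam * n with hb
  have hb1 : 1 ≤ b := by nlinarith
  refine ⟨2 * (Cn * Cw) ^ 2 + b * 2 ^ b * (Cf * Cw) ^ 2, by positivity,
    fun f N hf hN hB c x x' h hh hx hx' t y ht => ?_⟩
  have hsq : 1 ≤ √(n:ℝ) := Real.one_le_sqrt.2 hn'
  have hsh : h ≤ √n * h := le_mul_of_one_le_left hh.le hsq
  have hxc : dist x c ≤ √n * h := by rw [dist_eq_norm]; exact cube_norm_le hh.le hx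
  have hxc' : dist x' c ≤ √n * h := by rw [dist_eq_norm]; exact cube_norm_le hh.le hx'
  set σ := √n * h with hσ
  have hσ0 : 0 < σ := by linarith
  set w := avg ω (cube c h) with hw
  have hw0 : 0 ≤ w := avg_nonneg hω0 _
  set F := cvl ψ t f y with hF
  set f2 := (cube c (4 * σ)).indicator fun z => f z - avg f (cube c (4 * σ)) with hf2
  set f3 := (cube c (4 * σ))ᶜ.indicator fun z => f z - avg f (cube c (4 * σ)) with hf3
  obtain ⟨hi, hc, hfb⟩ := hfar f N hf hN hB c y t ht
  have hsplit : F = cvl ψ t f2 y + cvl ψ t f3 y := by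
    rw [hF, hc (avg f (cube c (4 * σ)))]
    unfold cvl
    have e2 : ∀ z, (t ^ n)⁻¹ * ψ (t⁻¹ • (y - z)) * f2 z =
        (cube c (4 * σ)).indicator (fun z => (t ^ n)⁻¹ * ψ (t⁻¹ • (y - z)) * (f z - avg f (cube c (4 * σ)))) z := by
      intro z
      simp only [hf2]
      by_cases hz : z ∈ cube c (4 * σ) <;> simp [hz]
    have e3 : ∀ z, (t ^ n)⁻¹ * ψ (t⁻¹ • (y - z)) * f3 z =
        (cube c (4 * σ))ᶜ.indicator (fun z => (t ^ n)⁻¹ * ψ (t⁻¹ • (y - z)) * (f z - avg f (cube c (4 * σ)))) z := by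
      intro z
      simp only [hf3]
      by_cases hz : z ∈ cube c (4 * σ) <;> simp [hz]
    simp_rw [e2, e3]
    rw [integral_indicator (measurableSet_cube _ _), integral_indicator (measurableSet_cube _ _).compl,
      integral_add_compl (measurableSet_cube _ _) (hi _)]
  set W := (t / (t + dist x y)) ^ b with hW
  set W' := (t / (t + dist x' y)) ^ b with hW'
  have hW0 : 0 ≤ W := by positivity
  have hW0' : 0 ≤ W' := by positivity
  have hcy : dist c y = ‖y - c‖ := by rw [dist_comm, dist_eq_norm]
  rw [hcy]
  set ρ := t + ‖y - c‖ with hρ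
  have htρ : t ≤ ρ := by rw [hρ]; linarith [norm_nonneg (y - c)]
  have hm1 : 0 ≤ mm (2 * δ) (t / (4 * σ)) := mm_nonneg _ (by positivity)
  have hm2 : 0 ≤ mm s (t / (2 * σ)) := mm_nonneg _ (by positivity)
  set A := N * w with hAdef
  have hA0 : 0 ≤ A := by positivity
  rcases lt_or_ge ρ (2 * σ) with hcase | hcase
  · -- near case
    have h3 := hnear f N hf hN hB c y t (4 * σ) ht (by positivity) (by linarith)
    have hwm : avg ω (cube c (4 * σ)) ≤ Cw * w := avg_mono hω hA hh (by positivity) (cube_mono _ (by linarith))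
    have h4 : |cvl ψ t f3 y| ≤ Cn * Cw * A * (t / (4 * σ)) ^ δ := by
      refine h3.trans ?_
      calc Cn * (t / (4 * σ)) ^ δ * (N * avg ω (cube c (4 * σ)))
          ≤ Cn * (t / (4 * σ)) ^ δ * (N * (Cw * w)) := by gcongr
        _ = _ := by rw [hAdef]; ring
    have h5 : (cvl ψ t f3 y) ^ 2 ≤ (Cn * Cw) ^ 2 * A ^ 2 * mm (2 * δ) (t / (4 * σ)) := by
      rw [← sq_abs]
      have e : mm (2 * δ) (t / (4 * σ)) = ((t / (4 * σ)) ^ δ) ^ 2 := by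
        rw [mm_of_le (by positivity) (by positivity) ((div_le_one (by positivity)).2 (by linarith)),
          mul_comm 2 δ, Real.rpow_mul (by positivity)]
        norm_num
      rw [e]
      calc |cvl ψ t f3 y| ^ 2 ≤ (Cn * Cw * A * (t / (4 * σ)) ^ δ) ^ 2 := by gcongr
        _ = _ := by ring
    have h6 : F ^ 2 ≤ 2 * cvl ψ t f2 y ^ 2 + 2 * cvl ψ t f3 y ^ 2 := by
      rw [hsplit]; nlinarith [sq_nonneg (cvl ψ t f2 y - cvl ψ t f3 y)]
    have h7 : 0 ≤ W' * F ^ 2 := by positivity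
    have h8 : 0 ≤ (2 * (Cn * Cw) ^ 2 + b * 2 ^ b * (Cf * Cw) ^ 2) * A ^ 2 *
        ((t / ρ) ^ ((lam - 2) * n - s) * mm s (t / (2 * σ))) := by positivity
    have h9 : W * F ^ 2 ≤ W * (2 * cvl ψ t f2 y ^ 2 + 2 * ((Cn * Cw) ^ 2 * A ^ 2 * mm (2 * δ) (t / (4 * σ)))) := by
      refine mul_le_mul_of_nonneg_left ?_ hW0
      linarith
    have h10 : 0 ≤ b * 2 ^ b * (Cf * Cw) ^ 2 * A ^ 2 * (W * mm (2 * δ) (t / (4 * σ))) := by positivity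
    linarith
  · -- far case
    have hwm : avg ω (cube c ρ) ≤ Cw * w := avg_mono hω hA hh (by linarith) (cube_mono _ (by linarith))
    have h4 : |F| ≤ Cf * Cw * A * (ρ / t) ^ n := by
      refine hfb.trans ?_
      calc Cf * (ρ / t) ^ n * (N * avg ω (cube c ρ))
          ≤ Cf * (ρ / t) ^ n * (N * (Cw * w)) := by gcongr
        _ = _ := by rw [hAdef]; ring
    have hρ0 : 0 < ρ := by linarith
    have h5 : F ^ 2 ≤ (Cf * Cw) ^ 2 * A ^ 2 * ((ρ / t) ^ n) ^ 2 := by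
      rw [← sq_abs]
      calc |F| ^ 2 ≤ (Cf * Cw * A * (ρ / t) ^ n) ^ 2 := by gcongr
        _ = _ := by ring
    have tri1 : dist x' y ≤ dist x y + 2 * σ := by
      have := dist_triangle4 x' c x y
      rw [dist_comm c x] at this
      linarith
    have tri2 : ‖y - c‖ ≤ dist x y + σ := by
      rw [← hcy]
      have := dist_triangle c x y
      rw [dist_comm c x] at this
      linarith
    have hWd : W ≤ W' + b * 2 ^ b * ((t / ρ) ^ b * (2 * σ / ρ)) :=
      W_diff hb1 ht (by linarith [dist_nonneg (x := x) (y := y)]) (by positivity)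
        (by linarith [dist_nonneg (x := x') (y := y)]) (by linarith) (by linarith) (by linarith) htρ
    have e1 : (t / ρ) ^ b * ((ρ / t) ^ n) ^ 2 = (t / ρ) ^ ((lam - 2) * n) := by
      have : ((ρ / t) ^ n) ^ 2 = (t / ρ) ^ (-(2 * (n:ℝ))) := by
        rw [Real.rpow_neg (by positivity), ← Real.inv_rpow (by positivity), inv_div]
        exact (rpow_mul_nat (by positivity) n 2).symm
      rw [this, ← Real.rpow_add (by positivity)]
      congr 1; rw [hb]; ring
    have h6 : b * 2 ^ b * ((t / ρ) ^ b * (2 * σ / ρ)) * F ^ 2 ≤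
        b * 2 ^ b * (Cf * Cw) ^ 2 * A ^ 2 * ((t / ρ) ^ ((lam - 2) * n - s) * mm s (t / (2 * σ))) := by
      calc b * 2 ^ b * ((t / ρ) ^ b * (2 * σ / ρ)) * F ^ 2
          ≤ b * 2 ^ b * ((t / ρ) ^ b * (2 * σ / ρ)) * ((Cf * Cw) ^ 2 * A ^ 2 * ((ρ / t) ^ n) ^ 2) := by gcongr
        _ = b * 2 ^ b * (Cf * Cw) ^ 2 * A ^ 2 * (((t / ρ) ^ b * ((ρ / t) ^ n) ^ 2) * (2 * σ / ρ)) := by ring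
        _ = b * 2 ^ b * (Cf * Cw) ^ 2 * A ^ 2 * ((t / ρ) ^ ((lam - 2) * n) * (2 * σ / ρ)) := by rw [e1]
        _ ≤ _ := by
            refine mul_le_mul_of_nonneg_left ?_ (by positivity)
            exact far_mm hs hs1 ht (by positivity) htρ hcase
    have h7 : W * F ^ 2 ≤ (W' + b * 2 ^ b * ((t / ρ) ^ b * (2 * σ / ρ))) * F ^ 2 := by gcongr
    have h8 : 0 ≤ (2 * (Cn * Cw) ^ 2 + b * 2 ^ b * (Cf * Cw) ^ 2) * A ^ 2 *
        (W * mm (2 * δ) (t / (4 * σ))) := by positivity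
    have h9 : 0 ≤ 2 * (Cn * Cw) ^ 2 * A ^ 2 * ((t / ρ) ^ ((lam - 2) * n - s) * mm s (t / (2 * σ))) := by positivity
    have h10 : 0 ≤ 2 * (W * cvl ψ t f2 y ^ 2) := by positivity
    linarith

lemma bracket_mm2 {κ s a : ℝ} (hs : 0 < s) (ha : 0 < a) (c : Rn n) :
    ∫⁻ t in Ioi (0:ℝ), ∫⁻ y : Rn n, ENNReal.ofReal ((t / (t + dist c y)) ^ κ * mm s (t / a) / t ^ (n + 1)) ≤
      JB n κ * ENNReal.ofReal (2 / s) := by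
  calc ∫⁻ t in Ioi (0:ℝ), ∫⁻ y : Rn n, ENNReal.ofReal ((t / (t + dist c y)) ^ κ * mm s (t / a) / t ^ (n + 1))
      = ∫⁻ t in Ioi (0:ℝ), JB n κ * ENNReal.ofReal (mm s (t / a) / t) := by
        refine setLIntegral_congr_fun measurableSet_Ioi fun t (ht : 0 < t) => ?_
        have hm : 0 ≤ mm s (t / a) := mm_nonneg s (by positivity)
        have : ∀ y : Rn n, ENNReal.ofReal ((t / (t + dist c y)) ^ κ * mm s (t / a) / t ^ (n + 1)) =
            ENNReal.ofReal (mm s (t / a) / t ^ (n + 1)) * ENNReal.ofReal ((t / (t + dist c y)) ^ κ) := by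
          intro y
          rw [← ENNReal.ofReal_mul (by positivity)]
          congr 1; ring
        simp only [this]
        rw [lintegral_const_mul' _ _ (by simp), lintegral_bracket ht, ← mul_assoc,
          ← ENNReal.ofReal_mul (by positivity), mul_comm]
        congr 2
        rw [pow_succ]; field_simp
    _ ≤ _ := by
        rw [lintegral_const_mul _ (by
          have := mm_measurable s
          fun_prop)]
        gcongr
        exact lint_mm ha hs

lemma II_add {F G : ℝ × Rn n → ℝ≥0∞} (hF : Measurable F) :
    ∫⁻ t in Ioi (0:ℝ), ∫⁻ y, (F (t, y) + G (t, y)) =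
      (∫⁻ t in Ioi (0:ℝ), ∫⁻ y, F (t, y)) + ∫⁻ t in Ioi (0:ℝ), ∫⁻ y, G (t, y) := by
  rw [← lintegral_add_left (hF.lintegral_prod_right' (ν := (volume : Measure (Rn n))))]
  congr 1; funext t
  rw [lintegral_add_left (by fun_prop)]

lemma Gstar_sq' (ψ : Rn n → ℝ) (lam : ℝ) (f : Rn n → ℝ) (x : Rn n) :
    Gstar ψ lam f x ^ 2 = ∫⁻ t in Ioi (0:ℝ), ∫⁻ y,
      ENNReal.ofReal ((t / (t + dist x y)) ^ (lam * (n : ℝ)) *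
        (cvl ψ t f y) ^ 2 / t ^ (n + 1)) := by
  rw [Gstar, ← ENNReal.rpow_natCast, ← ENNReal.rpow_mul]; norm_num

lemma int_compare (hn : 1 ≤ n) {C₁ C₂ δ γ : ℝ} (hC₁ : 0 < C₁) (hδ : 0 < δ) (hγ : 0 < γ)
    {ψ : Rn n → ℝ} (hψ : PsiKernel n C₁ C₂ δ γ ψ) {lam : ℝ} (hlam : 2 < lam)
    (hlamn : (lam - 3) * (n : ℝ) > 2 * δ + 2 * γ)
    {ω : Rn n → ℝ} {Cw : ℝ} (hCw : 0 < Cw) (hω0 : ∀ x, 0 ≤ ω x)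
    (hω : LocallyIntegrable ω volume) (hA : A1pt ω Cw) :
    ∃ C : ℝ, 0 < C ∧ ∀ (f : Rn n → ℝ) (N : ℝ), LocallyIntegrable f volume → 0 ≤ N → BMO1 ω f N →
      ∀ (c x x' : Rn n) (h : ℝ), 0 < h → x ∈ cube c h → x' ∈ cube c h →
      Gstar ψ lam f x ≤ Gstar ψ lam f x' +
        2 * Gstar ψ lam ((cube c (4 * (√n * h))).indicator fun z => f z - avg f (cube c (4 * (√n * h)))) x +
        ENNReal.ofReal (C * (N * avg ω (cube c h))) := by
  have hn0 : (0:ℝ) < n := by exact_mod_cast hn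
  have hsn : 0 < √(n:ℝ) := Real.sqrt_pos.2 hn0
  set s : ℝ := min 1 (((lam - 3) * n) / 2) with hs_def
  have hs : 0 < s := lt_min one_pos (by linarith)
  have hs1 : s ≤ 1 := min_le_left _ _
  have hs2 : s ≤ ((lam - 3) * n) / 2 := min_le_right _ _
  have hκ : (n:ℝ) < (lam - 2) * n - s := by nlinarith
  have hκ1 : (n:ℝ) < lam * n := by nlinarith
  obtain ⟨K, hK, hpt⟩ := pt_compare hn hC₁ hδ hγ hψ hlam hs hs1 hCw hω0 hω hA
  have J1 := JB_lt_top hκ1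
  have J2 := JB_lt_top hκ
  set D : ℝ := K * ((JB n (lam * n)).toReal * (2 / (2 * δ)) + (JB n ((lam - 2) * n - s)).toReal * (2 / s)) with hD
  have hD0 : 0 ≤ D := by positivity
  refine ⟨√D + 1, by positivity, fun f N hf hN hB c x x' h hh hx hx' => ?_⟩
  have hψm : Measurable ψ := psi_measurable hγ hψ
  have hav : 0 ≤ avg ω (cube c h) := avg_nonneg hω0 _
  set A := N * avg ω (cube c h) with hA'
  have hA0 : 0 ≤ A := by positivity
  set f2 := (cube c (4 * (√n * h))).indicator fun z => f z - avg f (cube c (4 * (√n * h))) with hf2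
  have mf : Measurable (fun q : ℝ × Rn n => cvl ψ q.1 f q.2) := cvl_measurable hψm hf.aestronglyMeasurable
  have mf2 : Measurable (fun q : ℝ × Rn n => cvl ψ q.1 f2 q.2) := by
    refine cvl_measurable hψm ?_
    exact (hf.aestronglyMeasurable.sub aestronglyMeasurable_const).indicator (measurableSet_cube _ _)
  have hmm := mm_measurable
  set F1 : ℝ × Rn n → ℝ≥0∞ := fun q => ENNReal.ofReal ((q.1 / (q.1 + dist x' q.2)) ^ (lam * (n : ℝ)) *
        (cvl ψ q.1 f q.2) ^ 2 / q.1 ^ (n + 1)) with hF1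
  set F2 : ℝ × Rn n → ℝ≥0∞ := fun q => ENNReal.ofReal ((q.1 / (q.1 + dist x q.2)) ^ (lam * (n : ℝ)) *
        (cvl ψ q.1 f2 q.2) ^ 2 / q.1 ^ (n + 1)) with hF2
  set F3 : ℝ × Rn n → ℝ≥0∞ := fun q => ENNReal.ofReal ((q.1 / (q.1 + dist x q.2)) ^ (lam * (n : ℝ)) *
        mm (2 * δ) (q.1 / (4 * (√n * h))) / q.1 ^ (n + 1)) with hF3
  set F4 : ℝ × Rn n → ℝ≥0∞ := fun q => ENNReal.ofReal ((q.1 / (q.1 + dist c q.2)) ^ ((lam - 2) * n - s) *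
        mm s (q.1 / (2 * (√n * h))) / q.1 ^ (n + 1)) with hF4
  have m1 : Measurable F1 := by fun_prop
  have m2 : Measurable F2 := by fun_prop
  have m3 : Measurable F3 := by
    have := hmm (2 * δ); fun_prop
  have m4 : Measurable F4 := by
    have := hmm s; fun_prop
  have key : Gstar ψ lam f x ^ 2 ≤ Gstar ψ lam f x' ^ 2 + (2 * Gstar ψ lam f2 x ^ 2 + ENNReal.ofReal (D * A ^ 2)) := by
    calc Gstar ψ lam f x ^ 2 ≤ ∫⁻ t in Ioi (0:ℝ), ∫⁻ y : Rn n, (F1 (t, y) + (fun q => (2 * F2 q + ENNReal.ofReal (K * A ^ 2) * (F3 q + F4 q))) (t, y)) := by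
          rw [Gstar_sq']
          refine setLIntegral_mono' measurableSet_Ioi fun t (ht : 0 < t) => lintegral_mono fun y => ?_
          have h3 := mm_nonneg (2 * δ) (u := t / (4 * (√n * h))) (by positivity)
          have h4 := mm_nonneg s (u := t / (2 * (√n * h))) (by positivity)
          have e2 : ∀ X : ℝ≥0∞, 2 * X = ENNReal.ofReal 2 * X := fun X => by simp
          simp only [hF1, hF2, hF3, hF4]
          rw [e2, ← ENNReal.ofReal_add (by positivity) (by positivity), ← ENNReal.ofReal_mul (by positivity),
            ← ENNReal.ofReal_mul (by positivity), ← ENNReal.ofReal_add (by positivity) (by positivity),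
            ← ENNReal.ofReal_add (by positivity) (by positivity)]
          refine ENNReal.ofReal_le_ofReal ?_
          have := div_le_div_of_nonneg_right (hpt f N hf hN hB c x x' h hh hx hx' t y ht) (c := t ^ (n + 1)) (by positivity)
          refine this.trans_eq ?_
          ring
      _ = (∫⁻ t in Ioi (0:ℝ), ∫⁻ y : Rn n, F1 (t, y)) + (2 * (∫⁻ t in Ioi (0:ℝ), ∫⁻ y : Rn n, F2 (t, y)) +
          ENNReal.ofReal (K * A ^ 2) * ((∫⁻ t in Ioi (0:ℝ), ∫⁻ y : Rn n, F3 (t, y)) + (∫⁻ t in Ioi (0:ℝ), ∫⁻ y : Rn n, F4 (t, y)))) := by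
          refine (II_add (G := fun q => (2 * F2 q + ENNReal.ofReal (K * A ^ 2) * (F3 q + F4 q))) m1).trans ?_
          congr 1
          refine (II_add (F := fun q => 2 * F2 q) (G := fun q => ENNReal.ofReal (K * A ^ 2) * (F3 q + F4 q)) (m2.const_mul 2)).trans ?_
          congr 1
          · rw [← lintegral_const_mul' _ _ (by simp)]
            congr 1; funext t
            rw [← lintegral_const_mul' _ _ (by simp)]
          · rw [← II_add m3, ← lintegral_const_mul' _ _ (by simp)]
            congr 1; funext t
            rw [← lintegral_const_mul' _ _ (by simp)]
      _ ≤ _ := by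
          rw [Gstar_sq' ψ lam f x', Gstar_sq' ψ lam f2 x]
          gcongr
          have b3 := bracket_mm2 (κ := lam * n) (s := 2 * δ) (a := 4 * (√n * h)) (by positivity) (by positivity) x
          have b4 := bracket_mm2 (κ := (lam - 2) * n - s) (s := s) (a := 2 * (√n * h)) (by positivity) (by positivity) c
          refine (mul_le_mul_right (add_le_add b3 b4) _).trans ?_
          rw [← ENNReal.ofReal_toReal J1.ne, ← ENNReal.ofReal_toReal J2.ne, ← ENNReal.ofReal_mul (by positivity),
            ← ENNReal.ofReal_mul (by positivity), ← ENNReal.ofReal_add (by positivity) (by positivity),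
            ← ENNReal.ofReal_mul (by positivity)]
          refine ENNReal.ofReal_le_ofReal (le_of_eq ?_)
          rw [hD]; ring
  rw [← ENNReal.pow_le_pow_left_iff (n := 2) (by norm_num)]
  refine key.trans ?_
  have hDA : ENNReal.ofReal (D * A ^ 2) ≤ (ENNReal.ofReal ((√D + 1) * A)) ^ 2 := by
    rw [← ENNReal.ofReal_pow (by positivity)]
    refine ENNReal.ofReal_le_ofReal ?_
    rw [mul_pow (√D + 1) A]
    have : D ≤ (√D + 1) ^ 2 := by
      nlinarith [Real.sq_sqrt hD0, Real.sqrt_nonneg D]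
    exact mul_le_mul_of_nonneg_right this (sq_nonneg A)
  generalize Gstar ψ lam f x' = a
  generalize Gstar ψ lam f2 x = b
  generalize ENNReal.ofReal ((√D + 1) * A) = d at *
  calc a ^ 2 + (2 * b ^ 2 + ENNReal.ofReal (D * A ^ 2)) ≤ a ^ 2 + (2 * b ^ 2 + d ^ 2) := by gcongr
    _ ≤ a ^ 2 + (2 * b ^ 2 + d ^ 2) + (2 * b ^ 2 + 2 * a * (2 * b) + 2 * a * d + 2 * (2 * b) * d) := le_self_add
    _ = _ := by ring

lemma essInf_cob {α : Type*} [MeasurableSpace α] {μ : Measure α} (hμ : μ ≠ 0) (g : α → ℝ) :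
    Filter.IsCoboundedUnder (· ≥ ·) (ae μ) g := by
  have : (ae μ).NeBot := ae_neBot.2 hμ
  have h1 : ∃ M : ℕ, ¬ ∀ᵐ x ∂μ, (M:ℝ) < g x := by
    by_contra! hcon
    have h2 := ae_all_iff.2 hcon
    obtain ⟨x, hx⟩ := h2.exists
    obtain ⟨m, hm⟩ := exists_nat_gt (g x)
    exact absurd (hx m) (not_lt.2 hm.le)
  obtain ⟨M, hM⟩ := h1
  refine ⟨M, fun a ha => ?_⟩
  have ha' : ∀ᵐ x ∂μ, a ≤ g x := by simpa using ha
  by_contra hlt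
  have hlt' : (M:ℝ) < a := not_le.1 hlt
  exact hM (ha'.mono fun x hx => hlt'.trans_le hx)

lemma essInf_bdd {α : Type*} [MeasurableSpace α] {μ : Measure α} {g : α → ℝ} (h0 : ∀ x, 0 ≤ g x) :
    Filter.IsBoundedUnder (· ≥ ·) (ae μ) g :=
  Filter.isBoundedUnder_of ⟨0, fun x => h0 x⟩

lemma essInf_le_ae {α : Type*} [MeasurableSpace α] {μ : Measure α} {g : α → ℝ} (h0 : ∀ x, 0 ≤ g x) :
    ∀ᵐ x ∂μ, essInf g μ ≤ g x := ae_essInf_le (essInf_bdd h0)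

lemma essInf_exists {α : Type*} [MeasurableSpace α] {μ : Measure α} (hμ : μ ≠ 0) (g : α → ℝ)
    {ε : ℝ} (hε : 0 < ε) {P : α → Prop} (hP : ∀ᵐ x ∂μ, P x) : ∃ x, P x ∧ g x < essInf g μ + ε := by
  by_contra! hcon
  have : ∀ᵐ x ∂μ, essInf g μ + ε ≤ g x := hP.mono fun x hx => hcon x hx
  have := le_essInf_of_ae_le _ this (essInf_cob hμ g)
  linarith

lemma avg_pos {ω : Rn n → ℝ} (hω0 : ∀ x, 0 ≤ ω x) (hω : LocallyIntegrable ω volume)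
    (hpos : ∀ᵐ x ∂(volume : Measure (Rn n)), 0 < ω x) (c : Rn n) {h : ℝ} (hh : 0 < h) :
    0 < avg ω (cube c h) := by
  have hv : 0 < (volume (cube c h)).toReal := by
    rw [volume_cube_toReal _ hh.le]; positivity
  refine mul_pos (inv_pos.2 hv) ?_
  rw [setIntegral_pos_iff_support_of_nonneg_ae (Filter.Eventually.of_forall hω0) (integrableOn_cube hω c hh.le)]
  have : volume (Function.support ω ∩ cube c h) = volume (cube c h) := by
    refine measure_congr ?_
    filter_upwards [hpos] with x hx
    apply propext
    exact ⟨fun h => h.2, fun h => ⟨hx.ne', h⟩⟩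
  rw [this]
  exact (ENNReal.toReal_pos_iff.1 hv).1

lemma restrict_cube_ne (c : Rn n) {h : ℝ} (hh : 0 < h) : (volume : Measure (Rn n)).restrict (cube c h) ≠ 0 := by
  rw [Ne, Measure.restrict_eq_zero, volume_cube c hh.le]
  simp only [ENNReal.ofReal_eq_zero, not_le]; positivity

lemma weak_cmp (hn : 1 ≤ n) {C₁ C₂ δ γ : ℝ} (hC₁ : 0 < C₁) (hC₂ : 0 < C₂) (hδ : 0 < δ) (hγ : 0 < γ)
    {ψ : Rn n → ℝ} (hψ : PsiKernel n C₁ C₂ δ γ ψ) {lam : ℝ} (hlam : 2 < lam)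
    (hlamn : (lam - 3) * (n : ℝ) > 2 * δ + 2 * γ)
    {ω : Rn n → ℝ} {Cw : ℝ} (hCw : 0 < Cw) (hω0 : ∀ x, 0 ≤ ω x)
    (hω : LocallyIntegrable ω volume) (hpos : ∀ᵐ x ∂(volume : Measure (Rn n)), 0 < ω x) (hA : A1pt ω Cw)
    {η : ℝ} (hη : 0 < η) :
    ∃ K : ℝ, 0 < K ∧ ∀ (f : Rn n → ℝ) (N : ℝ), LocallyIntegrable f volume → 0 < N → BMO1 ω f N →
      ∀ (c x' : Rn n) (h : ℝ), 0 < h → x' ∈ cube c h →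
      volume {x | x ∈ cube c h ∧ Gstar ψ lam f x' + ENNReal.ofReal (K * (N * avg ω (cube c h))) < Gstar ψ lam f x}
        ≤ ENNReal.ofReal (η * (2 * h) ^ n) := by
  have hn1 : (1:ℝ) ≤ n := by exact_mod_cast hn
  have hsn : 1 ≤ √(n:ℝ) := Real.one_le_sqrt.2 hn1
  obtain ⟨C, hC, hcmp⟩ := int_compare hn hC₁ hδ hγ hψ hlam hlamn hCw hω0 hω hA
  obtain ⟨K, hK, hwt⟩ := weak_type hn hC₁ hC₂ hδ hγ hψ hlam hlamn (η := η / (4 * √n) ^ n) (by positivity)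
  refine ⟨2 * K * Cw + C, by positivity, fun f N hf hN hB c x' h hh hx' => ?_⟩
  have hap := avg_pos hω0 hω hpos c hh
  set A := N * avg ω (cube c h) with hA'
  have hA0 : 0 < A := by positivity
  set r := 4 * (√n * h) with hr
  have hhr : h ≤ r := by nlinarith
  have hr0 : 0 < r := by linarith
  set f2 := (cube c r).indicator fun z => f z - avg f (cube c r) with hf2
  have hIntg : IntegrableOn (fun z => f z - avg f (cube c r)) (cube c r) :=
    (integrableOn_cube hf c hr0.le).sub (integrableOn_const (volume_cube_ne_top _ hr0))
  have i2 : Integrable f2 volume := hIntg.integrable_indicator (measurableSet_cube _ _)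
  have n2 : ∫ x, |f2 x| ≤ Cw * A * (2 * r) ^ n := by
    have e : (fun x => |f2 x|) = (cube c r).indicator fun z => |f z - avg f (cube c r)| := by
      funext x
      by_cases hx : x ∈ cube c r <;> simp [hf2, hx]
    rw [e, integral_indicator (measurableSet_cube _ _)]
    refine (hB c r hr0).trans ?_
    rw [setIntegral_cube_eq_avg ω c hr0]
    have := avg_mono hω hA hh hr0 (cube_mono c hhr)
    calc N * ((2 * r) ^ n * avg ω (cube c r)) ≤ N * ((2 * r) ^ n * (Cw * avg ω (cube c h))) := by gcongr
      _ = _ := by rw [hA']; ring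
  have hw := hwt c r f2 (Cw * A) hr0 (by positivity) i2 (fun x hx => by simp [hf2, hx]) n2
  refine (measure_mono ?_).trans (hw.trans (ENNReal.ofReal_le_ofReal (le_of_eq ?_)))
  · rintro x ⟨hx, hlt⟩
    have h1 := hcmp f N hf hN.le hB c x x' h hh hx hx'
    change ENNReal.ofReal (K * (Cw * A)) < Gstar ψ lam f2 x
    by_contra hle
    have hle := not_lt.1 hle
    refine absurd (hlt.trans_le h1) (not_lt.2 ?_)
    rw [add_assoc]
    gcongr
    calc 2 * Gstar ψ lam f2 x + ENNReal.ofReal (C * A) ≤ 2 * ENNReal.ofReal (K * (Cw * A)) + ENNReal.ofReal (C * A) := by gcongr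
      _ = _ := by
        rw [two_mul, ← ENNReal.ofReal_add (by positivity) (by positivity), ← ENNReal.ofReal_add (by positivity) (by positivity)]
        congr 1; ring
  · have : (2 * r) ^ n = (4 * √n) ^ n * (2 * h) ^ n := by rw [hr, ← mul_pow]; ring
    rw [this]; field_simp

lemma finite_ae (hn : 1 ≤ n) {C₁ C₂ δ γ : ℝ} (hC₁ : 0 < C₁) (hC₂ : 0 < C₂) (hδ : 0 < δ) (hγ : 0 < γ)
    {ψ : Rn n → ℝ} (hψ : PsiKernel n C₁ C₂ δ γ ψ) {lam : ℝ} (hlam : 2 < lam)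
    (hlamn : (lam - 3) * (n : ℝ) > 2 * δ + 2 * γ)
    {ω : Rn n → ℝ} {Cw : ℝ} (hCw : 0 < Cw) (hω0 : ∀ x, 0 ≤ ω x)
    (hω : LocallyIntegrable ω volume) (hpos : ∀ᵐ x ∂(volume : Measure (Rn n)), 0 < ω x) (hA : A1pt ω Cw)
    {f : Rn n → ℝ} {N : ℝ} (hf : LocallyIntegrable f volume) (hN : 0 < N) (hB : BMO1 ω f N)
    {x₀ : Rn n} (hx₀ : Gstar ψ lam f x₀ < ⊤) : ∀ᵐ x ∂(volume : Measure (Rn n)), Gstar ψ lam f x < ⊤ := by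
  have key : ∀ m : ℕ, volume {x | x ∈ cube x₀ (m + 1) ∧ Gstar ψ lam f x = ⊤} = 0 := by
    intro m
    have hm : (0:ℝ) < m + 1 := by positivity
    refine le_antisymm ?_ zero_le
    refine ENNReal.le_of_forall_pos_le_add fun ε hε _ => ?_
    rw [zero_add]
    have hp : (0:ℝ) < (2 * (m + 1)) ^ n := by positivity
    obtain ⟨K, hK, hw⟩ := weak_cmp hn hC₁ hC₂ hδ hγ hψ hlam hlamn hCw hω0 hω hpos hA
      (η := ε / (2 * (m + 1)) ^ n) (by positivity)
    refine (measure_mono ?_).trans ((hw f N hf hN hB x₀ x₀ (m + 1) hm (mem_cube_of_norm (by simpa using hm))).trans ?_)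
    · rintro x ⟨hx, hxt⟩
      refine ⟨hx, ?_⟩
      rw [hxt]
      exact ENNReal.add_lt_top.2 ⟨hx₀, ENNReal.ofReal_lt_top⟩
    · rw [div_mul_cancel₀ _ hp.ne']
      simp
  have h2 : volume (⋃ m : ℕ, {x | x ∈ cube x₀ (m + 1) ∧ Gstar ψ lam f x = ⊤}) = 0 := measure_iUnion_null key
  rw [ae_iff]
  refine measure_mono_null ?_ h2
  intro x hx
  obtain ⟨m, hm⟩ := exists_nat_gt ‖x - x₀‖
  refine mem_iUnion.2 ⟨m, mem_cube_of_norm (by linarith), ?_⟩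
  exact not_lt_top_iff.1 hx

lemma osc_weak (hn : 1 ≤ n) {C₁ C₂ δ γ : ℝ} (hC₁ : 0 < C₁) (hC₂ : 0 < C₂) (hδ : 0 < δ) (hγ : 0 < γ)
    {ψ : Rn n → ℝ} (hψ : PsiKernel n C₁ C₂ δ γ ψ) {lam : ℝ} (hlam : 2 < lam)
    (hlamn : (lam - 3) * (n : ℝ) > 2 * δ + 2 * γ)
    {ω : Rn n → ℝ} {Cw : ℝ} (hCw : 0 < Cw) (hω0 : ∀ x, 0 ≤ ω x)
    (hω : LocallyIntegrable ω volume) (hpos : ∀ᵐ x ∂(volume : Measure (Rn n)), 0 < ω x) (hA : A1pt ω Cw)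
    {η : ℝ} (hη : 0 < η) :
    ∃ K : ℝ, 0 < K ∧ ∀ (f : Rn n → ℝ) (N : ℝ), LocallyIntegrable f volume → 0 < N → BMO1 ω f N →
      (∀ᵐ x ∂(volume : Measure (Rn n)), Gstar ψ lam f x < ⊤) →
      ∀ (c : Rn n) (h : ℝ), 0 < h →
      volume {x | x ∈ cube c h ∧ essInf (fun x => (Gstar ψ lam f x).toReal) (volume.restrict (cube c h)) +
          K * (N * avg ω (cube c h)) < (Gstar ψ lam f x).toReal}
        ≤ ENNReal.ofReal (η * (2 * h) ^ n) := by
  obtain ⟨K, hK, hw⟩ := weak_cmp hn hC₁ hC₂ hδ hγ hψ hlam hlamn hCw hω0 hω hpos hA hη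
  refine ⟨K + 1, by positivity, fun f N hf hN hB hfin c h hh => ?_⟩
  have hap := avg_pos hω0 hω hpos c hh
  set A := N * avg ω (cube c h) with hA'
  have hA0 : 0 < A := by positivity
  set g := fun x => (Gstar ψ lam f x).toReal with hg
  have hP : ∀ᵐ x ∂(volume.restrict (cube c h)), x ∈ cube c h ∧ Gstar ψ lam f x < ⊤ := by
    filter_upwards [ae_restrict_mem (measurableSet_cube c h), ae_restrict_of_ae hfin] with x h1 h2 using ⟨h1, h2⟩
  obtain ⟨x', ⟨hx'c, hx't⟩, hx'⟩ := essInf_exists (restrict_cube_ne c hh) g hA0 hP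
  refine (measure_mono ?_).trans (hw f N hf hN hB c x' h hh hx'c)
  rintro x ⟨hx, hlt⟩
  refine ⟨hx, ?_⟩
  have h1 : g x' + K * A < g x := by
    change _ < g x at hlt
    linarith
  have h0 : 0 ≤ g x' := ENNReal.toReal_nonneg
  by_cases hxt : Gstar ψ lam f x = ⊤
  · rw [hxt]; exact ENNReal.add_lt_top.2 ⟨hx't, ENNReal.ofReal_lt_top⟩
  · rw [← ENNReal.ofReal_toReal hxt, ← ENNReal.ofReal_toReal hx't.ne,
      ← ENNReal.ofReal_add h0 (by positivity)]
    exact (ENNReal.ofReal_lt_ofReal_iff_of_nonneg (by positivity)).2 h1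

lemma stop_cubes (hn : 1 ≤ n) (c : Rn n) {h : ℝ} (hh : 0 < h) {E : Set (Rn n)} (hE : MeasurableSet E)
    (hEQ : E ⊆ cube c h) (hv : volume E ≤ ENNReal.ofReal (((2:ℝ) ^ (n + 2))⁻¹ * (2 * h) ^ n)) :
    ∃ (I : Set (ℕ × (Fin n → ℤ))) (cc : ℕ × (Fin n → ℤ) → Rn n) (r : ℕ × (Fin n → ℤ) → ℝ),
      (∀ i, 0 < r i) ∧ I.PairwiseDisjoint (fun i => cube (cc i) (r i)) ∧
      (∀ i ∈ I, cube (cc i) (r i) ⊆ cube c h) ∧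
      (∀ i ∈ I, ¬ ∀ᵐ x ∂(volume : Measure (Rn n)), x ∈ cube (cc i) (r i) → x ∈ E) ∧
      volume (⋃ i ∈ I, cube (cc i) (r i)) ≤ ENNReal.ofReal (1 / 2 * (2 * h) ^ n) ∧
      ∀ᵐ x ∂(volume : Measure (Rn n)), x ∈ cube c h → x ∈ E → ∃ i ∈ I, x ∈ cube (cc i) (r i) := by
  have hEfin : volume E ≠ ⊤ := ne_top_of_le_ne_top ENNReal.ofReal_ne_top hv
  have hp : (0:ℝ) < (2 * h) ^ n := by positivity
  set g : Rn n → ℝ := E.indicator fun _ => (1:ℝ) with hg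
  have hgi : Integrable g volume := by
    rw [hg, integrable_indicator_iff hE]; exact integrableOn_const hEfin
  have hset : ∀ F : Set (Rn n), ∫ x in F, g x = (volume (E ∩ F)).toReal := by
    intro F
    rw [hg, integral_indicator hE, Measure.restrict_restrict hE]
    simp [measureReal_def]
  have hα : avg g (cube c h) ≤ ((2:ℝ) ^ (n + 1))⁻¹ := by
    rw [avg, hset, inter_eq_left.2 hEQ, volume_cube_toReal _ hh.le]
    have h1 : (volume E).toReal ≤ ((2:ℝ) ^ (n + 2))⁻¹ * (2 * h) ^ n :=
      ENNReal.toReal_le_of_le_ofReal (by positivity) hv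
    calc ((2 * h) ^ n)⁻¹ * (volume E).toReal ≤ ((2 * h) ^ n)⁻¹ * (((2:ℝ) ^ (n + 2))⁻¹ * (2 * h) ^ n) := by gcongr
      _ = ((2:ℝ) ^ (n + 2))⁻¹ := by field_simp
      _ ≤ _ := by gcongr <;> norm_num
  obtain ⟨I, cc, r, hr, hdis, hsub, hlow, hup, hae⟩ := cz hn c hh (g := g)
    (fun x => indicator_nonneg (fun _ _ => zero_le_one) x) hgi hα
  refine ⟨I, cc, r, hr, hdis, hsub, ?_, ?_, ?_⟩
  · intro i hi hcon
    have h1 := hup i hi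
    have hri := hr i
    have hq : (0:ℝ) < (2 * r i) ^ n := by positivity
    have e : volume (E ∩ cube (cc i) (r i)) = volume (cube (cc i) (r i)) := by
      refine measure_congr ?_
      filter_upwards [hcon] with x hx
      exact propext ⟨fun h => h.2, fun h => ⟨hx h, h⟩⟩
    rw [hset, e, volume_cube_toReal _ (hr i).le] at h1
    have : (2:ℝ) ^ n * (2 ^ (n + 1))⁻¹ = 1 / 2 := by rw [pow_succ]; field_simp
    rw [this] at h1
    linarith
  · have hm : ∀ i, MeasurableSet (cube (cc i) (r i)) := fun i => measurableSet_cube _ _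
    have hIc : I.Countable := Set.to_countable I
    have hvol : ∀ i ∈ I, volume (cube (cc i) (r i)) ≤ ENNReal.ofReal (2 ^ (n + 1)) * volume (E ∩ cube (cc i) (r i)) := by
      intro i hi
      have h1 := hlow i hi
      have hfin : volume (E ∩ cube (cc i) (r i)) ≠ ⊤ := ne_top_of_le_ne_top hEfin (measure_mono inter_subset_left)
      rw [hset] at h1
      rw [volume_cube _ (hr i).le, ← ENNReal.ofReal_toReal hfin, ← ENNReal.ofReal_mul (by positivity)]
      refine ENNReal.ofReal_le_ofReal ?_
      have hq : (0:ℝ) < 2 ^ (n + 1) := by positivity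
      rw [inv_mul_lt_iff₀ hq] at h1
      exact h1.le
    calc volume (⋃ i ∈ I, cube (cc i) (r i)) ≤ ∑' i : I, volume (cube (cc i) (r i)) := measure_biUnion_le _ hIc _
      _ ≤ ∑' i : I, ENNReal.ofReal (2 ^ (n + 1)) * volume (E ∩ cube (cc i) (r i)) :=
          ENNReal.tsum_le_tsum fun i => hvol i i.2
      _ = ENNReal.ofReal (2 ^ (n + 1)) * volume (⋃ i ∈ I, E ∩ cube (cc i) (r i)) := by
          rw [ENNReal.tsum_mul_left, measure_biUnion hIc]
          · exact fun i hi j hj hij => (hdis hi hj hij).mono inter_subset_right inter_subset_right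
          · exact fun i _ => hE.inter (hm i)
      _ ≤ ENNReal.ofReal (2 ^ (n + 1)) * ENNReal.ofReal (((2:ℝ) ^ (n + 2))⁻¹ * (2 * h) ^ n) := by
          gcongr
          exact (measure_mono (iUnion₂_subset fun i _ => inter_subset_left)).trans hv
      _ = _ := by
          rw [← ENNReal.ofReal_mul (by positivity)]
          congr 1
          rw [pow_succ 2 (n + 1)]; field_simp
  · filter_upwards [hae] with x hx hxc hxE
    rcases hx hxc with h1 | h1
    · exact h1
    · exfalso
      have : g x = 1 := by simp [hg, hxE]
      rw [this] at h1
      have : ((2:ℝ) ^ (n + 1))⁻¹ < 1 := inv_lt_one_of_one_lt₀ (one_lt_pow₀ (by norm_num) (by omega))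
      linarith

/-- the measure with density the weight -/
def wm (ω : Rn n → ℝ) : Measure (Rn n) := volume.withDensity fun x => ENNReal.ofReal (ω x)

lemma wm_apply (ω : Rn n → ℝ) {E : Set (Rn n)} (hE : MeasurableSet E) : wm ω E = ∫⁻ x in E, ENNReal.ofReal (ω x) :=
  withDensity_apply _ hE

lemma wm_cube {ω : Rn n → ℝ} (hω0 : ∀ x, 0 ≤ ω x) (hω : LocallyIntegrable ω volume) (c : Rn n) {h : ℝ} (hh : 0 < h) :
    wm ω (cube c h) = ENNReal.ofReal ((2 * h) ^ n * avg ω (cube c h)) := by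
  rw [wm_apply _ (measurableSet_cube _ _), ← setIntegral_cube_eq_avg ω c hh,
    ofReal_integral_eq_lintegral_ofReal (integrableOn_cube hω c hh.le) (Filter.Eventually.of_forall hω0)]

lemma wm_small {ω : Rn n → ℝ} {Cw : ℝ} (hCw : 1 ≤ Cw) (hω0 : ∀ x, 0 ≤ ω x)
    (hω : LocallyIntegrable ω volume) (hA : A1pt ω Cw) (c : Rn n) {h : ℝ} (hh : 0 < h)
    {S : Set (Rn n)} (hS : MeasurableSet S) (hSQ : S ⊆ cube c h)
    (hv : volume S ≤ ENNReal.ofReal (1 / 2 * (2 * h) ^ n)) :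
    wm ω S ≤ ENNReal.ofReal (1 - 1 / (2 * Cw)) * wm ω (cube c h) := by
  have hp : (0:ℝ) < (2 * h) ^ n := by positivity
  have hC0 : 0 < Cw := by linarith
  have hav := avg_nonneg hω0 (cube c h)
  have hD : MeasurableSet (cube c h \ S) := (measurableSet_cube _ _).diff hS
  have hvD : ENNReal.ofReal (1 / 2 * (2 * h) ^ n) ≤ volume (cube c h \ S) := by
    have h1 : volume S + volume (cube c h \ S) = volume (cube c h) := by
      rw [measure_add_sdiff hS.nullMeasurableSet, union_eq_right.2 hSQ]
    rw [volume_cube _ hh.le] at h1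
    have h2 : ENNReal.ofReal ((2 * h) ^ n) = ENNReal.ofReal (1 / 2 * (2 * h) ^ n) + ENNReal.ofReal (1 / 2 * (2 * h) ^ n) := by
      rw [← ENNReal.ofReal_add (by positivity) (by positivity)]; congr 1; ring
    rw [h2] at h1
    by_contra hcon
    have := ENNReal.add_lt_add_of_le_of_lt (ne_top_of_le_ne_top ENNReal.ofReal_ne_top hv) hv (not_le.1 hcon)
    exact absurd h1 this.ne
  have hbig : ENNReal.ofReal (1 / (2 * Cw)) * wm ω (cube c h) ≤ wm ω (cube c h \ S) := by
    rw [wm_apply _ hD, wm_cube hω0 hω c hh, ← ENNReal.ofReal_mul (by positivity)]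
    calc ENNReal.ofReal (1 / (2 * Cw) * ((2 * h) ^ n * avg ω (cube c h)))
        = ENNReal.ofReal (avg ω (cube c h) / Cw) * ENNReal.ofReal (1 / 2 * (2 * h) ^ n) := by
          rw [← ENNReal.ofReal_mul (by positivity)]; congr 1; field_simp
      _ ≤ ENNReal.ofReal (avg ω (cube c h) / Cw) * volume (cube c h \ S) := by gcongr
      _ = ∫⁻ x in cube c h \ S, ENNReal.ofReal (avg ω (cube c h) / Cw) := by simp
      _ ≤ _ := by
          refine setLIntegral_mono_ae' hD ?_
          filter_upwards [hA c h hh] with x hx hxD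
          refine ENNReal.ofReal_le_ofReal ?_
          rw [div_le_iff₀ hC0, mul_comm]
          exact hx hxD.1
  have hadd : wm ω S + wm ω (cube c h \ S) = wm ω (cube c h) := by
    rw [measure_add_sdiff hS.nullMeasurableSet, union_eq_right.2 hSQ]
  have hfin : wm ω (cube c h) ≠ ⊤ := by rw [wm_cube hω0 hω c hh]; simp
  have hk : 1 / (2 * Cw) ≤ 1 := by rw [div_le_one (by positivity)]; linarith
  rw [ENNReal.ofReal_sub _ (by positivity), ENNReal.ofReal_one, ENNReal.sub_mul (by intros; exact hfin), one_mul]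
  refine ENNReal.le_sub_of_add_le_right (ENNReal.mul_ne_top ENNReal.ofReal_ne_top hfin) ?_
  rw [← hadd] at hbig ⊢
  gcongr

/-- truncated normalized lower oscillation -/
def UQ (ω g : Rn n → ℝ) (M : ℝ≥0∞) (c : Rn n) (h : ℝ) (x : Rn n) : ℝ≥0∞ :=
  min (ENNReal.ofReal (g x - essInf g (volume.restrict (cube c h))) / ENNReal.ofReal (ω x)) M

lemma UQ_aem {ω g : Rn n → ℝ} (hω : LocallyIntegrable ω volume) (hg : Measurable g) (M : ℝ≥0∞) (c : Rn n) (h : ℝ) :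
    AEMeasurable (UQ ω g M c h) (wm ω) := by
  have h1 : AEMeasurable ω volume := hω.aestronglyMeasurable.aemeasurable
  have h2 : AEMeasurable (UQ ω g M c h) volume := by
    unfold UQ
    fun_prop
  exact h2.mono_ac (withDensity_absolutelyContinuous _ _)

lemma one_step (hn : 1 ≤ n) {ω g : Rn n → ℝ} {Cw B p : ℝ} (hp : 1 < p) (hCw : 1 ≤ Cw) (hB : 0 < B) (hω0 : ∀ x, 0 ≤ ω x)
    (hω : LocallyIntegrable ω volume) (hpos : ∀ᵐ x ∂(volume : Measure (Rn n)), 0 < ω x) (hA : A1pt ω Cw)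
    (hg0 : ∀ x, 0 ≤ g x) (hg : Measurable g)
    (hosc : ∀ (c : Rn n) (h : ℝ), 0 < h → volume {x | x ∈ cube c h ∧
      essInf g (volume.restrict (cube c h)) + B * avg ω (cube c h) < g x} ≤
        ENNReal.ofReal (((2:ℝ) ^ (n + 2))⁻¹ * (2 * h) ^ n))
    {M Φ : ℝ≥0∞}
    (hΦ : ∀ (c : Rn n) (h : ℝ), 0 < h → ∫⁻ x in cube c h, UQ ω g M c h x ^ p ∂(wm ω) ≤ Φ * wm ω (cube c h))
    (c : Rn n) {h : ℝ} (hh : 0 < h) :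
    (∫⁻ x in cube c h, UQ ω g M c h x ^ p ∂(wm ω)) ^ (1 / p) ≤
      (ENNReal.ofReal (B * Cw) + (ENNReal.ofReal (1 - 1 / (2 * Cw)) * Φ) ^ (1 / p)) * wm ω (cube c h) ^ (1 / p) := by
  have hp0 : 0 < p := by linarith
  have hip : 0 ≤ 1 / p := by positivity
  have hac : wm ω ≪ volume := withDensity_absolutelyContinuous _ _
  set E := {x | x ∈ cube c h ∧ essInf g (volume.restrict (cube c h)) + B * avg ω (cube c h) < g x} with hE
  have hEm : MeasurableSet E := (measurableSet_cube c h).inter (measurableSet_lt measurable_const hg)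
  obtain ⟨I, cc, r, hr, hdis, hsub, hnot, hvol, hae⟩ := stop_cubes hn c hh hEm (fun x hx => hx.1) (hosc c h hh)
  have hIc : I.Countable := Set.to_countable I
  set V : Rn n → ℝ≥0∞ := fun x => ∑' i : I, (cube (cc i) (r i)).indicator (UQ ω g M (cc i) (r i)) x with hV
  have hVm : AEMeasurable V (wm ω) := by
    refine AEMeasurable.tsum fun i => ?_
    exact (UQ_aem hω hg M _ _).indicator (measurableSet_cube _ _)
  have hVi : ∀ i ∈ I, ∀ x ∈ cube (cc i) (r i), V x = UQ ω g M (cc i) (r i) x := by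
    intro i hi x hx
    simp only [hV]
    rw [tsum_eq_single (⟨i, hi⟩ : I)]
    · simp [hx]
    · intro j hj
      have hne : (j : ℕ × (Fin n → ℤ)) ≠ i := fun h => hj (Subtype.ext h)
      have : x ∉ cube (cc j) (r j) := fun hxj => Set.disjoint_left.1 (hdis j.2 hi hne) hxj hx
      simp [this]
  set S := ⋃ i ∈ I, cube (cc i) (r i) with hS
  have hSm : MeasurableSet S := MeasurableSet.biUnion hIc fun i _ => measurableSet_cube _ _
  have hSQ : S ⊆ cube c h := iUnion₂_subset hsub
  have hV0 : ∀ x ∉ S, V x = 0 := by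
    intro x hx
    simp only [hV, ENNReal.tsum_eq_zero]
    intro i
    have : x ∉ cube (cc i) (r i) := fun hxi => hx (mem_biUnion i.2 hxi)
    simp [this]
  have hinf : ∀ i ∈ I, essInf g (volume.restrict (cube (cc i) (r i))) ≤
      essInf g (volume.restrict (cube c h)) + B * avg ω (cube c h) := by
    intro i hi
    by_contra hlt
    refine hnot i hi ?_
    have h1 := (ae_restrict_iff' (measurableSet_cube _ _)).1 (essInf_le_ae (μ := volume.restrict (cube (cc i) (r i))) hg0)
    filter_upwards [h1] with x hx hxi
    exact ⟨hsub i hi hxi, (not_le.1 hlt).trans_le (hx hxi)⟩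
  have hpt : ∀ᵐ x ∂(wm ω), x ∈ cube c h → UQ ω g M c h x ≤ ENNReal.ofReal (B * Cw) + V x := by
    refine hac.ae_le ?_
    filter_upwards [hae, hpos, hA c h hh] with x hx1 hx2 hx3 hxc
    have hAx : B * avg ω (cube c h) ≤ B * Cw * ω x := by
      have := hx3 hxc
      calc B * avg ω (cube c h) ≤ B * (Cw * ω x) := by gcongr
        _ = _ := by ring
    have hdiv : ENNReal.ofReal (B * avg ω (cube c h)) / ENNReal.ofReal (ω x) ≤ ENNReal.ofReal (B * Cw) := by
      rw [← ENNReal.ofReal_div_of_pos hx2]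
      exact ENNReal.ofReal_le_ofReal ((div_le_iff₀ hx2).2 hAx)
    by_cases hxS : x ∈ S
    · obtain ⟨i, hi, hxi⟩ := mem_iUnion₂.1 hxS
      rw [hVi i hi x hxi]
      unfold UQ
      rw [← min_add_add_left]
      refine le_min ((min_le_left _ _).trans ?_) ((min_le_right _ _).trans le_add_self)
      calc ENNReal.ofReal (g x - essInf g (volume.restrict (cube c h))) / ENNReal.ofReal (ω x)
          ≤ (ENNReal.ofReal (B * avg ω (cube c h)) +
            ENNReal.ofReal (g x - essInf g (volume.restrict (cube (cc i) (r i))))) / ENNReal.ofReal (ω x) := by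
            gcongr
            refine le_trans (ENNReal.ofReal_le_ofReal ?_) ENNReal.ofReal_add_le
            linarith [hinf i hi]
        _ ≤ _ := by
            rw [ENNReal.add_div]
            gcongr
    · have hxE : x ∉ E := fun hxE => by
        obtain ⟨i, hi, hxi⟩ := hx1 hxc hxE
        exact hxS (mem_biUnion hi hxi)
      have hle : g x - essInf g (volume.restrict (cube c h)) ≤ B * avg ω (cube c h) := by
        by_contra hlt
        exact hxE ⟨hxc, by linarith [not_le.1 hlt]⟩
      calc UQ ω g M c h x ≤ _ := min_le_left _ _
        _ ≤ ENNReal.ofReal (B * avg ω (cube c h)) / ENNReal.ofReal (ω x) := by gcongr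
        _ ≤ ENNReal.ofReal (B * Cw) := hdiv
        _ ≤ _ := le_self_add
  have hVp : ∫⁻ x in cube c h, V x ^ p ∂(wm ω) ≤ ENNReal.ofReal (1 - 1 / (2 * Cw)) * Φ * wm ω (cube c h) := by
    calc ∫⁻ x in cube c h, V x ^ p ∂(wm ω) = ∫⁻ x in S, V x ^ p ∂(wm ω) := by
          rw [← lintegral_indicator (measurableSet_cube _ _), ← lintegral_indicator hSm]
          congr 1; funext x
          by_cases hx : x ∈ S
          · simp [hx, hSQ hx]
          · by_cases hx' : x ∈ cube c h <;> simp [hx, hx', hV0 x hx, hp0]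
      _ = ∑' i : I, ∫⁻ x in cube (cc i) (r i), V x ^ p ∂(wm ω) :=
          lintegral_biUnion hIc (fun i _ => measurableSet_cube _ _) hdis _
      _ ≤ ∑' i : I, Φ * wm ω (cube (cc i) (r i)) := by
          refine ENNReal.tsum_le_tsum fun i => ?_
          refine le_trans (le_of_eq ?_) (hΦ (cc i) (r i) (hr i))
          refine setLIntegral_congr_fun (measurableSet_cube _ _) fun x hx => ?_
          simp only [hVi i i.2 x hx]
      _ = Φ * wm ω S := by
          rw [ENNReal.tsum_mul_left, hS, measure_biUnion hIc hdis (fun i _ => measurableSet_cube _ _)]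
      _ ≤ Φ * (ENNReal.ofReal (1 - 1 / (2 * Cw)) * wm ω (cube c h)) := by
          gcongr
          exact wm_small hCw hω0 hω hA c hh hSm hSQ hvol
      _ = _ := by ring
  calc (∫⁻ x in cube c h, UQ ω g M c h x ^ p ∂(wm ω)) ^ (1 / p)
      ≤ (∫⁻ x in cube c h, ((fun _ => ENNReal.ofReal (B * Cw) : Rn n → ℝ≥0∞) + V) x ^ p ∂(wm ω)) ^ (1 / p) := by
        refine ENNReal.rpow_le_rpow ?_ hip
        refine setLIntegral_mono_ae' (measurableSet_cube _ _) ?_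
        filter_upwards [hpt] with x hx hxc
        exact ENNReal.rpow_le_rpow (hx hxc) hp0.le
    _ ≤ (∫⁻ x in cube c h, ENNReal.ofReal (B * Cw) ^ p ∂(wm ω)) ^ (1 / p) +
        (∫⁻ x in cube c h, V x ^ p ∂(wm ω)) ^ (1 / p) :=
        ENNReal.lintegral_Lp_add_le aemeasurable_const hVm.restrict hp.le
    _ ≤ (ENNReal.ofReal (B * Cw) ^ p * wm ω (cube c h)) ^ (1 / p) +
        (ENNReal.ofReal (1 - 1 / (2 * Cw)) * Φ * wm ω (cube c h)) ^ (1 / p) := by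
        refine add_le_add (le_of_eq ?_) (ENNReal.rpow_le_rpow hVp hip)
        simp
    _ = _ := by
        rw [ENNReal.mul_rpow_of_nonneg _ _ hip, ENNReal.mul_rpow_of_nonneg _ _ hip, ← ENNReal.rpow_mul,
          mul_one_div_cancel hp0.ne', ENNReal.rpow_one, add_mul]


lemma absorb (hn : 1 ≤ n) {ω g : Rn n → ℝ} {Cw B p : ℝ} (hp : 1 < p) (hCw : 1 ≤ Cw) (hB : 0 < B) (hω0 : ∀ x, 0 ≤ ω x)
    (hω : LocallyIntegrable ω volume) (hpos : ∀ᵐ x ∂(volume : Measure (Rn n)), 0 < ω x) (hA : A1pt ω Cw)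
    (hg0 : ∀ x, 0 ≤ g x) (hg : Measurable g)
    (hosc : ∀ (c : Rn n) (h : ℝ), 0 < h → volume {x | x ∈ cube c h ∧
      essInf g (volume.restrict (cube c h)) + B * avg ω (cube c h) < g x} ≤
        ENNReal.ofReal (((2:ℝ) ^ (n + 2))⁻¹ * (2 * h) ^ n))
    (M : ℕ) (c : Rn n) {h : ℝ} (hh : 0 < h) :
    ((wm ω (cube c h))⁻¹ * ∫⁻ x in cube c h, UQ ω g M c h x ^ p ∂(wm ω)) ^ (1 / p) ≤
      ENNReal.ofReal (Cw / (1 - (1 - 1 / (2 * Cw)) ^ (1 / p)) * B) := by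
  have hp0 : 0 < p := by linarith
  have hip : 0 < 1 / p := by positivity
  have hwpos : ∀ (c : Rn n) (h : ℝ), 0 < h → wm ω (cube c h) ≠ 0 := by
    intro c h hh
    rw [wm_cube hω0 hω c hh]
    have := avg_pos hω0 hω hpos c hh
    simp only [ne_eq, ENNReal.ofReal_eq_zero, not_le]; positivity
  have hwfin : ∀ (c : Rn n) (h : ℝ), 0 < h → wm ω (cube c h) ≠ ⊤ := by
    intro c h hh
    rw [wm_cube hω0 hω c hh]; simp
  set Φ : ℝ≥0∞ := ⨆ (c : Rn n) (h : ℝ) (_ : 0 < h),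
    (wm ω (cube c h))⁻¹ * ∫⁻ x in cube c h, UQ ω g M c h x ^ p ∂(wm ω) with hΦdef
  have hle : ∀ (c : Rn n) (h : ℝ), 0 < h →
      (wm ω (cube c h))⁻¹ * ∫⁻ x in cube c h, UQ ω g M c h x ^ p ∂(wm ω) ≤ Φ := fun c h hh =>
    le_iSup_of_le c (le_iSup_of_le h (le_iSup_of_le hh le_rfl))
  have hΦ : ∀ (c : Rn n) (h : ℝ), 0 < h → ∫⁻ x in cube c h, UQ ω g M c h x ^ p ∂(wm ω) ≤ Φ * wm ω (cube c h) := by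
    intro c h hh
    calc ∫⁻ x in cube c h, UQ ω g M c h x ^ p ∂(wm ω)
        = ((wm ω (cube c h))⁻¹ * ∫⁻ x in cube c h, UQ ω g M c h x ^ p ∂(wm ω)) * wm ω (cube c h) := by
          rw [mul_comm, ← mul_assoc, ENNReal.mul_inv_cancel (hwpos c h hh) (hwfin c h hh), one_mul]
      _ ≤ _ := by gcongr; exact hle c h hh
  have hΦfin : Φ ≠ ⊤ := by
    refine ne_top_of_le_ne_top (b := (M:ℝ≥0∞) ^ p) (ENNReal.rpow_ne_top_of_nonneg hp0.le (by simp)) ?_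
    refine iSup_le fun c => iSup_le fun h => iSup_le fun hh => ?_
    calc (wm ω (cube c h))⁻¹ * ∫⁻ x in cube c h, UQ ω g M c h x ^ p ∂(wm ω)
        ≤ (wm ω (cube c h))⁻¹ * ∫⁻ x in cube c h, (M:ℝ≥0∞) ^ p ∂(wm ω) := by
          gcongr with x
          exact min_le_right _ _
      _ = (M:ℝ≥0∞) ^ p := by
          rw [setLIntegral_const, mul_comm, mul_assoc, ENNReal.mul_inv_cancel (hwpos c h hh) (hwfin c h hh), mul_one]
  set ρ : ℝ := 1 - 1 / (2 * Cw) with hρ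
  have hk : 1 / (2 * Cw) ≤ 1 := by rw [div_le_one (by positivity)]; linarith
  have hk0 : 0 < 1 / (2 * Cw) := by positivity
  have hρ0 : 0 ≤ ρ := by linarith
  have hρ1 : ρ < 1 := by linarith
  have hρp : ρ ^ (1 / p) < 1 := Real.rpow_lt_one hρ0 hρ1 hip
  have hρp0 : 0 ≤ ρ ^ (1 / p) := Real.rpow_nonneg hρ0 _
  have hstep : Φ ^ (1 / p) ≤ ENNReal.ofReal (B * Cw) + (ENNReal.ofReal ρ * Φ) ^ (1 / p) := by
    have h1 : Φ ≤ (ENNReal.ofReal (B * Cw) + (ENNReal.ofReal ρ * Φ) ^ (1 / p)) ^ p := by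
      refine iSup_le fun c => iSup_le fun h => iSup_le fun hh => ?_
      have h2 := one_step hn hp hCw hB hω0 hω hpos hA hg0 hg hosc hΦ c hh
      have h3 : ((wm ω (cube c h))⁻¹ * ∫⁻ x in cube c h, UQ ω g M c h x ^ p ∂(wm ω)) ^ (1 / p) ≤
          ENNReal.ofReal (B * Cw) + (ENNReal.ofReal ρ * Φ) ^ (1 / p) := by
        rw [ENNReal.mul_rpow_of_nonneg _ _ hip.le, ENNReal.inv_rpow]
        have hz : wm ω (cube c h) ^ (1 / p) ≠ 0 := by
          simp [ENNReal.rpow_eq_zero_iff, hwpos c h hh, hwfin c h hh]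
        have ht : wm ω (cube c h) ^ (1 / p) ≠ ⊤ := ENNReal.rpow_ne_top_of_nonneg hip.le (hwfin c h hh)
        rw [mul_comm, ← div_eq_mul_inv]
        exact ENNReal.div_le_of_le_mul h2
      have h4 := ENNReal.rpow_le_rpow h3 hp0.le
      rwa [← ENNReal.rpow_mul, one_div_mul_cancel hp0.ne', ENNReal.rpow_one] at h4
    have h5 := ENNReal.rpow_le_rpow h1 hip.le
    rwa [← ENNReal.rpow_mul, mul_one_div_cancel hp0.ne', ENNReal.rpow_one] at h5
  refine (ENNReal.rpow_le_rpow (hle c h hh) hip.le).trans ?_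
  rw [ENNReal.mul_rpow_of_nonneg _ _ hip.le, ENNReal.ofReal_rpow_of_nonneg hρ0 hip.le] at hstep
  have hφ : Φ ^ (1 / p) ≠ ⊤ := ENNReal.rpow_ne_top_of_nonneg hip.le hΦfin
  generalize Φ ^ (1 / p) = φ at hstep hφ
  rw [← ENNReal.ofReal_toReal hφ] at hstep ⊢
  rw [← ENNReal.ofReal_mul hρp0, ← ENNReal.ofReal_add (by positivity) (by positivity),
    ENNReal.ofReal_le_ofReal_iff (by positivity)] at hstep
  refine ENNReal.ofReal_le_ofReal ?_
  rw [div_mul_eq_mul_div, le_div_iff₀ (by linarith)]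
  linarith

lemma blo_le (hn : 1 ≤ n) {ω g : Rn n → ℝ} {Cw B p : ℝ} (hp : 1 < p) (hCw : 1 ≤ Cw) (hB : 0 < B) (hω0 : ∀ x, 0 ≤ ω x)
    (hω : LocallyIntegrable ω volume) (hpos : ∀ᵐ x ∂(volume : Measure (Rn n)), 0 < ω x) (hA : A1pt ω Cw)
    (hg0 : ∀ x, 0 ≤ g x) (hg : Measurable g)
    (hosc : ∀ (c : Rn n) (h : ℝ), 0 < h → volume {x | x ∈ cube c h ∧
      essInf g (volume.restrict (cube c h)) + B * avg ω (cube c h) < g x} ≤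
        ENNReal.ofReal (((2:ℝ) ^ (n + 2))⁻¹ * (2 * h) ^ n)) :
    bloPNorm p ω g ≤ ENNReal.ofReal (Cw / (1 - (1 - 1 / (2 * Cw)) ^ (1 / p)) * B) := by
  have hp0 : 0 < p := by linarith
  have hip : 0 < 1 / p := by positivity
  have hac : wm ω ≪ volume := withDensity_absolutelyContinuous _ _
  refine iSup_le fun c => iSup_le fun h => iSup_le fun hh => ?_
  have e1 : ENNReal.ofReal (wInt ω (cube c h)) = wm ω (cube c h) := by
    rw [wm_cube hω0 hω c hh, wInt, setIntegral_cube_eq_avg ω c hh]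
  set U : Rn n → ℝ≥0∞ := fun x => ENNReal.ofReal (g x - essInf g (volume.restrict (cube c h))) / ENNReal.ofReal (ω x) with hU
  have e2 : ∫⁻ x in cube c h, ENNReal.ofReal ((g x - essInf g (volume.restrict (cube c h))) ^ p * (ω x) ^ (1 - p)) =
      ∫⁻ x in cube c h, U x ^ p ∂(wm ω) := by
    rw [wm, setLIntegral_withDensity_eq_setLIntegral_mul_non_measurable₀ _
      (hω.aestronglyMeasurable.aemeasurable.ennreal_ofReal.restrict) _ (measurableSet_cube _ _)
      (Filter.Eventually.of_forall fun x => ENNReal.ofReal_lt_top)]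
    refine lintegral_congr_ae ?_
    filter_upwards [essInf_le_ae (μ := volume.restrict (cube c h)) hg0, ae_restrict_of_ae hpos] with x hx1 hx2
    simp only [hU, Pi.mul_apply]
    rw [← ENNReal.ofReal_div_of_pos hx2]
    have h0 : 0 ≤ g x - essInf g (volume.restrict (cube c h)) := by linarith
    rw [ENNReal.ofReal_rpow_of_nonneg (by positivity) hp0.le, ← ENNReal.ofReal_mul hx2.le]
    congr 1
    rw [Real.div_rpow h0 hx2.le, Real.rpow_sub hx2, Real.rpow_one]
    ring
  rw [e1, e2]
  have hlim : Filter.Tendsto (fun M : ℕ => ∫⁻ x in cube c h, UQ ω g M c h x ^ p ∂(wm ω)) Filter.atTop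
      (nhds (∫⁻ x in cube c h, U x ^ p ∂(wm ω))) := by
    refine lintegral_tendsto_of_tendsto_of_monotone ?_ ?_ ?_
    · exact fun M => ((UQ_aem hω hg M c h).pow_const p).restrict
    · refine Filter.Eventually.of_forall fun x M M' hM => ?_
      refine ENNReal.rpow_le_rpow ?_ hp0.le
      unfold UQ
      refine min_le_min le_rfl ?_
      exact_mod_cast hM
    · refine ae_restrict_of_ae (hac.ae_le ?_)
      filter_upwards [hpos] with x hx
      have hfin : U x ≠ ⊤ := by
        simp only [hU]
        rw [← ENNReal.ofReal_div_of_pos hx]; simp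
      obtain ⟨m, hm⟩ := ENNReal.exists_nat_gt hfin
      refine tendsto_const_nhds.congr' ?_
      filter_upwards [Filter.eventually_ge_atTop m] with M hM
      have : U x ≤ M := hm.le.trans (by exact_mod_cast hM)
      unfold UQ
      rw [min_eq_left this]
  have hw0 : wm ω (cube c h) ≠ 0 := by
    rw [wm_cube hω0 hω c hh]
    have := avg_pos hω0 hω hpos c hh
    simp only [ne_eq, ENNReal.ofReal_eq_zero, not_le]; positivity
  have hlim2 := ENNReal.Tendsto.const_mul (a := (wm ω (cube c h))⁻¹) hlim (Or.inr (by simpa using hw0))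
  have hlim3 := hlim2.ennrpow_const (1 / p)
  exact le_of_tendsto' hlim3 fun M => absorb hn hp hCw hB hω0 hω hpos hA hg0 hg hosc M c hh

lemma a1pt_of {ω : Rn n → ℝ} {Cw : ℝ} (hω0 : ∀ x, 0 ≤ ω x) (hA : A1cubeBound ω Cw) : A1pt ω Cw := by
  intro c h hh
  have h1 := (ae_restrict_iff' (measurableSet_cube _ _)).1 (essInf_le_ae (μ := volume.restrict (cube c h)) hω0)
  filter_upwards [h1] with x hx hxc
  exact (hA.2 c h hh).trans (mul_le_mul_of_nonneg_left (hx hxc) hA.1.le)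

lemma bmo1_of {ω f : Rn n → ℝ} {p N : ℝ} (hp : 1 < p) (hω0 : ∀ x, 0 ≤ ω x)
    (hω : LocallyIntegrable ω volume) (hpos : ∀ᵐ x ∂(volume : Measure (Rn n)), 0 < ω x)
    (hf : LocallyIntegrable f volume) (hN : 0 ≤ N) (hB : bmoPNorm p ω f ≤ ENNReal.ofReal N) : BMO1 ω f N := by
  intro c h hh
  have hp0 : 0 < p := by linarith
  have hip : 0 < 1 / p := by positivity
  have hpq := Real.HolderConjugate.conjExponent hp
  set q := Real.conjExponent p with hq
  have hq0 : 0 < q := hpq.symm.pos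
  have hiq : 1 / p + 1 / q = 1 := by
    have := hpq.inv_add_inv_eq_one
    simpa [one_div] using this
  have hωm : AEMeasurable ω volume := hω.aestronglyMeasurable.aemeasurable
  have hfm : AEMeasurable f volume := hf.aestronglyMeasurable.aemeasurable
  set a := avg f (cube c h) with ha
  set w := ∫ x in cube c h, ω x with hw
  have hw0 : 0 < w := by
    have := avg_pos hω0 hω hpos c hh
    rw [hw, setIntegral_cube_eq_avg ω c hh]; positivity
  set X := ∫⁻ x in cube c h, ENNReal.ofReal (|f x - a| ^ p * (ω x) ^ (1 - p)) with hX
  have h1 : ((ENNReal.ofReal w)⁻¹ * X) ^ (1 / p) ≤ ENNReal.ofReal N := by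
    refine le_trans ?_ hB
    exact le_iSup_of_le c (le_iSup_of_le h (le_iSup_of_le hh le_rfl))
  have hwz : ENNReal.ofReal w ≠ 0 := by simpa using hw0
  have h2 : X ^ (1 / p) ≤ ENNReal.ofReal N * ENNReal.ofReal w ^ (1 / p) := by
    rw [ENNReal.mul_rpow_of_nonneg _ _ hip.le, ENNReal.inv_rpow, mul_comm, ← div_eq_mul_inv] at h1
    rwa [ENNReal.div_le_iff (by simp [ENNReal.rpow_eq_zero_iff, hw0]) (ENNReal.rpow_ne_top_of_nonneg hip.le (by simp))] at h1
  have hH := ENNReal.lintegral_mul_le_Lp_mul_Lq (volume.restrict (cube c h)) hpq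
    (f := fun x => ENNReal.ofReal (|f x - a| * ω x ^ ((1 - p) / p))) (g := fun x => ENNReal.ofReal (ω x ^ (1 / q)))
    (by
      refine AEMeasurable.restrict ?_
      fun_prop) (by
      refine AEMeasurable.restrict ?_
      fun_prop)
  have hqe : 1 / q = (p - 1) / p := by
    rw [sub_div, div_self hp0.ne']; linarith
  have e1 : ∫⁻ x in cube c h, ((fun x => ENNReal.ofReal (|f x - a| * ω x ^ ((1 - p) / p))) *
      (fun x => ENNReal.ofReal (ω x ^ (1 / q)))) x = ∫⁻ x in cube c h, ENNReal.ofReal |f x - a| := by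
    refine lintegral_congr_ae ?_
    filter_upwards [ae_restrict_of_ae hpos] with x hx
    simp only [Pi.mul_apply]
    rw [← ENNReal.ofReal_mul (by positivity), mul_assoc, ← Real.rpow_add hx, hqe]
    congr 1
    rw [show (1 - p) / p + (p - 1) / p = 0 by ring, Real.rpow_zero, mul_one]
  have e2 : ∫⁻ x in cube c h, (fun x => ENNReal.ofReal (|f x - a| * ω x ^ ((1 - p) / p))) x ^ p = X := by
    refine lintegral_congr_ae ?_
    filter_upwards [ae_restrict_of_ae hpos] with x hx
    rw [ENNReal.ofReal_rpow_of_nonneg (by positivity) hp0.le, Real.mul_rpow (by positivity) (by positivity),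
      ← Real.rpow_mul hx.le, div_mul_cancel₀ _ hp0.ne']
  have e3 : ∫⁻ x in cube c h, (fun x => ENNReal.ofReal (ω x ^ (1 / q))) x ^ q = ENNReal.ofReal w := by
    rw [hw, ofReal_integral_eq_lintegral_ofReal (integrableOn_cube hω c hh.le) (Filter.Eventually.of_forall hω0)]
    refine lintegral_congr fun x => ?_
    have := hω0 x
    rw [ENNReal.ofReal_rpow_of_nonneg (by positivity) hq0.le, ← Real.rpow_mul this, one_div_mul_cancel hq0.ne', Real.rpow_one]
  rw [e1, e2, e3] at hH
  have hIntg : IntegrableOn (fun z => |f z - a|) (cube c h) :=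
    ((integrableOn_cube hf c hh.le).sub (integrableOn_const (volume_cube_ne_top _ hh))).abs
  rw [← ofReal_integral_eq_lintegral_ofReal hIntg (Filter.Eventually.of_forall fun x => abs_nonneg _)] at hH
  have h3 : ENNReal.ofReal (∫ x in cube c h, |f x - a|) ≤ ENNReal.ofReal (N * w) := by
    refine hH.trans ?_
    calc X ^ (1 / p) * ENNReal.ofReal w ^ (1 / q) ≤ ENNReal.ofReal N * ENNReal.ofReal w ^ (1 / p) * ENNReal.ofReal w ^ (1 / q) := by gcongr
      _ = _ := by
        rw [mul_assoc, ← ENNReal.rpow_add _ _ hwz (by simp), hiq, ENNReal.rpow_one, ENNReal.ofReal_mul hN]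
  exact (ENNReal.ofReal_le_ofReal_iff (by positivity)).1 h3

theorem bmoP_bloP_of_Gstar (n : ℕ) (hn : 1 ≤ n) (C₁ C₂ δ γ : ℝ)
    (hC₁ : 0 < C₁) (hC₂ : 0 < C₂) (hδ : 0 < δ) (hγ : 0 < γ)
    (ψ : Rn n → ℝ) (hψ : PsiKernel n C₁ C₂ δ γ ψ)
    (lam : ℝ) (hlam : 2 < lam) (hlamn : (lam - 3) * (n : ℝ) > 2 * δ + 2 * γ)
    (p : ℝ) (hp : 1 < p)
    (ω : Rn n → ℝ) (hω : IsWeight ω) (hA1 : IsA1cube ω) :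
    ∃ C : ℝ, 0 < C ∧ ∀ f : Rn n → ℝ, LocallyIntegrable f volume →
      bmoPNorm p ω f < ⊤ →
        ∀ x₀ : Rn n, Gstar ψ lam f x₀ < ⊤ →
          (∀ᵐ x ∂(volume : Measure (Rn n)), Gstar ψ lam f x < ⊤) ∧
          bloPNorm p ω (fun x => (Gstar ψ lam f x).toReal) ≤
            ENNReal.ofReal C * bmoPNorm p ω f := by
  obtain ⟨hω0, hωl, hpos⟩ := hω
  obtain ⟨Cw, hAb⟩ := hA1
  have hCw0 : 0 < Cw := hAb.1
  have hA : A1pt ω Cw := a1pt_of hω0 hAb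
  have hCw : 1 ≤ Cw := by
    have h1 := avg_mono hωl hA (c := 0) (c' := 0) one_pos one_pos subset_rfl
    have h2 := avg_pos hω0 hωl hpos (0 : Rn n) one_pos
    nlinarith
  have hψm : Measurable ψ := psi_measurable hγ hψ
  obtain ⟨K, hK, hosc⟩ := osc_weak hn hC₁ hC₂ hδ hγ hψ hlam hlamn hCw0 hω0 hωl hpos hA
    (η := ((2:ℝ) ^ (n + 2))⁻¹) (by positivity)
  have hip : 0 < 1 / p := by positivity
  set D : ℝ := Cw / (1 - (1 - 1 / (2 * Cw)) ^ (1 / p)) with hD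
  have hk : 1 / (2 * Cw) ≤ 1 := by rw [div_le_one (by positivity)]; linarith
  have hk0 : 0 < 1 / (2 * Cw) := by positivity
  have hρp : (1 - 1 / (2 * Cw)) ^ (1 / p) < 1 := Real.rpow_lt_one (by linarith) (by linarith) hip
  have hD0 : 0 < D := div_pos hCw0 (by linarith)
  refine ⟨D * K, by positivity, fun f hf hfb x₀ hx₀ => ?_⟩
  set b := (bmoPNorm p ω f).toReal with hb
  have hb0 : 0 ≤ b := ENNReal.toReal_nonneg
  have hBM : ∀ N, b < N → BMO1 ω f N := fun N hN => by
    refine bmo1_of hp hω0 hωl hpos hf (by linarith) ?_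
    rw [← ENNReal.ofReal_toReal hfb.ne]
    exact ENNReal.ofReal_le_ofReal hN.le
  have hfin := finite_ae hn hC₁ hC₂ hδ hγ hψ hlam hlamn hCw0 hω0 hωl hpos hA hf (N := b + 1) (by linarith)
    (hBM _ (by linarith)) hx₀
  refine ⟨hfin, ?_⟩
  have hgm : Measurable (fun x => (Gstar ψ lam f x).toReal) :=
    (Gstar_measurable hψm lam hf.aestronglyMeasurable).ennreal_toReal
  have hall : ∀ N, b < N → bloPNorm p ω (fun x => (Gstar ψ lam f x).toReal) ≤ ENNReal.ofReal (D * K * N) := by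
    intro N hN
    have hN0 : 0 < N := by linarith
    have := blo_le hn hp hCw (B := K * N) (by positivity) hω0 hωl hpos hA
      (g := fun x => (Gstar ψ lam f x).toReal) (fun x => ENNReal.toReal_nonneg) hgm ?_
    · rwa [← hD, ← mul_assoc] at this
    · intro c h hh
      have h1 := hosc f N hf hN0 (hBM N hN) hfin c h hh
      simpa only [mul_assoc] using h1
  rw [← ENNReal.ofReal_toReal hfb.ne, ← ENNReal.ofReal_mul (by positivity)]
  have hlim : Filter.Tendsto (fun N : ℝ => ENNReal.ofReal (D * K * N)) (nhdsWithin b (Ioi b))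
      (nhds (ENNReal.ofReal (D * K * b))) := by
    refine ENNReal.tendsto_ofReal ?_
    exact ((continuous_const.mul continuous_id).tendsto b).mono_left nhdsWithin_le_nhds
  refine ge_of_tendsto hlim ?_
  filter_upwards [self_mem_nhdsWithin] with N hN
  exact hall N hN

end LPW
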